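/- For the torus control system (lifted to ℝ^d × ℝ^d) with Hamiltonians H_u(q,p) = |p|²/2 + V_0(q) + Σ_{j=1}^d (u_{2j−1} cos(k_j·q) + u_{2j} sin(k_j·q)), the Liouville equation is small-time approximately controllable in L^r: for every r ∈ [1,∞) and all torus densities ρ0, ρ1, we have [for every ε > 0 there exist τ ∈ [0,ε] and a piecewise constant control u(·) on [0,τ] with ‖ρ0 ∘ Φ^τ_{H_u} − ρ1‖_{L^r(Q)} < ε] if and only if for all real numbers μ < ν the Lebesgue measure of {μ < ρ0 < ν} ∩ Q equals the Lebesgue measure of {μ < ρ1 < ν} ∩ Q. -/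

import Mathlib

open MeasureTheory Real

noncomputable section

/-- The phase space `T*ℝ^d = ℝ^d × ℝ^d` (positions `q` and momenta `p`),
identified with `ℝ^{2d}` with the sup norm and the Lebesgue (symplectic volume) measure. -/
abbrev Phase (d : ℕ) := (Fin d → ℝ) × (Fin d → ℝ)

/-- The Hamiltonian vector field of a function `H : Phase d → ℝ`:
`H⃗(q,p) = (∂_p H(q,p), −∂_q H(q,p))`. -/
def hamVF {d : ℕ} (H : Phase d → ℝ) (x : Phase d) : Phase d :=
  (fun i => fderiv ℝ H x (0, Pi.single i 1),
   fun i => -(fderiv ℝ H x (Pi.single i 1, 0)))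

/-- `φ` is the global flow of the (complete) vector field `X`. -/
def IsFlowOf {d : ℕ} (X : Phase d → Phase d) (φ : ℝ → Phase d → Phase d) : Prop :=
  (∀ x, φ 0 x = x) ∧ ∀ x t, HasDerivAt (fun s => φ s x) (X (φ t x)) t

/-- `Φ` is a smooth diffeomorphism of phase space. -/
def IsDiffeo {d : ℕ} (Φ : Phase d → Phase d) : Prop :=
  ContDiff ℝ (⊤ : ℕ∞) Φ ∧
    ∃ Ψ, ContDiff ℝ (⊤ : ℕ∞) Ψ ∧ Function.LeftInverse Ψ Φ ∧ Function.RightInverse Ψ Φ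

/-- `Φ` is a Hamiltonian diffeomorphism of `T*ℝ^d`: a smooth diffeomorphism which is the
time-1 flow map of a smooth time-dependent Hamiltonian whose non-autonomous Hamiltonian flow
is defined on `[0,1]` from every initial point. -/
def IsHamDiffeo {d : ℕ} (Φ : Phase d → Phase d) : Prop :=
  IsDiffeo Φ ∧
  ∃ (H : ℝ → Phase d → ℝ) (φ : ℝ → Phase d → Phase d),
    ContDiff ℝ (⊤ : ℕ∞) (fun z : ℝ × Phase d => H z.1 z.2) ∧
    (∀ x, φ 0 x = x) ∧
    (∀ x, ∀ t ∈ Set.Icc (0:ℝ) 1,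
      HasDerivWithinAt (fun s => φ s x) (hamVF (H t) (φ t x)) (Set.Icc (0:ℝ) 1) t) ∧
    Φ = φ 1

/-- `Φ` is the flow map from time `0` to time `τ` of the time-dependent Hamiltonian vector
field `H⃗_{u(t)}` for some piecewise constant control `u(·) : [0,τ] → U` (finitely many
pieces): i.e. `Φ` is a finite composition of flows of the autonomous fields `H⃗_{u_i}`
for nonnegative durations summing to `τ`. -/
def Reachable {d : ℕ} {U : Type*} (Ham : U → Phase d → ℝ) (τ : ℝ)
    (Φ : Phase d → Phase d) : Prop :=
  ∃ (n : ℕ) (dur : Fin n → ℝ) (u : Fin n → U) (φ : Fin n → ℝ → Phase d → Phase d),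
    (∀ i, 0 ≤ dur i) ∧ (∑ i, dur i) = τ ∧
    (∀ i, IsFlowOf (hamVF (Ham (u i))) (φ i)) ∧
    Φ = (List.ofFn (fun i => φ i (dur i))).foldl (fun g f => f ∘ g) id

/-- `‖Φ − Ψ‖_{C^ℓ(K)} < ε`: all iterated derivatives of the difference up to order `ℓ`
are smaller than `ε` on `K`. -/
def CloseCl {d : ℕ} (ℓ : ℕ) (K : Set (Phase d)) (ε : ℝ) (Φ Ψ : Phase d → Phase d) : Prop :=
  ∀ j ≤ ℓ, ∀ x ∈ K, ‖iteratedFDeriv ℝ j (fun y => Φ y - Ψ y) x‖ < ε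

/-- `Ψ ∈ R̄_st`: the diffeomorphism `Ψ` is small-time approximately reachable for the
control system with controlled Hamiltonians `Ham u`, `u ∈ U`. -/
def SmallTimeReachable {d : ℕ} {U : Type*} (Ham : U → Phase d → ℝ)
    (Ψ : Phase d → Phase d) : Prop :=
  ∀ ε > 0, ∀ K : Set (Phase d), IsCompact K → ∀ ℓ : ℕ,
    ∃ τ ∈ Set.Icc (0:ℝ) ε, ∃ Φ, Reachable Ham τ Φ ∧ CloseCl ℓ K ε Φ Ψ

/-- A function `f` with complete Hamiltonian vector field is STAR (small-time approximately
reachable) if its flow at every time `s ∈ ℝ` belongs to `R̄_st`. -/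
def IsSTAR {d : ℕ} {U : Type*} (Ham : U → Phase d → ℝ) (f : Phase d → ℝ) : Prop :=
  (∃ φ, IsFlowOf (hamVF f) φ) ∧
  ∀ φ, IsFlowOf (hamVF f) φ → ∀ s : ℝ, SmallTimeReachable Ham (φ s)

/-- The Poisson bracket `{f,g} = Σ_j (∂_{p_j} f ∂_{q_j} g − ∂_{q_j} f ∂_{p_j} g)`. -/
def poissonBracket {d : ℕ} (f g : Phase d → ℝ) : Phase d → ℝ :=
  fun x => ∑ j, (fderiv ℝ f x (0, Pi.single j 1) * fderiv ℝ g x (Pi.single j 1, 0)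
      - fderiv ℝ f x (Pi.single j 1, 0) * fderiv ℝ g x (0, Pi.single j 1))

/-- The mechanical Hamiltonian `H_u(q,p) = |p|²/2 + V_0(q) + Σ_j u_j V_j(q)`. -/
def mechHam {d m : ℕ} (V0 : (Fin d → ℝ) → ℝ) (V : Fin m → (Fin d → ℝ) → ℝ)
    (u : Fin m → ℝ) : Phase d → ℝ :=
  fun x => (∑ i, (x.2 i) ^ 2) / 2 + V0 x.1 + ∑ j, u j * V j x.1

/-- The Euclidean controlled Hamiltonian
`H_u(q,p) = |p|²/2 + V_0(q) + Σ_{j=1}^d u_j q_j + u_{d+1} e^{−|q|²/2}`,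
with control `u ∈ ℝ^d × ℝ ≃ ℝ^{d+1}`. -/
def eucHam {d : ℕ} (V0 : (Fin d → ℝ) → ℝ) (u : (Fin d → ℝ) × ℝ) : Phase d → ℝ :=
  fun x => (∑ i, (x.2 i) ^ 2) / 2 + V0 x.1 + (∑ j, u.1 j * x.1 j)
    + u.2 * Real.exp (-(∑ i, (x.1 i) ^ 2) / 2)

/-- The frequencies `k_1 = e_1, …, k_{d−1} = e_{d−1}, k_d = (1,…,1)`. -/
def kvec (d : ℕ) (j : Fin d) : Fin d → ℝ :=
  if (j : ℕ) < d - 1 then Pi.single j 1 else fun _ => 1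

/-- The torus controlled Hamiltonian (lifted to `ℝ^d × ℝ^d`)
`H_u(q,p) = |p|²/2 + V_0(q) + Σ_{j=1}^d (u_{2j−1} cos(k_j·q) + u_{2j} sin(k_j·q))`,
with control `u ∈ (ℝ²)^d ≃ ℝ^{2d}`. -/
def torusHam {d : ℕ} (V0 : (Fin d → ℝ) → ℝ) (u : Fin d → ℝ × ℝ) : Phase d → ℝ :=
  fun x => (∑ i, (x.2 i) ^ 2) / 2 + V0 x.1 +
    ∑ j, ((u j).1 * Real.cos (∑ i, kvec d j i * x.1 i) +
          (u j).2 * Real.sin (∑ i, kvec d j i * x.1 i))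

/-- The vertical shear `(q,p) ↦ (q, p − ∇f(q))`. -/
def vshear {d : ℕ} (f : (Fin d → ℝ) → ℝ) : Phase d → Phase d :=
  fun x => (x.1, fun i => x.2 i - fderiv ℝ f x.1 (Pi.single i 1))

/-- The horizontal shear `(q,p) ↦ (q + ∇g(p), p)`. -/
def hshear {d : ℕ} (g : (Fin d → ℝ) → ℝ) : Phase d → Phase d :=
  fun x => (fun i => x.1 i + fderiv ℝ g x.2 (Pi.single i 1), x.2)

/-- `M` is a mesh of size `h`: the closed sup-norm cubes `C̄(m_n,h)` cover `ℝ^{2d}` and the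
open cubes `C(m_n,h)` are pairwise disjoint. -/
def IsMesh {d : ℕ} (h : ℝ) (M : ℕ → Phase d) : Prop :=
  (∀ x : Phase d, ∃ n, ‖x - M n‖ ≤ h) ∧
  ∀ n ℓ : ℕ, n ≠ ℓ →
    Disjoint {x : Phase d | ‖x - M n‖ < h} {x : Phase d | ‖x - M ℓ‖ < h}

/-- `F` is a permutation of the mesh `M` of size `h`: a bijection translating every open
cube of the mesh onto another one. -/
def IsMeshPermutation {d : ℕ} (h : ℝ) (M : ℕ → Phase d) (F : Phase d → Phase d) : Prop :=
  Function.Bijective F ∧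
  ∀ n : ℕ, ∃ ℓ : ℕ, ∀ x : Phase d, ‖x - M n‖ < h → F x = x + (M ℓ - M n)

/-- The fundamental domain `Q = [0,2π)^d × ℝ^d` of `T*𝕋^d` in `ℝ^d × ℝ^d`. -/
def torusBlock (d : ℕ) : Set (Phase d) :=
  {x : Phase d | ∀ i, 0 ≤ x.1 i ∧ x.1 i < 2 * Real.pi}

/-- A torus density of class `L^r`: a measurable function on `ℝ^d × ℝ^d`, `2π`-periodic in
each position variable, with finite `L^r` norm on the fundamental domain `Q`. -/
def IsTorusDensity {d : ℕ} (p : ENNReal) (ρ : Phase d → ℝ) : Prop :=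
  Measurable ρ ∧
  (∀ (q : Fin d → ℝ) (pp : Fin d → ℝ) (k : Fin d → ℤ),
    ρ (fun i => q i + 2 * Real.pi * (k i), pp) = ρ (q, pp)) ∧
  eLpNorm ρ p (volume.restrict (torusBlock d)) < ⊤

end

open MeasureTheory Real
set_option autoImplicit false
set_option linter.all false
set_option linter.unusedSimpArgs false
set_option linter.unusedVariables false

noncomputable section
namespace TL
variable {d : ℕ}

/-! ### Basics on the lattice and the reduction to the fundamental domain -/

def lat (k : Fin d → ℤ) : Phase d := (fun i => 2 * π * (k i), 0)
def kq (q : Fin d → ℝ) : Fin d → ℤ := fun i => ⌊q i / (2 * π)⌋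
def redq (q : Fin d → ℝ) : Fin d → ℝ := fun i => 2 * π * Int.fract (q i / (2 * π))
def red (x : Phase d) : Phase d := (redq x.1, x.2)
def volQ (d : ℕ) : Measure (Phase d) := volume.restrict (torusBlock d)

lemma redq_eq (q : Fin d → ℝ) (i : Fin d) : redq q i = q i - 2 * π * kq q i := by
  have := Real.pi_pos
  simp only [redq, kq, Int.fract]
  field_simp

lemma red_eq (x : Phase d) : red x = x - lat (kq x.1) := by
  ext i
  · simp [red, lat, redq_eq]
  · simp [red, lat]

lemma kq_add (q : Fin d → ℝ) (k : Fin d → ℤ) : kq (fun i => q i + 2 * π * k i) = kq q + k := by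
  funext i
  have := Real.pi_pos
  have h : (q i + 2 * π * k i) / (2 * π) = q i / (2 * π) + k i := by field_simp
  simp [kq, h]

lemma kq_add_lat (x : Phase d) (k : Fin d → ℤ) : kq (x + lat k).1 = kq x.1 + k := kq_add x.1 k

lemma redq_add (q : Fin d → ℝ) (k : Fin d → ℤ) : redq (fun i => q i + 2 * π * k i) = redq q := by
  funext i
  rw [redq_eq, kq_add, redq_eq]
  simp; ring

lemma red_add_lat (x : Phase d) (k : Fin d → ℤ) : red (x + lat k) = red x := by
  have := redq_add x.1 k
  simp only [red, lat, Prod.fst_add, Prod.snd_add, add_zero]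
  exact Prod.ext this rfl

lemma lat_neg (k : Fin d → ℤ) : lat (-k) = -lat k := by
  ext i <;> simp [lat]

lemma lat_zero : lat (0 : Fin d → ℤ) = 0 := by
  ext i <;> simp [lat]

lemma red_sub_lat (x : Phase d) (k : Fin d → ℤ) : red (x - lat k) = red x := by
  rw [sub_eq_add_neg, ← lat_neg, red_add_lat]

lemma red_red (x : Phase d) : red (red x) = red x := by
  conv_lhs => rw [red_eq x]
  exact red_sub_lat _ _

lemma redq_redq (q : Fin d → ℝ) : redq (redq q) = redq q :=
  congrArg Prod.fst (red_red (q, (0 : Fin d → ℝ)))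

lemma redq_mem (q : Fin d → ℝ) (i : Fin d) : 0 ≤ redq q i ∧ redq q i < 2 * π := by
  have := Real.pi_pos
  constructor
  · exact mul_nonneg (by positivity) (Int.fract_nonneg _)
  · have := Int.fract_lt_one (q i / (2 * π))
    simp only [redq]
    nlinarith

lemma red_mem (x : Phase d) : red x ∈ torusBlock d := fun i => redq_mem x.1 i

lemma redq_of_mem {q : Fin d → ℝ} (h : ∀ i, 0 ≤ q i ∧ q i < 2 * π) : redq q = q := by
  funext i
  have := Real.pi_pos
  have h2 : Int.fract (q i / (2 * π)) = q i / (2 * π) := by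
    rw [Int.fract_eq_self]
    constructor
    · exact div_nonneg (h i).1 (by positivity)
    · rw [div_lt_one (by positivity)]; exact (h i).2
  simp only [redq, h2]
  field_simp

lemma red_of_mem {x : Phase d} (h : x ∈ torusBlock d) : red x = x :=
  Prod.ext (redq_of_mem h) rfl

lemma mem_block_iff (x : Phase d) : x ∈ torusBlock d ↔ kq x.1 = 0 := by
  constructor
  · intro h
    have h1 := red_of_mem h
    funext i
    have h2 := congrFun (congrArg Prod.fst h1) i
    have h3 : redq x.1 i = x.1 i := h2
    rw [redq_eq] at h3
    have := Real.pi_pos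
    have h4 : (kq x.1 i : ℝ) = 0 := by
      have : 2 * π * (kq x.1 i : ℝ) = 0 := by linarith
      rcases mul_eq_zero.1 this with h | h
      · linarith
      · exact h
    exact_mod_cast h4
  · intro h
    have h1 := red_mem x
    rw [red_eq, h, lat_zero, sub_zero] at h1
    exact h1

lemma measurable_kq : Measurable (kq : (Fin d → ℝ) → _) := by
  refine measurable_pi_iff.2 fun i => ?_
  exact Int.measurable_floor.comp ((measurable_pi_apply i).div_const _)

lemma measurable_redq : Measurable (redq : (Fin d → ℝ) → _) := by
  refine measurable_pi_iff.2 fun i => ?_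
  exact (measurable_fract.comp ((measurable_pi_apply i).div_const _)).const_mul _

lemma measurable_red : Measurable (red : Phase d → _) :=
  (measurable_redq.comp measurable_fst).prodMk measurable_snd

lemma measurableSet_block : MeasurableSet (torusBlock d) := by
  have : torusBlock d = (fun x : Phase d => kq x.1) ⁻¹' {0} := by
    ext x; exact mem_block_iff x
  rw [this]
  exact (measurable_kq.comp measurable_fst) (measurableSet_singleton _)

lemma ae_volQ_mem : ∀ᵐ x ∂(volQ d), x ∈ torusBlock d := ae_restrict_mem measurableSet_block

lemma volume_wall (i : Fin d) (a : ℝ) : volume {x : Phase d | x.1 i = a} = 0 := by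
  have h1 : volume {q : Fin d → ℝ | q i = a} = 0 := by
    have := MeasureTheory.Measure.pi_hyperplane (fun _ : Fin d => (volume : Measure ℝ)) i a
    simpa [volume_pi] using this
  have h2 : {x : Phase d | x.1 i = a} = {q : Fin d → ℝ | q i = a} ×ˢ Set.univ := by
    ext; simp
  rw [h2, Measure.volume_eq_prod, Measure.prod_prod, h1, zero_mul]

lemma volume_wall2 (i : Fin d) (a : ℝ) : volume {x : Phase d | x.2 i = a} = 0 := by
  have h1 : volume {q : Fin d → ℝ | q i = a} = 0 := by
    have := MeasureTheory.Measure.pi_hyperplane (fun _ : Fin d => (volume : Measure ℝ)) i a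
    simpa [volume_pi] using this
  have h2 : {x : Phase d | x.2 i = a} = Set.univ ×ˢ {q : Fin d → ℝ | q i = a} := by
    ext; simp
  rw [h2, Measure.volume_eq_prod, Measure.prod_prod, h1, mul_zero]

instance haarPhase : (volume : Measure (Phase d)).IsAddHaarMeasure := by
  rw [Measure.volume_eq_prod]
  haveI : (volume : Measure (Fin d → ℝ)).IsAddHaarMeasure := inferInstance
  exact Measure.prod.instIsAddHaarMeasure _ _

lemma volQ_le : volQ d ≤ volume := Measure.restrict_le_self

/-- interior of Q -/
def IntQ (x : Phase d) : Prop := ∀ i, 0 < x.1 i ∧ x.1 i < 2 * π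

lemma ae_intQ : ∀ᵐ x ∂(volQ d), IntQ x := by
  have h : ∀ i : Fin d, ∀ᵐ x ∂(volQ d), x.1 i ≠ 0 := fun i => by
    have : volQ d {x | x.1 i = 0} = 0 :=
      le_antisymm ((volQ_le _).trans (volume_wall i 0).le) zero_le
    rw [ae_iff]; simpa using this
  filter_upwards [ae_volQ_mem, ae_all_iff.2 h] with x hx hx2 i
  exact ⟨lt_of_le_of_ne (hx i).1 (hx2 i).symm, (hx i).2⟩

lemma IntQ.mem {x : Phase d} (h : IntQ x) : x ∈ torusBlock d := fun i => ⟨(h i).1.le, (h i).2⟩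

lemma isOpen_intQ : IsOpen {x : Phase d | IntQ x} := by
  have : {x : Phase d | IntQ x} = ⋂ i, ({x | 0 < x.1 i} ∩ {x | x.1 i < 2 * π}) := by
    ext; simp [IntQ]
  rw [this]
  refine isOpen_iInter_of_finite fun i => ?_
  refine (isOpen_lt (by fun_prop) (by fun_prop)).inter (isOpen_lt (by fun_prop) (by fun_prop))

lemma continuousAt_redq {q : Fin d → ℝ} (h : ∀ i, 0 < redq q i) : ContinuousAt redq q := by
  refine continuousAt_pi.2 fun i => ?_
  have hh : ContinuousAt (fun q : Fin d → ℝ => Int.fract (q i / (2 * π))) q := by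
    have h1 : ContinuousAt (Int.fract : ℝ → ℝ) (q i / (2 * π)) := by
      refine continuousAt_fract ?_
      have h0 := h i
      simp only [redq] at h0
      intro h2
      have h3 : Int.fract (q i / (2 * π)) = 0 := by
        rw [Int.fract, sub_eq_zero]; exact h2
      rw [h3] at h0
      simp at h0
    exact ContinuousAt.comp (f := fun q : Fin d → ℝ => q i / (2 * π)) h1
      ((continuous_apply i).div_const _).continuousAt
  exact hh.const_mul _

lemma continuousAt_red {x : Phase d} (h : ∀ i, 0 < redq x.1 i) : ContinuousAt red x := by
  refine ContinuousAt.prodMk ?_ continuousAt_snd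
  exact ContinuousAt.comp (f := fun x : Phase d => x.1) (continuousAt_redq h) continuousAt_fst

/-! ### Admissible maps -/

structure Adm (Ψ : Phase d → Phase d) : Prop where
  meas : Measurable Ψ
  per : ∀ x, red (Ψ (red x)) = red (Ψ x)
  mp : MeasurePreserving (fun x => red (Ψ x)) (volQ d) (volQ d)

lemma red_ae_eq : (fun x : Phase d => red x) =ᵐ[volQ d] id := by
  filter_upwards [ae_volQ_mem] with x hx
  exact red_of_mem hx

lemma Adm.id : Adm (id : Phase d → Phase d) :=
  ⟨measurable_id, fun x => red_red x,
    (MeasurePreserving.id _).congr measurable_red red_ae_eq.symm⟩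

lemma Adm.comp {Ψ₁ Ψ₂ : Phase d → Phase d} (h1 : Adm Ψ₁) (h2 : Adm Ψ₂) : Adm (Ψ₁ ∘ Ψ₂) := by
  refine ⟨h1.meas.comp h2.meas, fun x => ?_, ?_⟩
  · simp only [Function.comp]
    rw [← h1.per (Ψ₂ (red x)), h2.per, h1.per]
  · have := h1.mp.comp h2.mp
    refine cast ?_ this
    congr 1
    funext x
    simp [Function.comp, h1.per]

lemma measure_tile (A : Set (Phase d)) (hA : MeasurableSet A) :
    volume A = ∑' k : Fin d → ℤ, volume (A ∩ {x | kq x.1 = k}) := by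
  rw [← measure_iUnion]
  · congr 1
    ext x; simp
  · intro i j hij
    refine Set.disjoint_left.2 ?_
    rintro x ⟨_, hx⟩ ⟨_, hx2⟩
    exact hij (hx.symm.trans hx2)
  · intro k
    exact hA.inter ((measurable_kq.comp measurable_fst) (measurableSet_singleton k))

lemma Adm.of_mp {Φ : Phase d → Phase d} (h : MeasurePreserving Φ volume volume)
    (hl : ∀ x k, Φ (x + lat k) = Φ x + lat k) : Adm Φ := by
  refine ⟨h.measurable, fun x => ?_, ?_⟩
  · have : red x = x + lat (-(kq x.1)) := by rw [lat_neg, red_eq]; abel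
    rw [this, hl, red_add_lat]
  refine ⟨measurable_red.comp h.measurable, ?_⟩
  ext E hE
  rw [Measure.map_apply (f := fun x => red (Φ x)) (measurable_red.comp h.measurable) hE]
  have hE' : MeasurableSet (red ⁻¹' E) := measurable_red hE
  have hm : ∀ k, MeasurableSet {x : Phase d | kq x.1 = k} := fun k =>
    (measurable_kq.comp measurable_fst) (measurableSet_singleton k)
  have hA : MeasurableSet ((fun x => red (Φ x)) ⁻¹' E) := (measurable_red.comp h.measurable) hE
  set A := (fun x => red (Φ x)) ⁻¹' E with hAdef
  have hQ : torusBlock d = {x | kq x.1 = 0} := by ext x; exact mem_block_iff x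
  rw [volQ, Measure.restrict_apply hA, Measure.restrict_apply hE, hQ]
  have hpre : ∀ k, MeasurableSet {x | kq (Φ x).1 = k} := fun k => h.measurable (hm k)
  have e1 : volume (A ∩ {x | kq x.1 = 0}) =
      ∑' k : Fin d → ℤ, volume (A ∩ {x | kq x.1 = 0} ∩ {x | kq (Φ x).1 = k}) := by
    rw [← measure_iUnion]
    · congr 1
      ext x; simp
    · intro i j hij
      refine Set.disjoint_left.2 ?_
      rintro x ⟨_, hx⟩ ⟨_, hx2⟩
      exact hij (hx.symm.trans hx2)
    · intro k
      exact (hA.inter (hm 0)).inter (hpre k)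
  have e2 : ∀ k : Fin d → ℤ, volume (A ∩ {x | kq x.1 = 0} ∩ {x | kq (Φ x).1 = k}) =
      volume (A ∩ {x | kq (Φ x).1 = 0} ∩ {x | kq x.1 = -k}) := by
    intro k
    rw [← measure_preimage_add_right volume (lat k)]
    congr 1
    ext x
    simp only [hAdef, Set.mem_preimage, Set.mem_inter_iff, Set.mem_setOf_eq, hl, red_add_lat,
      kq_add_lat]
    constructor
    · rintro ⟨⟨a, b⟩, c⟩
      exact ⟨⟨a, by simpa using c⟩, by rw [eq_neg_iff_add_eq_zero]; exact b⟩
    · rintro ⟨⟨a, b⟩, c⟩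
      exact ⟨⟨a, by rw [c]; simp⟩, by rw [b]; simp⟩
  have e3 : volume (A ∩ {x | kq (Φ x).1 = 0}) =
      ∑' k : Fin d → ℤ, volume (A ∩ {x | kq (Φ x).1 = 0} ∩ {x | kq x.1 = k}) :=
    measure_tile _ (hA.inter (hpre 0))
  have e5 := (Equiv.neg (Fin d → ℤ)).tsum_eq
    (fun k => volume (A ∩ {x | kq (Φ x).1 = 0} ∩ {x | kq x.1 = k}))
  simp only [Equiv.neg_apply] at e5
  rw [e1, tsum_congr e2, e5, ← e3]
  have e4 : A ∩ {x | kq (Φ x).1 = 0} = Φ ⁻¹' (E ∩ {x | kq x.1 = 0}) := by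
    ext x
    simp only [hAdef, Set.mem_preimage, Set.mem_inter_iff, Set.mem_setOf_eq]
    constructor
    · rintro ⟨a, b⟩
      rw [red_of_mem ((mem_block_iff _).2 b)] at a
      exact ⟨a, b⟩
    · rintro ⟨a, b⟩
      rw [red_of_mem ((mem_block_iff _).2 b)]
      exact ⟨a, b⟩
  rw [e4, h.measure_preimage (hE.inter (hm 0)).nullMeasurableSet]

/-! ### Torus functions -/

structure Tor (p : ENNReal) (f : Phase d → ℝ) : Prop where
  meas : Measurable f
  per : ∀ x, f (red x) = f x
  fin : eLpNorm f p (volQ d) < ⊤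

lemma Tor.of {p : ENNReal} {f : Phase d → ℝ} (h : IsTorusDensity p f) : Tor p f := by
  refine ⟨h.1, fun x => ?_, h.2.2⟩
  have := h.2.1 x.1 x.2 (-(kq x.1))
  rw [show red x = (fun i => x.1 i + 2 * π * ((-(kq x.1)) i : ℤ), x.2) from ?_]
  · exact this
  · rw [red_eq]; ext i
    · simp [lat]; ring
    · simp [lat]

variable {p : ENNReal}

lemma Tor.memLp {f : Phase d → ℝ} (h : Tor p f) : MemLp f p (volQ d) :=
  ⟨h.meas.aestronglyMeasurable, h.fin⟩

lemma eLpNorm_comp_adm {f : Phase d → ℝ} (hf : Measurable f) (hper : ∀ x, f (red x) = f x)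
    {Ψ : Phase d → Phase d} (hΨ : Adm Ψ) :
    eLpNorm (fun x => f (Ψ x)) p (volQ d) = eLpNorm f p (volQ d) := by
  have := eLpNorm_comp_measurePreserving (p := p) hf.aestronglyMeasurable hΨ.mp
  rw [← this]
  congr 1
  funext x
  simp [Function.comp, hper]

lemma per_comp {f : Phase d → ℝ} (hper : ∀ x, f (red x) = f x)
    {Ψ : Phase d → Phase d} (hΨ : Adm Ψ) (x : Phase d) : f (Ψ (red x)) = f (Ψ x) := by
  rw [← hper, hΨ.per, hper]

lemma Tor.comp {f : Phase d → ℝ} (h : Tor p f) {Ψ : Phase d → Phase d} (hΨ : Adm Ψ) :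
    Tor p (fun x => f (Ψ x)) :=
  ⟨h.meas.comp hΨ.meas, fun x => per_comp h.per hΨ x, by
    rw [eLpNorm_comp_adm h.meas h.per hΨ]; exact h.fin⟩

end TL
end

open MeasureTheory Real
set_option autoImplicit false
set_option linter.all false
set_option linter.unusedSimpArgs false
set_option linter.unusedVariables false

noncomputable section
namespace TL
variable {d : ℕ}

/-! ### Flows of mechanical fields -/

structure NF (g : (Fin d → ℝ) → (Fin d → ℝ)) (K : NNReal) (M : ℝ) : Prop where
  lip : LipschitzWith K g
  bdd : ∀ q, ‖g q‖ ≤ M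
  per : ∀ q (k : Fin d → ℤ), g (fun i => q i + 2 * π * k i) = g q

def fld (g : (Fin d → ℝ) → (Fin d → ℝ)) (x : Phase d) : Phase d := (x.2, -g x.1)

variable {g : (Fin d → ℝ) → (Fin d → ℝ)} {K : NNReal} {M : ℝ}

lemma NF.M_nonneg (h : NF g K M) : 0 ≤ M := (norm_nonneg _).trans (h.bdd 0)

lemma NF.lipd (h : NF g K M) (x y) : ‖g x - g y‖ ≤ K * ‖x - y‖ := by
  have := h.lip.dist_le_mul x y
  rwa [dist_eq_norm, dist_eq_norm] at this

lemma NF.lip_fld (h : NF g K M) : LipschitzWith (max 1 K) (fld g) := by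
  have h1 : LipschitzWith 1 (fun x : Phase d => x.2) := LipschitzWith.prod_snd
  have h2 : LipschitzWith K (fun x : Phase d => -g x.1) := by
    have := (h.lip.comp (LipschitzWith.prod_fst (α := Fin d → ℝ) (β := Fin d → ℝ))).neg
    rw [mul_one] at this
    exact this
  exact h1.prodMk h2

lemma mvt {E : Type*} [NormedAddCommGroup E] [NormedSpace ℝ E] {f f' : ℝ → E} {t C : ℝ}
    (h : ∀ s, HasDerivAt f (f' s) s) (hb : ∀ s, |s| ≤ |t| → ‖f' s‖ ≤ C) :
    ‖f t - f 0‖ ≤ C * |t| := by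
  have := Convex.norm_image_sub_le_of_norm_hasDerivWithin_le (s := Set.Icc (-|t|) |t|)
    (x := 0) (y := t) (f := f) (f' := f') (C := C)
    (fun x _ => (h x).hasDerivWithinAt) (fun x hx => hb x (abs_le.2 hx)) (convex_Icc _ _)
    ⟨by simp, by simp⟩ ⟨neg_abs_le t, le_abs_self t⟩
  simpa using this

lemma NF.exists_local (h : NF g K M) (x : Phase d) (T : ℝ) (hT : 0 < T) :
    ∃ γ : ℝ → Phase d, γ 0 = x ∧ ∀ t ∈ Set.Ioo (-T) T, HasDerivAt γ (fld g (γ t)) t := by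
  have hM := h.M_nonneg
  let f : ℝ → Phase d → Phase d := fun t y => (t • g (y.1 + t • y.2), -g (y.1 + t • y.2))
  obtain ⟨L, hL⟩ : ∃ z : NNReal, (z : ℝ) = (1 + T) * M :=
    ⟨⟨(1 + T) * M, by positivity⟩, rfl⟩
  obtain ⟨a, ha⟩ : ∃ z : NNReal, (z : ℝ) = (1 + T) * M * T :=
    ⟨⟨(1 + T) * M * T, by positivity⟩, rfl⟩
  obtain ⟨K', hK'⟩ : ∃ z : NNReal, (z : ℝ) = (1 + T) * (K * (1 + T)) :=
    ⟨⟨(1 + T) * (K * (1 + T)), by positivity⟩, rfl⟩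
  have ht0 : (0 : ℝ) ∈ Set.Icc (-T) T := ⟨by linarith, hT.le⟩
  have hPL : IsPicardLindelof f (⟨0, ht0⟩ : Set.Icc (-T) T) x a 0 L K' := by
    constructor
    · intro t ht
      refine LipschitzWith.lipschitzOnWith ?_
      refine LipschitzWith.of_dist_le_mul fun y z => ?_
      have hta : |t| ≤ T := abs_le.2 ht
      rw [dist_eq_norm, dist_eq_norm]
      have e1 : ‖(y.1 + t • y.2) - (z.1 + t • z.2)‖ ≤ (1 + T) * ‖y - z‖ := by
        have : (y.1 + t • y.2) - (z.1 + t • z.2) = (y - z).1 + t • (y - z).2 := by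
          simp only [Prod.fst_sub, Prod.snd_sub, smul_sub]; abel
        rw [this]
        refine (norm_add_le _ _).trans ?_
        rw [norm_smul, Real.norm_eq_abs]
        have := norm_fst_le (y - z)
        have := norm_snd_le (y - z)
        have := mul_le_mul hta this (norm_nonneg _) hT.le
        linarith
      have e2 := (h.lipd (y.1 + t • y.2) (z.1 + t • z.2)).trans
        (mul_le_mul_of_nonneg_left e1 K.2)
      have e3 : 0 ≤ (K : ℝ) * ((1 + T) * ‖y - z‖) := by positivity
      rw [Prod.norm_def]
      refine max_le ?_ ?_
      · simp only [f, Prod.fst_sub, ← smul_sub, norm_smul, Real.norm_eq_abs]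
        calc _ ≤ T * ((K : ℝ) * ((1 + T) * ‖y - z‖)) :=
              mul_le_mul hta e2 (norm_nonneg _) hT.le
          _ ≤ (1 + T) * ((K : ℝ) * ((1 + T) * ‖y - z‖)) := by nlinarith
          _ = _ := by rw [hK']; ring
      · simp only [f, Prod.snd_sub]
        rw [← norm_neg]
        have : -(-g (y.1 + t • y.2) - -g (z.1 + t • z.2)) =
          g (y.1 + t • y.2) - g (z.1 + t • z.2) := by abel
        rw [this]
        calc _ ≤ ((K : ℝ) * ((1 + T) * ‖y - z‖)) := e2
          _ ≤ (1 + T) * ((K : ℝ) * ((1 + T) * ‖y - z‖)) := by nlinarith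
          _ = _ := by rw [hK']; ring
    · intro y _
      have := h.lip.continuous
      apply Continuous.continuousOn
      simp only [f]
      fun_prop
    · intro t ht y _
      have hta : |t| ≤ T := abs_le.2 ht
      have := h.bdd (y.1 + t • y.2)
      rw [Prod.norm_def]
      refine max_le ?_ ?_
      · simp only [f, norm_smul, Real.norm_eq_abs, hL]
        have := mul_le_mul hta this (norm_nonneg _) hT.le
        nlinarith
      · simp only [f, norm_neg, hL]
        nlinarith
    · simp [hL, ha]
  obtain ⟨α, hα0, hα⟩ := hPL.exists_eq_forall_mem_Icc_hasDerivWithinAt₀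
  refine ⟨fun t => ((α t).1 + t • (α t).2, (α t).2), by simp [hα0], fun t ht => ?_⟩
  have h1 : HasDerivAt α (f t (α t)) t :=
    (hα t (Set.Ioo_subset_Icc_self ht)).hasDerivAt (Icc_mem_nhds ht.1 ht.2)
  have h2 : HasDerivAt (fun t => (α t).1) (f t (α t)).1 t := by
    have := (hasFDerivAt_fst (𝕜 := ℝ) (p := α t)).comp_hasDerivAt t h1
    exact this
  have h3 : HasDerivAt (fun t => (α t).2) (f t (α t)).2 t := by
    have := (hasFDerivAt_snd (𝕜 := ℝ) (p := α t)).comp_hasDerivAt t h1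
    exact this
  have h4 := h2.add ((hasDerivAt_id t).smul h3)
  have h5 := h4.prodMk h3
  refine h5.congr_deriv ?_
  simp only [f, fld, id]
  refine Prod.ext ?_ rfl
  simp

lemma NF.unique_Ioo (h : NF g K M) {γ δ : ℝ → Phase d} {T : ℝ} (hT : 0 < T)
    (h1 : ∀ t ∈ Set.Ioo (-T) T, HasDerivAt γ (fld g (γ t)) t)
    (h2 : ∀ t ∈ Set.Ioo (-T) T, HasDerivAt δ (fld g (δ t)) t) (h0 : γ 0 = δ 0) :
    Set.EqOn γ δ (Set.Ioo (-T) T) :=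
  ODE_solution_unique_of_mem_Ioo (v := fun _ => fld g) (s := fun _ => Set.univ) (t₀ := 0)
    (fun t _ => h.lip_fld.lipschitzOnWith) ⟨by linarith, hT⟩ (fun t ht => ⟨h1 t ht, trivial⟩)
    (fun t ht => ⟨h2 t ht, trivial⟩) h0

lemma NF.exists_flow (h : NF g K M) : ∃ φ, IsFlowOf (fld g) φ := by
  have hpos : ∀ n : ℕ, (0 : ℝ) < n + 1 := fun n => by positivity
  choose γ hγ0 hγ using fun (x : Phase d) (n : ℕ) => h.exists_local x (n + 1) (hpos n)
  have hag : ∀ x (m n : ℕ), m ≤ n → ∀ t ∈ Set.Ioo (-(m + 1 : ℝ)) (m + 1), γ x m t = γ x n t := by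
    intro x m n hmn t ht
    have hmn' : (m : ℝ) ≤ n := by exact_mod_cast hmn
    refine h.unique_Ioo (hpos m) (hγ x m) (fun t ht => hγ x n t ?_) ?_ ht
    · exact ⟨by linarith [ht.1], by linarith [ht.2]⟩
    · rw [hγ0, hγ0]
  refine ⟨fun t x => γ x ⌈|t|⌉₊ t, fun x => by simp [hγ0], fun x t => ?_⟩
  set N := ⌈|t|⌉₊ with hN
  have htN : |t| ≤ N := Nat.le_ceil _
  have htI : t ∈ Set.Ioo (-(N + 1 : ℝ)) (N + 1) := by
    have := abs_le.1 htN
    exact ⟨by linarith, by linarith⟩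
  refine (hγ x N t htI).congr_of_eventuallyEq ?_
  filter_upwards [Ioo_mem_nhds htI.1 htI.2] with s hs
  have hs' : |s| ≤ ⌈|s|⌉₊ := Nat.le_ceil _
  have hsI : s ∈ Set.Ioo (-((⌈|s|⌉₊ : ℕ) + 1 : ℝ)) ((⌈|s|⌉₊ : ℕ) + 1) := by
    have := abs_le.1 hs'
    exact ⟨by linarith, by linarith⟩
  rcases le_total ⌈|s|⌉₊ N with h1 | h1
  · exact hag x _ _ h1 s hsI
  · exact (hag x _ _ h1 s hs).symm

section flow
variable {φ : ℝ → Phase d → Phase d}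

lemma NF.flow_unique (h : NF g K M) (hφ : IsFlowOf (fld g) φ) {γ : ℝ → Phase d} 
    (hγ : ∀ t, HasDerivAt γ (fld g (γ t)) t) (t : ℝ) : γ t = φ t (γ 0) := by
  have := ODE_solution_unique_univ (v := fun _ => fld g) (s := fun _ => Set.univ) (t₀ := 0)
    (fun t => h.lip_fld.lipschitzOnWith) (fun t => ⟨hγ t, trivial⟩)
    (fun t => ⟨hφ.2 (γ 0) t, trivial⟩) (by simp [hφ.1])
  exact congrFun this t

lemma NF.flow_add (h : NF g K M) (hφ : IsFlowOf (fld g) φ) (s t : ℝ) (x : Phase d) :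
    φ (s + t) x = φ s (φ t x) := by
  have := h.flow_unique hφ (γ := fun s => φ (s + t) x) (fun s => by
    have := (hφ.2 x (s + t)).comp_add_const s t
    exact this) s
  simpa using this

lemma NF.flow_neg (h : NF g K M) (hφ : IsFlowOf (fld g) φ) (t : ℝ) (x : Phase d) :
    φ (-t) (φ t x) = x := by
  rw [← h.flow_add hφ, neg_add_cancel, hφ.1]

lemma NF.flow_lat (h : NF g K M) (hφ : IsFlowOf (fld g) φ) (t : ℝ) (x : Phase d)
    (k : Fin d → ℤ) : φ t (x + lat k) = φ t x + lat k := by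
  have := h.flow_unique hφ (γ := fun s => φ s x + lat k) (fun s => by
    have h1 := (hφ.2 x s).add_const (lat k)
    have h2 : fld g (φ s x + lat k) = fld g (φ s x) := by
      refine Prod.ext ?_ ?_
      · simp [fld, lat]
      · have := h.per (φ s x).1 k
        simp only [fld, lat, Prod.fst_add]
        exact congrArg _ this
    rw [h2]; exact h1) t
  simp only [hφ.1] at this
  exact this.symm

lemma flow_fst (hφ : IsFlowOf (fld g) φ) (x : Phase d) (t : ℝ) :
    HasDerivAt (fun s => (φ s x).1) (φ t x).2 t := by
  have := (hasFDerivAt_fst (𝕜 := ℝ) (p := φ t x)).comp_hasDerivAt t (hφ.2 x t)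
  exact this

lemma flow_snd (hφ : IsFlowOf (fld g) φ) (x : Phase d) (t : ℝ) :
    HasDerivAt (fun s => (φ s x).2) (-g (φ t x).1) t := by
  have := (hasFDerivAt_snd (𝕜 := ℝ) (p := φ t x)).comp_hasDerivAt t (hφ.2 x t)
  exact this

lemma NF.flow_p (h : NF g K M) (hφ : IsFlowOf (fld g) φ) (x : Phase d) (t : ℝ) :
    ‖(φ t x).2 - x.2‖ ≤ M * |t| := by
  have := mvt (t := t) (flow_snd hφ x) (C := M) (fun s _ => by rw [norm_neg]; exact h.bdd _)
  simpa [hφ.1] using this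

lemma NF.flow_q (h : NF g K M) (hφ : IsFlowOf (fld g) φ) (x : Phase d) (t : ℝ) :
    ‖(φ t x).1 - x.1 - t • x.2‖ ≤ M * |t| ^ 2 := by
  have h1 : ∀ s, HasDerivAt (fun s => (φ s x).1 - s • x.2) ((φ s x).2 - x.2) s := fun s => by
    have := (flow_fst hφ x s).sub ((hasDerivAt_id s).smul_const x.2)
    rw [one_smul] at this
    exact this
  have := mvt (t := t) h1 (C := M * |t|) (fun s hs => (h.flow_p hφ x s).trans
    (mul_le_mul_of_nonneg_left hs h.M_nonneg))
  simp only [hφ.1, zero_smul, sub_zero] at this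
  calc _ = ‖(φ t x).1 - t • x.2 - x.1‖ := by congr 1; abel
    _ ≤ _ := this
    _ = _ := by ring

/-- refined momentum estimate -/
lemma NF.flow_p2 (h : NF g K M) (hφ : IsFlowOf (fld g) φ) (x : Phase d) (t : ℝ)
    (q' : Fin d → ℝ) (D : ℝ) (hD : ∀ s, |s| ≤ |t| → ‖(φ s x).1 - q'‖ ≤ D) :
    ‖(φ t x).2 - x.2 + t • g q'‖ ≤ K * D * |t| := by
  have h1 : ∀ s, HasDerivAt (fun s => (φ s x).2 + s • g q') (-g (φ s x).1 + g q') s := fun s => by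
    have := (flow_snd hφ x s).add ((hasDerivAt_id s).smul_const (g q'))
    rw [one_smul] at this
    exact this
  have := mvt (t := t) h1 (C := K * D) (fun s hs => by
    have := h.lipd q' (φ s x).1
    have h2 : -g (φ s x).1 + g q' = g q' - g (φ s x).1 := by abel
    rw [h2]
    refine this.trans (mul_le_mul_of_nonneg_left ?_ K.2)
    rw [norm_sub_rev]; exact hD s hs)
  simp only [hφ.1, zero_smul, add_zero] at this
  calc _ = ‖(φ t x).2 + t • g q' - x.2‖ := by congr 1; abel
    _ ≤ _ := this

end flow

end TL
end

open MeasureTheory Real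
set_option autoImplicit false
set_option linter.all false
set_option linter.unusedSimpArgs false
set_option linter.unusedVariables false

noncomputable section
namespace TL
variable {d : ℕ}

/-! ### Liouville theorem -/

def shear (F : (Fin d → ℝ) → (Fin d → ℝ)) (x : Phase d) : Phase d := (x.1, x.2 + F x.1)

lemma mp_shear {F : (Fin d → ℝ) → (Fin d → ℝ)} (hF : Measurable F) :
    MeasurePreserving (shear F) volume volume := by
  rw [Measure.volume_eq_prod]
  refine MeasurePreserving.skew_product (f := id) (g := fun q p => p + F q)
    (MeasurePreserving.id _) ?_ ?_
  · exact measurable_snd.add (hF.comp measurable_fst)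
  · exact Filter.Eventually.of_forall fun q => (measurePreserving_add_right volume (F q)).map_eq

lemma mp_hshear {F : (Fin d → ℝ) → (Fin d → ℝ)} (hF : Measurable F) :
    MeasurePreserving (fun x : Phase d => (x.1 + F x.2, x.2)) volume volume := by
  have h0 : MeasurePreserving (Prod.swap : Phase d → Phase d) volume volume := by
    rw [Measure.volume_eq_prod]; exact Measure.measurePreserving_swap
  exact h0.comp ((mp_shear hF).comp h0)

variable {g : (Fin d → ℝ) → (Fin d → ℝ)} {K : NNReal} {M : ℝ}

def euler (g : (Fin d → ℝ) → (Fin d → ℝ)) (h : ℝ) (x : Phase d) : Phase d :=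
  (x.1 + h • x.2, x.2 - h • g (x.1 + h • x.2))

lemma NF.mp_euler (hg : NF g K M) (h : ℝ) : MeasurePreserving (euler g h) volume volume := by
  have h1 := mp_hshear (d := d) (F := fun p => h • p) (by fun_prop)
  have h2 := mp_shear (d := d) (F := fun q => -(h • g q)) (by
    have := hg.lip.continuous.measurable; fun_prop)
  have := h2.comp h1
  refine cast ?_ this
  congr 1

lemma NF.euler_lip (hg : NF g K M) {h : ℝ} (hh : |h| ≤ 1) (y z : Phase d) :
    ‖euler g h y - euler g h z‖ ≤ (1 + (1 + 2 * K) * |h|) * ‖y - z‖ := by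
  have n1 := norm_fst_le (y - z)
  have n2 := norm_snd_le (y - z)
  have e1 : ‖(y.1 + h • y.2) - (z.1 + h • z.2)‖ ≤ (1 + |h|) * ‖y - z‖ := by
    have : (y.1 + h • y.2) - (z.1 + h • z.2) = (y - z).1 + h • (y - z).2 := by
      simp only [Prod.fst_sub, Prod.snd_sub, smul_sub]; abel
    rw [this]
    refine (norm_add_le _ _).trans ?_
    rw [norm_smul, Real.norm_eq_abs]
    have := mul_le_mul_of_nonneg_left n2 (abs_nonneg h)
    linarith
  have e2 := (hg.lipd (y.1 + h • y.2) (z.1 + h • z.2)).trans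
    (mul_le_mul_of_nonneg_left e1 K.2)
  have hK : (0 : ℝ) ≤ K := K.2
  have hn : 0 ≤ ‖y - z‖ := norm_nonneg _
  have ha := abs_nonneg h
  have hp : 0 ≤ (K : ℝ) * |h| * ‖y - z‖ := by positivity
  rw [Prod.norm_def]
  refine max_le ?_ ?_
  · simp only [euler, Prod.fst_sub]
    refine e1.trans ?_
    nlinarith
  · simp only [euler, Prod.snd_sub]
    have : y.2 - h • g (y.1 + h • y.2) - (z.2 - h • g (z.1 + h • z.2)) =
      (y - z).2 - h • (g (y.1 + h • y.2) - g (z.1 + h • z.2)) := by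
        simp only [Prod.snd_sub, smul_sub]; abel
    rw [this]
    refine (norm_sub_le _ _).trans ?_
    rw [norm_smul, Real.norm_eq_abs]
    have e3 := mul_le_mul_of_nonneg_left e2 ha
    have e4 : |h| * ((K : ℝ) * ((1 + |h|) * ‖y - z‖)) ≤ 2 * (K * |h| * ‖y - z‖) := by
      have : |h| * ((K : ℝ) * ((1 + |h|) * ‖y - z‖)) = (1 + |h|) * (K * |h| * ‖y - z‖) := by ring
      rw [this]
      exact mul_le_mul_of_nonneg_right (by linarith) hp
    nlinarith

section flow
variable {φ : ℝ → Phase d → Phase d}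

lemma NF.euler_step (hg : NF g K M) (hφ : IsFlowOf (fld g) φ) {h : ℝ} (hh : |h| ≤ 1)
    (y : Phase d) (P : ℝ) (hP : ‖y.2‖ ≤ P) :
    ‖euler g h y - φ h y‖ ≤ (M + K * (M + 2 * P)) * |h| ^ 2 := by
  have hK : (0 : ℝ) ≤ K := K.2
  have hM := hg.M_nonneg
  have hP0 : 0 ≤ P := (norm_nonneg _).trans hP
  have ha := abs_nonneg h
  rw [Prod.norm_def]
  refine max_le ?_ ?_
  · simp only [euler, Prod.fst_sub]
    have := hg.flow_q hφ y h
    calc _ = ‖(φ h y).1 - y.1 - h • y.2‖ := by rw [← norm_neg]; congr 1; abel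
      _ ≤ _ := this
      _ ≤ _ := mul_le_mul_of_nonneg_right (by nlinarith [mul_nonneg hK (by positivity : 0 ≤ M + 2 * P)]) (by positivity)
  · simp only [euler, Prod.snd_sub]
    have := hg.flow_p2 hφ y h (y.1 + h • y.2) ((M + 2 * P) * |h|) (fun s hs => by
      have h1 := hg.flow_q hφ y s
      have h2 : (φ s y).1 - (y.1 + h • y.2) = ((φ s y).1 - y.1 - s • y.2) + (s - h) • y.2 := by
        rw [sub_smul]; abel
      rw [h2]
      refine (norm_add_le _ _).trans ?_
      rw [norm_smul, Real.norm_eq_abs]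
      have h3 : |s - h| ≤ 2 * |h| := (abs_sub _ _).trans (by linarith)
      have h4 : |s - h| * ‖y.2‖ ≤ 2 * |h| * P := mul_le_mul h3 hP (norm_nonneg _) (by positivity)
      have h5 : M * |s| ^ 2 ≤ M * |h| := by
        refine mul_le_mul_of_nonneg_left ?_ hM
        have := abs_nonneg s
        nlinarith
      linarith)
    calc _ = ‖(φ h y).2 - y.2 + h • g (y.1 + h • y.2)‖ := by rw [← norm_neg]; congr 1; abel
      _ ≤ _ := this
      _ = K * (M + 2 * P) * |h| ^ 2 := by ring
      _ ≤ _ := mul_le_mul_of_nonneg_right (by linarith) (by positivity)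

lemma NF.euler_tendsto (hg : NF g K M) (hφ : IsFlowOf (fld g) φ) (t : ℝ) (x : Phase d) :
    Filter.Tendsto (fun n : ℕ => (euler g (t / n))^[n] x) Filter.atTop (nhds (φ t x)) := by
  have hK : (0 : ℝ) ≤ K := K.2
  have hM := hg.M_nonneg
  set P := ‖x.2‖ + M * |t| with hP
  set D := M + K * (M + 2 * P) with hD
  set C : ℝ := 1 + 2 * K with hC
  have hP0 : 0 ≤ P := by positivity
  have hD0 : 0 ≤ D := by positivity
  have hC0 : 0 ≤ C := by positivity
  have key : ∀ n : ℕ, |t| ≤ n → 0 < n → ∀ k ≤ n,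
      ‖(euler g (t / n))^[k] x - φ (k * (t / n)) x‖ ≤
        k * (D * |t / n| ^ 2) * (1 + C * |t / n|) ^ k := by
    intro n hn hn0 k
    have hn' : (0 : ℝ) < n := by exact_mod_cast hn0
    have hh : |t / n| ≤ 1 := by
      rw [abs_div, abs_of_pos hn', div_le_one hn']; exact hn
    set h := t / n with hdef
    have ha := abs_nonneg h
    induction k with
    | zero => intro _; simp [hφ.1]
    | succ k ih =>
      intro hk
      have ih' := ih (by omega)
      have e1 : φ ((k + 1 : ℕ) * h) x = φ h (φ (k * h) x) := by
        rw [← hg.flow_add hφ]; congr 1; push_cast; ring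
      rw [Function.iterate_succ_apply', e1]
      have hkP : ‖(φ (k * h) x).2‖ ≤ P := by
        have h1 := hg.flow_p hφ x (k * h)
        have h2 : |k * h| ≤ |t| := by
          rw [hdef, abs_mul, abs_div, abs_of_pos hn', abs_of_nonneg (by positivity : (0:ℝ) ≤ k)]
          have : (k : ℝ) ≤ n := by exact_mod_cast (by omega : k ≤ n)
          rw [← mul_div_assoc, div_le_iff₀ hn', mul_comm]
          exact mul_le_mul_of_nonneg_left this (abs_nonneg t)
        have h3 := norm_add_le ((φ (k * h) x).2 - x.2) x.2
        rw [sub_add_cancel] at h3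
        have := mul_le_mul_of_nonneg_left h2 hM
        linarith
      have s1 := hg.euler_lip hh ((euler g h)^[k] x) (φ (k * h) x)
      have s2 := hg.euler_step hφ hh (φ (k * h) x) P hkP
      have s3 := norm_add_le (euler g h ((euler g h)^[k] x) - euler g h (φ (k * h) x))
        (euler g h (φ (k * h) x) - φ h (φ (k * h) x))
      rw [sub_add_sub_cancel] at s3
      have hone : 1 ≤ (1 + C * |h|) ^ (k + 1) := one_le_pow₀ (by nlinarith [mul_nonneg hC0 ha])
      have s4 : (1 + C * |h|) * ‖(euler g h)^[k] x - φ (k * h) x‖ ≤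
        (1 + C * |h|) * (k * (D * |h| ^ 2) * (1 + C * |h|) ^ k) :=
          mul_le_mul_of_nonneg_left ih' (by positivity)
      have s5 : D * |h| ^ 2 ≤ D * |h| ^ 2 * (1 + C * |h|) ^ (k + 1) :=
        le_mul_of_one_le_right (by positivity) hone
      calc _ ≤ _ := s3
        _ ≤ (1 + C * |h|) * (k * (D * |h| ^ 2) * (1 + C * |h|) ^ k) + D * |h| ^ 2 := by linarith
        _ ≤ (1 + C * |h|) * (k * (D * |h| ^ 2) * (1 + C * |h|) ^ k) +
            D * |h| ^ 2 * (1 + C * |h|) ^ (k + 1) := by linarith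
        _ = _ := by push_cast; ring
  rw [tendsto_iff_norm_sub_tendsto_zero]
  refine squeeze_zero' (g := fun n : ℕ => D * t ^ 2 * Real.exp (C * |t|) / n)
    (Filter.Eventually.of_forall fun _ => norm_nonneg _) ?_ (tendsto_const_div_atTop_nhds_zero_nat _)
  filter_upwards [Filter.eventually_ge_atTop ⌈|t|⌉₊, Filter.eventually_gt_atTop 0] with n hn hn0
  have hn' : (0 : ℝ) < n := by exact_mod_cast hn0
  have h1 := key n (Nat.ceil_le.1 hn) hn0 n le_rfl
  rw [mul_div_cancel₀ _ hn'.ne'] at h1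
  refine h1.trans ?_
  have h2 : (1 + C * |t / n|) ^ n ≤ Real.exp (C * |t|) := by
    have : 1 + C * |t / n| ≤ Real.exp (C * |t / n|) := by
      have := Real.add_one_le_exp (C * |t / n|); linarith
    refine (pow_le_pow_left₀ (by positivity) this n).trans ?_
    rw [← Real.exp_nat_mul, abs_div, abs_of_pos hn']
    apply le_of_eq; congr 1; field_simp
  calc _ ≤ n * (D * |t / n| ^ 2) * Real.exp (C * |t|) := mul_le_mul_of_nonneg_left h2 (by positivity)
    _ = _ := by rw [sq_abs]; field_simp

lemma NF.flow_meas (hg : NF g K M) (hφ : IsFlowOf (fld g) φ) (t : ℝ) : Measurable (φ t) :=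
  measurable_of_tendsto_metrizable (f := fun n : ℕ => (euler g (t / n))^[n])
    (fun n => (hg.mp_euler _).measurable.iterate n)
    (tendsto_pi_nhds.2 fun x => hg.euler_tendsto hφ t x)

lemma measure_preimage_le_of_tendsto {S : ℕ → Phase d → Phase d} {Φ : Phase d → Phase d}
    (hS : ∀ n, MeasurePreserving (S n) volume volume)
    (h : ∀ x, Filter.Tendsto (fun n => S n x) Filter.atTop (nhds (Φ x)))
    (U : Set (Phase d)) (hU : IsOpen U) : volume (Φ ⁻¹' U) ≤ volume U := by
  have h1 : Φ ⁻¹' U ⊆ ⋃ N : ℕ, ⋂ n ≥ N, S n ⁻¹' U := by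
    intro x hx
    obtain ⟨N, hN⟩ := Filter.eventually_atTop.1 ((h x).eventually (hU.mem_nhds hx))
    simp only [Set.mem_iUnion, Set.mem_iInter]
    exact ⟨N, fun n hn => hN n hn⟩
  refine (measure_mono h1).trans ?_
  have hmono : Monotone (fun N : ℕ => ⋂ n ≥ N, S n ⁻¹' U) := by
    intro a b hab x hx
    simp only [Set.mem_iInter] at hx ⊢
    exact fun n hn => hx n (le_trans hab hn)
  rw [hmono.measure_iUnion]
  refine iSup_le fun N => ?_
  refine (measure_mono (t := S N ⁻¹' U) ?_).trans ((hS N).measure_preimage hU.measurableSet.nullMeasurableSet).le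
  intro x hx
  simp only [Set.mem_iInter] at hx
  exact hx N le_rfl

lemma NF.flow_le (hg : NF g K M) (hφ : IsFlowOf (fld g) φ) (t : ℝ) (E : Set (Phase d)) :
    volume (φ t ⁻¹' E) ≤ volume E := by
  conv_rhs => rw [Set.measure_eq_iInf_isOpen]
  refine le_iInf fun U => le_iInf fun hEU => le_iInf fun hU => ?_
  refine (measure_mono (Set.preimage_mono hEU)).trans ?_
  refine measure_preimage_le_of_tendsto (S := fun n : ℕ => (euler g (t / n))^[n])
    (fun n => (hg.mp_euler _).iterate n) (fun x => hg.euler_tendsto hφ t x) U hU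

lemma NF.flow_mp (hg : NF g K M) (hφ : IsFlowOf (fld g) φ) (t : ℝ) :
    MeasurePreserving (φ t) volume volume := by
  refine ⟨hg.flow_meas hφ t, ?_⟩
  ext E hE
  rw [Measure.map_apply (hg.flow_meas hφ t) hE]
  refine le_antisymm (hg.flow_le hφ t E) ?_
  have h1 := hg.flow_le hφ (-t) (φ t ⁻¹' E)
  have h2 : φ (-t) ⁻¹' (φ t ⁻¹' E) = E := by
    ext x
    have := hg.flow_neg hφ (-t) x
    rw [neg_neg] at this
    simp [this]
  rwa [h2] at h1

lemma NF.flow_adm (hg : NF g K M) (hφ : IsFlowOf (fld g) φ) (t : ℝ) : Adm (φ t) :=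
  Adm.of_mp (hg.flow_mp hφ t) (hg.flow_lat hφ t)

end flow

end TL
end

open MeasureTheory Real
set_option autoImplicit false
set_option linter.all false
set_option linter.unusedSimpArgs false
set_option linter.unusedVariables false

noncomputable section
namespace TL
variable {d : ℕ}

/-! ### The controlled Hamiltonian fields -/

def dz (k : Fin d → ℤ) (q : Fin d → ℝ) : ℝ := ∑ i, (k i : ℝ) * q i

def dzL (k : Fin d → ℤ) : (Fin d → ℝ) →L[ℝ] ℝ := ∑ i, (k i : ℝ) • ContinuousLinearMap.proj i

lemma dzL_apply (k : Fin d → ℤ) (q : Fin d → ℝ) : dzL k q = dz k q := by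
  simp [dzL, dz]

lemma hasFDerivAt_dz (k : Fin d → ℤ) (q : Fin d → ℝ) : HasFDerivAt (dz k) (dzL k) q := by
  have : dz k = dzL k := by funext q; rw [dzL_apply]
  rw [this]; exact (dzL k).hasFDerivAt

lemma contDiff_dz (k : Fin d → ℤ) : ContDiff ℝ 1 (dz k) := by
  have : dz k = dzL k := by funext q; rw [dzL_apply]
  rw [this]; exact (dzL k).contDiff

lemma dz_add (k m : Fin d → ℤ) (q : Fin d → ℝ) :
    dz k (fun i => q i + 2 * π * m i) = dz k q + (∑ i, k i * m i : ℤ) * (2 * π) := by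
  simp only [dz]
  push_cast
  rw [Finset.sum_mul, ← Finset.sum_add_distrib]
  refine Finset.sum_congr rfl fun i _ => by ring

def kz (d : ℕ) (j : Fin d) : Fin d → ℤ :=
  if (j : ℕ) < d - 1 then Pi.single j 1 else fun _ => 1

lemma kvec_eq (j i : Fin d) : kvec d j i = (kz d j i : ℝ) := by
  unfold kvec kz
  split_ifs
  · by_cases h : i = j
    · subst h; simp
    · simp [h]
  · simp

def gradf (U : (Fin d → ℝ) → ℝ) (q : Fin d → ℝ) : Fin d → ℝ := fun i => fderiv ℝ U q (Pi.single i 1)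

def cg (u : Fin d → ℝ × ℝ) (q : Fin d → ℝ) : Fin d → ℝ := fun i =>
  ∑ j, (-((u j).1 * Real.sin (dz (kz d j) q)) + (u j).2 * Real.cos (dz (kz d j) q)) * kz d j i

lemma hamVF_eq (V0 : (Fin d → ℝ) → ℝ) (hV : Differentiable ℝ V0) (u : Fin d → ℝ × ℝ) :
    hamVF (torusHam V0 u) = fld (fun q => gradf V0 q + cg u q) := by
  funext x
  have h1 : HasFDerivAt (fun x : Phase d => (∑ i, (x.2 i) ^ 2) / 2)
      (∑ i, (x.2 i) • ((ContinuousLinearMap.proj i).comp (ContinuousLinearMap.snd ℝ (Fin d → ℝ) (Fin d → ℝ)))) x := by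
    have h0 : ∀ i : Fin d, HasFDerivAt (fun x : Phase d => x.2 i)
      ((ContinuousLinearMap.proj i).comp (ContinuousLinearMap.snd ℝ (Fin d → ℝ) (Fin d → ℝ))) x :=
      fun i => ((ContinuousLinearMap.proj (R := ℝ) (φ := fun _ : Fin d => ℝ) i).comp (ContinuousLinearMap.snd ℝ (Fin d → ℝ) (Fin d → ℝ))).hasFDerivAt
    have := (HasFDerivAt.fun_sum (u := Finset.univ) (fun i _ => (h0 i).pow 2)).mul_const (2⁻¹ : ℝ)
    simp only [div_eq_mul_inv]
    refine this.congr_fderiv ?_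
    rw [Finset.smul_sum]
    refine Finset.sum_congr rfl fun i _ => ?_
    rw [smul_smul]
    congr 1
    simp
  have h2 : HasFDerivAt (fun x : Phase d => V0 x.1)
      ((fderiv ℝ V0 x.1).comp (ContinuousLinearMap.fst ℝ (Fin d → ℝ) (Fin d → ℝ))) x :=
    (hV x.1).hasFDerivAt.comp x hasFDerivAt_fst
  have h3 : HasFDerivAt (fun x : Phase d => ∑ j, ((u j).1 * Real.cos (dz (kz d j) x.1) +
      (u j).2 * Real.sin (dz (kz d j) x.1)))
      (∑ j, (-((u j).1 * Real.sin (dz (kz d j) x.1)) + (u j).2 * Real.cos (dz (kz d j) x.1)) •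
        ((dzL (kz d j)).comp (ContinuousLinearMap.fst ℝ (Fin d → ℝ) (Fin d → ℝ)))) x := by
    refine HasFDerivAt.fun_sum (u := Finset.univ) (fun j _ => ?_)
    have h0 : HasFDerivAt (fun x : Phase d => dz (kz d j) x.1)
      ((dzL (kz d j)).comp (ContinuousLinearMap.fst ℝ (Fin d → ℝ) (Fin d → ℝ))) x :=
      (hasFDerivAt_dz (kz d j) x.1).comp x hasFDerivAt_fst
    refine ((h0.cos.const_mul (u j).1).add (h0.sin.const_mul (u j).2)).congr_fderiv ?_
    rw [add_smul, smul_smul, smul_smul]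
    congr 2
    ring
  have h4 := (h1.add h2).add h3
  have h5 : torusHam V0 u = fun x : Phase d => (∑ i, (x.2 i) ^ 2) / 2 + V0 x.1 +
      ∑ j, ((u j).1 * Real.cos (dz (kz d j) x.1) + (u j).2 * Real.sin (dz (kz d j) x.1)) := by
    funext x
    simp only [torusHam, dz, kvec_eq]
  have h6 := h4.fderiv
  have h7 : fderiv ℝ (torusHam V0 u) x = fderiv ℝ (((fun x : Phase d => (∑ i, x.2 i ^ 2) / 2) + fun x => V0 x.1) + fun x =>
      ∑ j, ((u j).1 * cos (dz (kz d j) x.1) + (u j).2 * sin (dz (kz d j) x.1))) x := by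
    rw [h5]; rfl
  rw [h6] at h7
  refine Prod.ext ?_ ?_
  · funext i
    simp only [hamVF, h7, fld]
    simp [dzL_apply, dz, Pi.single_apply]
  · funext i
    simp only [hamVF, h7, fld]
    simp [dzL_apply, dz, Pi.single_apply, gradf, cg]

lemma bdd_of_per {E : Type*} [NormedAddCommGroup E] {f : (Fin d → ℝ) → E} (hf : Continuous f)
    (hper : ∀ q (k : Fin d → ℤ), f (fun i => q i + 2 * π * k i) = f q) :
    ∃ C, ∀ q, ‖f q‖ ≤ C := by
  have hc : IsCompact (Set.Icc (0 : Fin d → ℝ) (fun _ => 2 * π)) := isCompact_Icc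
  obtain ⟨C, hC⟩ := hc.exists_bound_of_continuousOn hf.continuousOn
  refine ⟨C, fun q => ?_⟩
  have h1 : f (redq q) = f q := by
    rw [← hper (redq q) (kq q)]
    congr 1; funext i; rw [redq_eq]; ring
  rw [← h1]
  exact hC _ ⟨fun i => (redq_mem q i).1, fun i => (redq_mem q i).2.le⟩

lemma fderiv_per {E : Type*} [NormedAddCommGroup E] [NormedSpace ℝ E] {f : (Fin d → ℝ) → E}
    (hper : ∀ q (k : Fin d → ℤ), f (fun i => q i + 2 * π * k i) = f q) (q) (k : Fin d → ℤ) :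
    fderiv ℝ f (fun i => q i + 2 * π * k i) = fderiv ℝ f q := by
  have h := fderiv_comp_add_right (𝕜 := ℝ) (f := f) (x := q) (fun i => 2 * π * (k i : ℝ))
  have h2 : (fun q : Fin d → ℝ => f (q + fun i => 2 * π * (k i : ℝ))) = f := by
    funext q; exact hper q k
  rw [h2] at h
  exact h.symm

lemma exists_NF {g : (Fin d → ℝ) → (Fin d → ℝ)} (hg : ContDiff ℝ 1 g)
    (hper : ∀ q (k : Fin d → ℤ), g (fun i => q i + 2 * π * k i) = g q) :
    ∃ (K : NNReal) (M : ℝ), NF g K M := by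
  obtain ⟨M, hM⟩ := bdd_of_per hg.continuous hper
  obtain ⟨C, hC⟩ := bdd_of_per (hg.continuous_fderiv one_ne_zero) (fderiv_per hper)
  have hC0 : 0 ≤ C := (norm_nonneg _).trans (hC 0)
  refine ⟨⟨C, hC0⟩, M, ?_, hM, hper⟩
  exact lipschitzWith_of_nnnorm_fderiv_le (hg.differentiable one_ne_zero) (fun x => hC x)

lemma NF.add {g₁ g₂ : (Fin d → ℝ) → (Fin d → ℝ)} {K₁ K₂ : NNReal} {M₁ M₂ : ℝ}
    (h1 : NF g₁ K₁ M₁) (h2 : NF g₂ K₂ M₂) : NF (fun q => g₁ q + g₂ q) (K₁ + K₂) (M₁ + M₂) :=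
  ⟨h1.lip.add h2.lip, fun q => (norm_add_le _ _).trans (add_le_add (h1.bdd q) (h2.bdd q)),
    fun q k => by rw [h1.per, h2.per]⟩

lemma contDiff_cg (u : Fin d → ℝ × ℝ) : ContDiff ℝ 1 (cg u) := by
  refine contDiff_pi.2 fun i => ?_
  have := fun j => contDiff_dz (kz d j)
  unfold cg
  fun_prop

lemma cg_per (u : Fin d → ℝ × ℝ) (q) (k : Fin d → ℤ) : cg u (fun i => q i + 2 * π * k i) = cg u q := by
  funext i
  simp only [cg, dz_add, Real.sin_add_int_mul_two_pi, Real.cos_add_int_mul_two_pi]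

lemma cg_smul (s : ℝ) (u : Fin d → ℝ × ℝ) (q) : cg (s • u) q = s • cg u q := by
  funext i
  simp only [cg, Pi.smul_apply, Prod.smul_fst, Prod.smul_snd, smul_eq_mul, Finset.mul_sum]
  refine Finset.sum_congr rfl fun j _ => by ring

lemma cg_zero : cg (0 : Fin d → ℝ × ℝ) = 0 := by
  funext q i
  simp [cg]

class GoodV (V0 : (Fin d → ℝ) → ℝ) : Prop where
  smooth : ContDiff ℝ (⊤ : ℕ∞) V0
  per : ∀ (q : Fin d → ℝ) (k : Fin d → ℤ), V0 (fun i => q i + 2 * π * (k i)) = V0 q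

variable (V0 : (Fin d → ℝ) → ℝ) [GoodV V0]

lemma exists_NF_V0 : ∃ (K : NNReal) (M : ℝ), NF (gradf V0) K M := by
  refine exists_NF ?_ ?_
  · refine contDiff_pi.2 fun i => ?_
    have h : ContDiff ℝ 2 V0 := (GoodV.smooth (V0 := V0)).of_le (WithTop.coe_le_coe.2 (le_top (a := (2 : ℕ∞))))
    have := h.fderiv_right (m := 1) (by norm_num)
    unfold gradf
    fun_prop
  · intro q k
    funext i
    simp only [gradf]
    rw [fderiv_per GoodV.per]

lemma exists_NF_u (u : Fin d → ℝ × ℝ) :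
    ∃ (K : NNReal) (M : ℝ), NF (fun q => gradf V0 q + cg u q) K M := by
  obtain ⟨K, M, h⟩ := exists_NF_V0 V0
  obtain ⟨K', M', h'⟩ := exists_NF (contDiff_cg u) (cg_per u)
  exact ⟨_, _, h.add h'⟩

lemma hamVF_eq' (u : Fin d → ℝ × ℝ) :
    hamVF (torusHam V0 u) = fld (fun q => gradf V0 q + cg u q) :=
  hamVF_eq V0 ((GoodV.smooth (V0 := V0)).differentiable (by simp)) u

/-! ### Reachable maps -/

/-- admissible with admissible inverse -/
def AdmInv (Φ : Phase d → Phase d) : Prop :=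
  Adm Φ ∧ ∃ Φ', Adm Φ' ∧ (∀ x, Φ' (Φ x) = x) ∧ (∀ x, Φ (Φ' x) = x)

lemma AdmInv.comp {Φ₁ Φ₂ : Phase d → Phase d} (h1 : AdmInv Φ₁) (h2 : AdmInv Φ₂) :
    AdmInv (Φ₁ ∘ Φ₂) := by
  obtain ⟨a1, b1, c1, d1, e1⟩ := h1
  obtain ⟨a2, b2, c2, d2, e2⟩ := h2
  exact ⟨a1.comp a2, b2 ∘ b1, c2.comp c1, fun x => by simp [d1, d2], fun x => by simp [e1, e2]⟩

lemma admInv_flow {u : Fin d → ℝ × ℝ} {φ : ℝ → Phase d → Phase d}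
    (hφ : IsFlowOf (hamVF (torusHam V0 u)) φ) (t : ℝ) : AdmInv (φ t) := by
  obtain ⟨K, M, h⟩ := exists_NF_u V0 u
  rw [hamVF_eq'] at hφ
  refine ⟨h.flow_adm hφ t, φ (-t), h.flow_adm hφ (-t), h.flow_neg hφ t, fun x => ?_⟩
  have := h.flow_neg hφ (-t) x
  rwa [neg_neg] at this

lemma foldl_ind {P : (Phase d → Phase d) → Prop} (hc : ∀ f g, P f → P g → P (f ∘ g))
    (l : List (Phase d → Phase d)) : (∀ f ∈ l, P f) → ∀ g, P g →
    P (l.foldl (fun g f => f ∘ g) g) := by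
  induction l with
  | nil => intro _ g hg; exact hg
  | cons a l ih =>
    intro h g hg
    simp only [List.foldl_cons]
    exact ih (fun f hf => h f (List.mem_cons_of_mem _ hf)) _ (hc _ _ (h a (List.mem_cons_self)) hg)

lemma admInv_id : AdmInv (id : Phase d → Phase d) := ⟨Adm.id, id, Adm.id, by simp, by simp⟩

lemma reachable_admInv {τ : ℝ} {Φ : Phase d → Phase d} (h : Reachable (torusHam V0) τ Φ) :
    AdmInv Φ := by
  obtain ⟨n, dur, u, φ, _, _, h3, rfl⟩ := h
  refine foldl_ind (fun f g => AdmInv.comp) _ ?_ _ admInv_id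
  intro f hf
  rw [List.mem_ofFn] at hf
  obtain ⟨i, rfl⟩ := hf
  exact admInv_flow V0 (h3 i) _

lemma foldl_comp (l : List (Phase d → Phase d)) (g : Phase d → Phase d) :
    l.foldl (fun g f => f ∘ g) g = (l.foldl (fun g f => f ∘ g) id) ∘ g := by
  induction l generalizing g with
  | nil => rfl
  | cons a l ih =>
    simp only [List.foldl_cons]
    rw [ih, ih (a ∘ id)]
    rfl

variable {V0}

lemma reachable_comp {τ₁ τ₂ : ℝ} {Φ₁ Φ₂ : Phase d → Phase d} (h1 : Reachable (torusHam V0) τ₁ Φ₁)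
    (h2 : Reachable (torusHam V0) τ₂ Φ₂) : Reachable (torusHam V0) (τ₁ + τ₂) (Φ₁ ∘ Φ₂) := by
  obtain ⟨n, dur, u, φ, a1, a2, a3, rfl⟩ := h1
  obtain ⟨m, dur', u', φ', b1, b2, b3, rfl⟩ := h2
  refine ⟨m + n, Fin.append dur' dur, Fin.append u' u, Fin.append φ' φ, ?_, ?_, ?_, ?_⟩
  · intro i
    refine Fin.addCases (fun i => ?_) (fun i => ?_) i
    · simpa using b1 i
    · simpa using a1 i
  · rw [Fin.sum_univ_add]; simp [a2, b2, add_comm]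
  · intro i
    refine Fin.addCases (fun i => ?_) (fun i => ?_) i
    · simpa using b3 i
    · simpa using a3 i
  · have : (fun i => Fin.append φ' φ i (Fin.append dur' dur i)) =
        Fin.append (fun i => φ' i (dur' i)) (fun i => φ i (dur i)) := by
      funext i
      refine Fin.addCases (fun i => ?_) (fun i => ?_) i <;> simp
    rw [this, List.ofFn_fin_append, List.foldl_append]
    exact (foldl_comp _ _).symm

lemma reachable_flow {u : Fin d → ℝ × ℝ} {φ : ℝ → Phase d → Phase d}
    (hφ : IsFlowOf (hamVF (torusHam V0 u)) φ) (t : ℝ) (ht : 0 ≤ t) :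
    Reachable (torusHam V0) t (φ t) :=
  ⟨1, fun _ => t, fun _ => u, fun _ => φ, fun _ => ht, by simp, fun _ => hφ, by simp⟩

lemma reachable_id : Reachable (torusHam V0) 0 (id : Phase d → Phase d) :=
  ⟨0, Fin.elim0, Fin.elim0, Fin.elim0, fun i => i.elim0, by simp, fun i => i.elim0, by simp⟩

end TL
end

open MeasureTheory Real
set_option autoImplicit false
set_option linter.all false
set_option linter.unusedSimpArgs false
set_option linter.unusedVariables false

noncomputable section
namespace TL
variable {d : ℕ}
open Filter Topology

/-- Riesz' theorem (a.e. convergence + equal norms gives norm convergence along a subsequence) -/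
lemma riesz {α : Type*} [MeasurableSpace α] {μ : Measure α} {p : ENNReal} (h1 : 1 ≤ p) (hp : p ≠ ⊤)
    {u : ℕ → α → ℝ} {v : α → ℝ} (hu : ∀ n, Measurable (u n)) (hv : Measurable v)
    (heq : ∀ n, eLpNorm (u n) p μ = eLpNorm v p μ) (hfin : eLpNorm v p μ < ⊤)
    (hlim : ∀ᵐ x ∂μ, Tendsto (fun n => u n x) atTop (𝓝 (v x))) (ε : ENNReal) (hε : 0 < ε) :
    ∃ᶠ n in atTop, eLpNorm (fun x => u n x - v x) p μ < ε := by
  have hp0 : p ≠ 0 := (lt_of_lt_of_le one_pos h1).ne'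
  set r := p.toReal with hr
  have hr1 : 1 ≤ r := by
    rw [hr, ← ENNReal.toReal_one]; exact ENNReal.toReal_mono hp h1
  have hr0 : 0 < r := by linarith
  set C : ENNReal := 2 ^ (r - 1) with hC
  have hCtop : C ≠ ⊤ := ENNReal.rpow_ne_top_of_nonneg (by linarith) (by simp)
  set A := ∫⁻ x, ‖v x‖ₑ ^ r ∂μ with hA
  have hnorm : ∀ f : α → ℝ, eLpNorm f p μ = (∫⁻ x, ‖f x‖ₑ ^ r ∂μ) ^ (1 / r) := fun f =>
    eLpNorm_eq_lintegral_rpow_enorm_toReal hp0 hp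
  have hAtop : A ≠ ⊤ := by
    intro h
    rw [hnorm, ← hA, h] at hfin
    rw [ENNReal.top_rpow_of_pos (by positivity)] at hfin
    exact lt_irrefl _ hfin
  have hAn : ∀ n, ∫⁻ x, ‖u n x‖ₑ ^ r ∂μ = A := fun n => by
    have := heq n
    rw [hnorm, hnorm] at this
    exact (ENNReal.rpow_left_injective (x := 1 / r) (by positivity)) this
  by_contra hcon
  rw [Filter.not_frequently] at hcon
  obtain ⟨N, hN⟩ := eventually_atTop.1 hcon
  have hb : ∀ n ≥ N, ε ^ r ≤ ∫⁻ x, ‖u n x - v x‖ₑ ^ r ∂μ := fun n hn => by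
    have := not_lt.1 (hN n hn)
    rw [hnorm] at this
    have h2 := ENNReal.rpow_le_rpow this hr0.le
    rwa [← ENNReal.rpow_mul, one_div, inv_mul_cancel₀ hr0.ne', ENNReal.rpow_one] at h2
  have hle : ∀ n x, ‖u n x - v x‖ₑ ^ r ≤ C * (‖u n x‖ₑ ^ r + ‖v x‖ₑ ^ r) := fun n x => by
    refine le_trans ?_ (ENNReal.rpow_add_le_mul_rpow_add_rpow _ _ hr1)
    exact ENNReal.rpow_le_rpow (enorm_sub_le) hr0.le
  have hm1 : ∀ n, Measurable fun x => ‖u n x - v x‖ₑ ^ r := fun n =>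
    (((hu n).sub hv).enorm).pow_const _
  have hm2 : ∀ n, Measurable fun x => ‖u n x‖ₑ ^ r := fun n => ((hu n).enorm).pow_const _
  have hm3 : Measurable fun x => ‖v x‖ₑ ^ r := (hv.enorm).pow_const _
  have hintg : ∀ n, ∫⁻ x, C * (‖u n x‖ₑ ^ r + ‖v x‖ₑ ^ r) ∂μ = C * (A + A) := fun n => by
    rw [lintegral_const_mul' _ _ hCtop, lintegral_add_left (hm2 n), hAn]
  have hbtop : ∀ n, ∫⁻ x, ‖u n x - v x‖ₑ ^ r ∂μ ≤ C * (A + A) := fun n => by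
    rw [← hintg n]; exact lintegral_mono (hle n)
  have hCA : C * (A + A) ≠ ⊤ := ENNReal.mul_ne_top hCtop (ENNReal.add_ne_top.2 ⟨hAtop, hAtop⟩)
  have hF := lintegral_liminf_le (μ := μ) (u := atTop)
    (f := fun n x => C * (‖u n x‖ₑ ^ r + ‖v x‖ₑ ^ r) - ‖u n x - v x‖ₑ ^ r)
    (fun n => (((hm2 n).add hm3).const_mul C).sub (hm1 n))
  have hL : ∫⁻ x, liminf (fun n => C * (‖u n x‖ₑ ^ r + ‖v x‖ₑ ^ r) - ‖u n x - v x‖ₑ ^ r) atTop ∂μ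
      = C * (A + A) := by
    have : ∀ᵐ x ∂μ, liminf (fun n => C * (‖u n x‖ₑ ^ r + ‖v x‖ₑ ^ r) - ‖u n x - v x‖ₑ ^ r) atTop
        = C * (‖v x‖ₑ ^ r + ‖v x‖ₑ ^ r) := by
      filter_upwards [hlim] with x hx
      apply Tendsto.liminf_eq
      have e1 : Tendsto (fun n => ‖u n x‖ₑ ^ r) atTop (𝓝 (‖v x‖ₑ ^ r)) :=
        (ENNReal.continuous_rpow_const.tendsto _).comp hx.enorm
      have e2 : Tendsto (fun n => ‖u n x - v x‖ₑ ^ r) atTop (𝓝 0) := by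
        have h0 : Tendsto (fun n => u n x - v x) atTop (𝓝 0) := by
          simpa using hx.sub_const (v x)
        have := ((ENNReal.continuous_rpow_const (y := r)).tendsto _).comp h0.enorm
        simpa [Function.comp_def, hr0] using this
      have e3 := ENNReal.Tendsto.const_mul (a := C) (e1.add_const (‖v x‖ₑ ^ r)) (Or.inr hCtop)
      have e4 := ENNReal.Tendsto.sub e3 e2 (Or.inr (by simp))
      simpa using e4
    rw [lintegral_congr_ae this, lintegral_const_mul' _ _ hCtop, lintegral_add_left hm3]
  rw [hL] at hF
  have hR : liminf (fun n => ∫⁻ x, C * (‖u n x‖ₑ ^ r + ‖v x‖ₑ ^ r) - ‖u n x - v x‖ₑ ^ r ∂μ) atTop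
      ≤ C * (A + A) - ε ^ r := by
    refine liminf_le_of_frequently_le' (Eventually.frequently ?_)
    filter_upwards [eventually_ge_atTop N] with n hn
    rw [lintegral_sub (hm1 n) (ne_top_of_le_ne_top hCA (hbtop n)) (Eventually.of_forall (hle n)), hintg]
    exact tsub_le_tsub_left (hb n hn) _
  have hlt : C * (A + A) - ε ^ r < C * (A + A) := by
    have hεr : 0 < ε ^ r := ENNReal.rpow_pos_of_nonneg hε hr0.le
    refine ENNReal.sub_lt_self hCA ?_ hεr.ne'
    exact (lt_of_lt_of_le hεr ((hb N le_rfl).trans (hbtop N))).ne'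
  exact absurd (hF.trans hR) (not_le.2 hlt)

class GoodP (p : ENNReal) : Prop where
  one_le : 1 ≤ p
  ne_top : p ≠ ⊤

variable (V0 : (Fin d → ℝ) → ℝ) [GoodV V0] (p : ENNReal) [GoodP p]

/-- small time approximately reachable, with remaining time budget `t` -/
def SSt (t : ℝ) (Ψ : Phase d → Phase d) : Prop :=
  Adm Ψ ∧ ∀ f, Tor p f → ∀ ε > (0 : ℝ), ∃ τ ∈ Set.Icc (0 : ℝ) (t + ε), ∃ Φ,
    Reachable (torusHam V0) τ Φ ∧
      eLpNorm (fun x => f (Φ x) - f (Ψ x)) p (volQ d) < ENNReal.ofReal ε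

variable {V0 p}

lemma SSt.mono {t t' : ℝ} (h : t ≤ t') {Ψ : Phase d → Phase d} (hs : SSt V0 p t Ψ) :
    SSt V0 p t' Ψ :=
  ⟨hs.1, fun f hf ε hε => by
    obtain ⟨τ, hτ, Φ, h1, h2⟩ := hs.2 f hf ε hε
    exact ⟨τ, ⟨hτ.1, by linarith [hτ.2]⟩, Φ, h1, h2⟩⟩

lemma sub_norm_le {f g h : Phase d → ℝ} (hf : Measurable f) (hg : Measurable g) (hh : Measurable h) :
    eLpNorm (fun x => f x - h x) p (volQ d) ≤
      eLpNorm (fun x => f x - g x) p (volQ d) + eLpNorm (fun x => g x - h x) p (volQ d) := by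
  have := eLpNorm_add_le (p := p) (μ := volQ d) (hf.sub hg).aestronglyMeasurable
    (hg.sub hh).aestronglyMeasurable GoodP.one_le
  have e : (fun x => f x - h x) = f - g + (g - h) := by funext x; simp
  rw [e]; exact this

lemma SSt.comp {t1 t2 : ℝ} {Ψ1 Ψ2 : Phase d → Phase d} (h1 : SSt V0 p t1 Ψ1)
    (h2 : SSt V0 p t2 Ψ2) : SSt V0 p (t1 + t2) (Ψ1 ∘ Ψ2) := by
  refine ⟨h1.1.comp h2.1, fun f hf ε hε => ?_⟩
  obtain ⟨τ1, hτ1, Φ1, a1, b1⟩ := h1.2 f hf (ε / 2) (by linarith)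
  obtain ⟨τ2, hτ2, Φ2, a2, b2⟩ := h2.2 _ (hf.comp h1.1) (ε / 2) (by linarith)
  have A1 := (reachable_admInv V0 a1).1
  have A2 := (reachable_admInv V0 a2).1
  refine ⟨τ1 + τ2, ⟨add_nonneg hτ1.1 hτ2.1, by linarith [hτ1.2, hτ2.2]⟩, Φ1 ∘ Φ2,
    reachable_comp a1 a2, ?_⟩
  refine (sub_norm_le (g := fun x => f (Ψ1 (Φ2 x))) (hf.meas.comp (A1.comp A2).meas)
    (hf.meas.comp (h1.1.comp A2).meas) (hf.meas.comp (h1.1.comp h2.1).meas)).trans_lt ?_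
  have e : eLpNorm (fun x => f ((Φ1 ∘ Φ2) x) - f (Ψ1 (Φ2 x))) p (volQ d)
      = eLpNorm (fun x => f (Φ1 x) - f (Ψ1 x)) p (volQ d) :=
    eLpNorm_comp_adm (f := fun x => f (Φ1 x) - f (Ψ1 x))
      ((hf.meas.comp A1.meas).sub (hf.meas.comp h1.1.meas))
      (fun x => by rw [per_comp hf.per A1, per_comp hf.per h1.1]) A2
  simp only [Function.comp_apply] at e ⊢
  rw [e]
  calc _ < ENNReal.ofReal (ε / 2) + ENNReal.ofReal (ε / 2) := ENNReal.add_lt_add b1 b2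
    _ = ENNReal.ofReal ε := by rw [← ENNReal.ofReal_add (by linarith) (by linarith)]; congr 1; ring

lemma SSt.comp0 {Ψ1 Ψ2 : Phase d → Phase d} (h1 : SSt V0 p 0 Ψ1)
    (h2 : SSt V0 p 0 Ψ2) : SSt V0 p 0 (Ψ1 ∘ Ψ2) := by simpa using h1.comp h2

lemma SSt.of_reach {t : ℝ} {Φ : Phase d → Phase d} (ht : 0 ≤ t)
    (h : Reachable (torusHam V0) t Φ) : SSt V0 p t Φ := by
  refine ⟨(reachable_admInv V0 h).1, fun f hf ε hε => ⟨t, ⟨ht, by linarith⟩, Φ, h, ?_⟩⟩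
  simp [hε]

lemma SSt.id : SSt V0 p 0 (id : Phase d → Phase d) := SSt.of_reach le_rfl reachable_id

lemma exists_cont_approx {f : Phase d → ℝ} (hf : Tor p f) {ε : ENNReal} (hε : ε ≠ 0) :
    ∃ g, Tor p g ∧ eLpNorm (fun x => f x - g x) p (volQ d) ≤ ε ∧
      ∀ x, IntQ (red x) → ContinuousAt g x := by
  haveI : IsLocallyFiniteMeasure (volQ d) := by unfold volQ; infer_instance
  obtain ⟨g, _, h2, h3, h4⟩ := hf.memLp.exists_hasCompactSupport_eLpNorm_sub_le GoodP.ne_top hε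
  have hae : (fun x => g (red x)) =ᵐ[volQ d] g := by
    filter_upwards [ae_volQ_mem] with x hx
    rw [red_of_mem hx]
  refine ⟨fun x => g (red x), ⟨h3.measurable.comp measurable_red, fun x => by rw [red_red], ?_⟩, ?_, ?_⟩
  · rw [eLpNorm_congr_ae hae]; exact h4.2
  · refine le_trans (le_of_eq (eLpNorm_congr_ae ?_)) h2
    filter_upwards [hae] with x hx
    simp [hx]
  · intro x hx
    exact ContinuousAt.comp (f := red) h3.continuousAt (continuousAt_red fun i => (hx i).1)

lemma Adm.ae_intQ {Ψ : Phase d → Phase d} (h : Adm Ψ) : ∀ᵐ x ∂(volQ d), IntQ (red (Ψ x)) :=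
  h.mp.quasiMeasurePreserving.ae TL.ae_intQ

lemma SSt.limit' {t : ℕ → ℝ} {Ψn : ℕ → Phase d → Phase d} {Ψ : Phase d → Phase d}
    (h : ∀ n, SSt V0 p (t n) (Ψn n)) (ht : Tendsto t atTop (𝓝 0)) (hΨ : Adm Ψ)
    (hlim : ∀ᵐ x ∂(volQ d), Tendsto (fun n => Ψn n x) atTop (𝓝 (Ψ x))) : SSt V0 p 0 Ψ := by
  refine ⟨hΨ, fun f hf ε hε => ?_⟩
  obtain ⟨g, hg, hfg, hgc⟩ := exists_cont_approx hf (ε := ENNReal.ofReal (ε / 4)) (by simp; linarith)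
  have hfr := riesz (μ := volQ d) (GoodP.one_le (p := p)) GoodP.ne_top
    (u := fun n x => g (Ψn n x)) (v := fun x => g (Ψ x))
    (fun n => hg.meas.comp (h n).1.meas) (hg.meas.comp hΨ.meas)
    (fun n => by rw [eLpNorm_comp_adm hg.meas hg.per (h n).1, eLpNorm_comp_adm hg.meas hg.per hΨ])
    (hg.comp hΨ).fin (by
      filter_upwards [hlim, hΨ.ae_intQ] with x hx hx2
      exact (hgc _ hx2).tendsto.comp hx) (ENNReal.ofReal (ε / 4)) (by simp; linarith)
  have hev : ∀ᶠ n in atTop, t n < ε / 2 := ht.eventually (gt_mem_nhds (by linarith))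
  obtain ⟨n, hn1, hn2⟩ := (hfr.and_eventually hev).exists
  obtain ⟨τ, hτ, Φ, a, b⟩ := (h n).2 g hg (ε / 4) (by linarith)
  have A := (reachable_admInv V0 a).1
  refine ⟨τ, ⟨hτ.1, by linarith [hτ.2]⟩, Φ, a, ?_⟩
  have e1 : ∀ {Θ : Phase d → Phase d}, Adm Θ → eLpNorm (fun x => f (Θ x) - g (Θ x)) p (volQ d)
      ≤ ENNReal.ofReal (ε / 4) := fun hΘ => by
    rw [eLpNorm_comp_adm (f := fun x => f x - g x) (hf.meas.sub hg.meas)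
      (fun x => by rw [hf.per, hg.per]) hΘ]
    exact hfg
  have e2 : eLpNorm (fun x => g (Ψ x) - f (Ψ x)) p (volQ d) ≤ ENNReal.ofReal (ε / 4) := by
    have := e1 hΨ
    rw [← eLpNorm_neg] at this
    convert this using 2
    funext x; simp
  have m := fun {f : Phase d → ℝ} (hf : Tor p f) {Θ : Phase d → Phase d} (hΘ : Adm Θ) =>
    hf.meas.comp hΘ.meas
  have s1 := sub_norm_le (p := p) (m hf A) (m hg A) (m hf hΨ)
  have s2 := sub_norm_le (p := p) (m hg A) (m hg (h n).1) (m hf hΨ)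
  have s3 := sub_norm_le (p := p) (m hg (h n).1) (m hg hΨ) (m hf hΨ)
  simp only [Function.comp_apply] at s1 s2 s3
  calc eLpNorm (fun x => f (Φ x) - f (Ψ x)) p (volQ d) ≤ _ := s1
    _ ≤ ENNReal.ofReal (ε / 4) + (eLpNorm (fun x => g (Φ x) - g (Ψn n x)) p (volQ d)
      + (eLpNorm (fun x => g (Ψn n x) - g (Ψ x)) p (volQ d) + ENNReal.ofReal (ε / 4))) := by
        refine add_le_add (e1 A) (s2.trans (add_le_add le_rfl (s3.trans (add_le_add le_rfl e2))))
    _ < ENNReal.ofReal (ε / 4) + (ENNReal.ofReal (ε / 4) + (ENNReal.ofReal (ε / 4)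
        + ENNReal.ofReal (ε / 4))) := by
        refine ENNReal.add_lt_add_of_le_of_lt (by simp) le_rfl (ENNReal.add_lt_add b ?_)
        exact ENNReal.add_lt_add_of_lt_of_le (by simp) hn1 le_rfl
    _ = ENNReal.ofReal ε := by
        have h4 : 0 ≤ ε / 4 := by linarith
        rw [← ENNReal.ofReal_add h4 h4, ← ENNReal.ofReal_add h4 (by linarith),
          ← ENNReal.ofReal_add h4 (by linarith)]
        congr 1; ring

lemma SSt.limit {t : ℕ → ℝ} {Ψn : ℕ → Phase d → Phase d} {Ψ : Phase d → Phase d}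
    (h : ∀ᶠ n in atTop, SSt V0 p (t n) (Ψn n)) (ht : Tendsto t atTop (𝓝 0)) (hΨ : Adm Ψ)
    (hlim : ∀ᵐ x ∂(volQ d), Tendsto (fun n => Ψn n x) atTop (𝓝 (Ψ x))) : SSt V0 p 0 Ψ := by
  obtain ⟨N, hN⟩ := eventually_atTop.1 h
  refine SSt.limit' (t := fun n => t (n + N)) (Ψn := fun n => Ψn (n + N)) (fun n => hN _ (by omega))
    ((tendsto_add_atTop_iff_nat N).2 ht) hΨ ?_
  filter_upwards [hlim] with x hx
  exact (tendsto_add_atTop_iff_nat (f := fun n => Ψn n x) N).2 hx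

end TL
end

open MeasureTheory Real
set_option autoImplicit false
set_option linter.all false
set_option linter.unusedSimpArgs false
set_option linter.unusedVariables false

noncomputable section
namespace TL
variable {d : ℕ}
open Filter Topology

lemma per_add {F : (Fin d → ℝ) → (Fin d → ℝ)} (hF : ∀ q, F (redq q) = F q) (q) (k : Fin d → ℤ) :
    F (fun i => q i + 2 * π * k i) = F q := by
  rw [← hF, redq_add, hF]

lemma per_of_add {β : Type*} {F : (Fin d → ℝ) → β}
    (hF : ∀ q (k : Fin d → ℤ), F (fun i => q i + 2 * π * k i) = F q) (q) : F (redq q) = F q := by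
  rw [← hF q (-(kq q))]
  congr 1
  funext i
  rw [redq_eq]; simp; ring

lemma adm_shear {F : (Fin d → ℝ) → (Fin d → ℝ)} (hm : Measurable F) (hF : ∀ q, F (redq q) = F q) :
    Adm (shear F) := by
  refine Adm.of_mp (mp_shear hm) fun x k => ?_
  have : F (x + lat k).1 = F x.1 := per_add hF x.1 k
  refine Prod.ext rfl ?_
  simp only [shear, this, Prod.snd_add]
  simp [lat]

lemma shear_comp (F G : (Fin d → ℝ) → (Fin d → ℝ)) :
    shear F ∘ shear G = shear (fun q => F q + G q) := by
  funext x
  simp only [shear, Function.comp]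
  rw [add_assoc, add_comm (G x.1)]

variable (V0 : (Fin d → ℝ) → ℝ) [GoodV V0] (p : ENNReal) [GoodP p]

structure InF (F : (Fin d → ℝ) → (Fin d → ℝ)) : Prop where
  meas : Measurable F
  per : ∀ q, F (redq q) = F q
  sst : ∀ s : ℝ, SSt V0 p 0 (shear (fun q => s • F q))

variable {V0 p}

lemma InF.adm {F : (Fin d → ℝ) → (Fin d → ℝ)} (h : InF V0 p F) : Adm (shear F) :=
  adm_shear h.meas h.per

lemma InF.sst1 {F : (Fin d → ℝ) → (Fin d → ℝ)} (h : InF V0 p F) : SSt V0 p 0 (shear F) := by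
  simpa using h.sst 1

lemma InF.smul {F : (Fin d → ℝ) → (Fin d → ℝ)} (h : InF V0 p F) (c : ℝ) :
    InF V0 p (fun q => c • F q) :=
  ⟨h.meas.const_smul c, fun q => by rw [h.per], fun s => by
    simpa [smul_smul] using h.sst (s * c)⟩

lemma InF.add {F G : (Fin d → ℝ) → (Fin d → ℝ)} (h : InF V0 p F) (h' : InF V0 p G) :
    InF V0 p (fun q => F q + G q) :=
  ⟨h.meas.add h'.meas, fun q => by rw [h.per, h'.per], fun s => by
    have := (h.sst s).comp0 (h'.sst s)
    rw [shear_comp] at this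
    simpa [smul_add] using this⟩

lemma InF.zero : InF V0 p (fun _ => 0) :=
  ⟨measurable_const, fun _ => rfl, fun s => by
    have : shear (fun q : Fin d → ℝ => s • (0 : Fin d → ℝ)) = id := by
      funext x; simp [shear]
    rw [this]; exact SSt.id⟩

lemma InF.sum {ι : Type*} (S : Finset ι) {F : ι → (Fin d → ℝ) → (Fin d → ℝ)}
    (h : ∀ i ∈ S, InF V0 p (F i)) : InF V0 p (fun q => ∑ i ∈ S, F i q) := by
  classical
  induction S using Finset.induction_on with
  | empty => simpa using InF.zero
  | insert a S ha ih =>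
    simp only [Finset.sum_insert ha]
    exact (h a (by simp)).add (ih fun i hi => h i (by simp [hi]))

lemma InF.congr {F G : (Fin d → ℝ) → (Fin d → ℝ)} (h : InF V0 p F) (e : ∀ q, F q = G q) :
    InF V0 p G := by
  rwa [show G = F from (funext e).symm]

lemma InF.lim {F : ℕ → (Fin d → ℝ) → (Fin d → ℝ)} {G : (Fin d → ℝ) → (Fin d → ℝ)}
    (h : ∀ n, InF V0 p (F n)) (hm : Measurable G) (hper : ∀ q, G (redq q) = G q)
    (hl : ∀ᵐ x ∂(volQ d), Tendsto (fun n => F n x.1) atTop (𝓝 (G x.1))) : InF V0 p G := by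
  refine ⟨hm, hper, fun s => ?_⟩
  refine SSt.limit' (t := fun _ => 0) (fun n => (h n).sst s) tendsto_const_nhds
    (adm_shear (hm.const_smul s) fun q => by rw [hper]) ?_
  filter_upwards [hl] with x hx
  exact tendsto_const_nhds.prodMk_nhds (tendsto_const_nhds.add (hx.const_smul s))

/-- from one sign at a time -/
lemma InF.mk' {F : (Fin d → ℝ) → (Fin d → ℝ)} (hm : Measurable F) (hper : ∀ q, F (redq q) = F q)
    (h : ∀ s : ℝ, SSt V0 p 0 (shear (fun q => s • F q))) : InF V0 p F := ⟨hm, hper, h⟩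

variable (V0 p)

lemma exists_drift : ∃ (φ : ℝ → Phase d → Phase d) (M : ℝ), (∀ t, 0 ≤ t → SSt V0 p t (φ t)) ∧ 0 ≤ M ∧
    (∀ x t, ‖(φ t x).2 - x.2‖ ≤ M * |t|) ∧ (∀ x t, ‖(φ t x).1 - x.1 - t • x.2‖ ≤ M * |t| ^ 2) := by
  obtain ⟨K, M, h⟩ := exists_NF_u V0 0
  obtain ⟨φ, hφ⟩ := h.exists_flow
  refine ⟨φ, M, fun t ht => SSt.of_reach ht (reachable_flow (u := 0) ?_ t ht), h.M_nonneg,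
    fun x t => h.flow_p hφ x t, fun x t => h.flow_q hφ x t⟩
  rw [hamVF_eq']; exact hφ

def τs (n : ℕ) : ℝ := 1 / ((n : ℝ) + 1)
lemma τs_pos (n : ℕ) : 0 < τs n := by unfold τs; positivity
lemma τs_lim : Tendsto τs atTop (𝓝 0) := tendsto_one_div_add_atTop_nhds_zero_nat

lemma NF.smul {g : (Fin d → ℝ) → (Fin d → ℝ)} {K : NNReal} {M : ℝ} (h : NF g K M) (c : NNReal) :
    NF (fun q => (c : ℝ) • g q) (c * K) (c * M) := by
  refine ⟨LipschitzWith.of_dist_le_mul fun x y => ?_, fun q => ?_, fun q k => by rw [h.per]⟩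
  · rw [dist_eq_norm, ← smul_sub, norm_smul]
    have := h.lipd x y
    simp only [NNReal.coe_mul, Real.norm_eq_abs, NNReal.abs_eq, dist_eq_norm]
    rw [mul_assoc]
    exact mul_le_mul_of_nonneg_left this c.2
  · rw [norm_smul]
    simpa using mul_le_mul_of_nonneg_left (h.bdd q) c.2

lemma sst_cg (v : Fin d → ℝ × ℝ) : SSt V0 p 0 (shear (fun q => -cg v q)) := by
  obtain ⟨K0, M0, h0⟩ := exists_NF_V0 V0
  obtain ⟨K1, M1, h1⟩ := exists_NF (contDiff_cg v) (cg_per v)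
  have key : ∀ n : ℕ, ∃ Φ : Phase d → Phase d, SSt V0 p (τs n) Φ ∧ ∀ x,
      ‖(Φ x).1 - x.1‖ ≤ τs n * (‖x.2‖ + M0 * τs n + M1) ∧
      ‖(Φ x).2 - x.2 + cg v x.1‖ ≤ M0 * τs n + (K0 * τs n + K1) * (τs n * (‖x.2‖ + M0 * τs n + M1) )
        := by
    intro n
    have hτ := τs_pos n
    obtain ⟨c, hc⟩ : ∃ z : NNReal, (z : ℝ) = (τs n)⁻¹ := ⟨⟨_, (inv_pos.2 hτ).le⟩, rfl⟩
    have hN := h0.add (h1.smul c)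
    obtain ⟨φ, hφ⟩ := hN.exists_flow
    refine ⟨φ (τs n), SSt.of_reach hτ.le (reachable_flow (u := (c : ℝ) • v) ?_ _ hτ.le), fun x => ?_⟩
    · rw [hamVF_eq']
      simpa only [cg_smul] using hφ
    · have hD : ∀ s, |s| ≤ |τs n| → ‖(φ s x).1 - x.1‖ ≤ τs n * (‖x.2‖ + M0 * τs n + M1) := by
        intro s hs
        rw [abs_of_pos hτ] at hs
        have a1 := hN.flow_q hφ x s
        have a2 : ‖(φ s x).1 - x.1‖ ≤ ‖(φ s x).1 - x.1 - s • x.2‖ + ‖s • x.2‖ := by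
          have := norm_add_le ((φ s x).1 - x.1 - s • x.2) (s • x.2)
          rwa [sub_add_cancel] at this
        rw [norm_smul, Real.norm_eq_abs] at a2
        have a3 : (M0 + c * M1) * |s| ^ 2 ≤ (M0 + c * M1) * (τs n) ^ 2 := by
          have : 0 ≤ M0 + c * M1 := hN.M_nonneg
          gcongr
        have a4 : (M0 + c * M1) * (τs n) ^ 2 = M0 * τs n ^ 2 + M1 * τs n := by
          rw [hc]; field_simp
        have a5 : |s| * ‖x.2‖ ≤ τs n * ‖x.2‖ := by gcongr
        nlinarith
      refine ⟨hD _ le_rfl, ?_⟩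
      have b := hN.flow_p2 hφ x (τs n) x.1 _ hD
      rw [abs_of_pos hτ] at b
      have e1 : (φ (τs n) x).2 - x.2 + cg v x.1 =
          ((φ (τs n) x).2 - x.2 + τs n • (gradf V0 x.1 + (c : ℝ) • cg v x.1)) - τs n • gradf V0 x.1 := by
        rw [smul_add, smul_smul, hc, mul_inv_cancel₀ hτ.ne', one_smul]; abel
      rw [e1]
      refine (norm_sub_le _ _).trans ?_
      have e2 : ‖τs n • gradf V0 x.1‖ ≤ M0 * τs n := by
        rw [norm_smul, Real.norm_eq_abs, abs_of_pos hτ, mul_comm]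
        exact mul_le_mul_of_nonneg_right (h0.bdd _) hτ.le
      have e3 : ((K0 + c * K1 : NNReal) : ℝ) * (τs n * (‖x.2‖ + M0 * τs n + M1)) * τs n
          = (K0 * τs n + K1) * (τs n * (‖x.2‖ + M0 * τs n + M1)) := by
        push_cast; rw [hc]; field_simp
      rw [e3] at b
      linarith
  choose Φ hΦ hest using key
  refine SSt.limit' hΦ τs_lim (adm_shear (contDiff_cg v).continuous.measurable.neg
    (fun q => by rw [per_of_add (cg_per v)])) (Eventually.of_forall fun x => ?_)
  have l1 : Tendsto (fun n => τs n * (‖x.2‖ + M0 * τs n + M1)) atTop (𝓝 0) := by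
    have : Tendsto (fun n => τs n * (‖x.2‖ + M0 * τs n + M1)) atTop (𝓝 (0 * (‖x.2‖ + M0 * 0 + M1))) :=
      τs_lim.mul ((tendsto_const_nhds.add (tendsto_const_nhds.mul τs_lim)).add tendsto_const_nhds)
    simpa using this
  have l2 : Tendsto (fun n => M0 * τs n + (K0 * τs n + K1) * (τs n * (‖x.2‖ + M0 * τs n + M1) ))
      atTop (𝓝 0) := by
    have : Tendsto (fun n => M0 * τs n + (K0 * τs n + K1) * (τs n * (‖x.2‖ + M0 * τs n + M1) ))
      atTop (𝓝 (M0 * 0 + (K0 * 0 + K1) * 0)) :=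
      (tendsto_const_nhds.mul τs_lim).add (((tendsto_const_nhds.mul τs_lim).add tendsto_const_nhds).mul l1)
    simpa using this
  have m1 := squeeze_zero_norm (fun n => (hest n x).1) l1
  have m2 := squeeze_zero_norm (fun n => (hest n x).2) l2
  have m3 : Tendsto (fun n => (Φ n x).1) atTop (𝓝 x.1) := by
    simpa using m1.add_const x.1
  have m4 : Tendsto (fun n => (Φ n x).2) atTop (𝓝 (x.2 + -cg v x.1)) := by
    have := m2.add_const (x.2 + -cg v x.1)
    rw [zero_add] at this
    refine this.congr fun n => by abel
  exact m3.prodMk_nhds m4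

lemma inF_cg (v : Fin d → ℝ × ℝ) : InF V0 p (cg v) := by
  refine ⟨(contDiff_cg v).continuous.measurable, per_of_add (cg_per v), fun s => ?_⟩
  have := sst_cg V0 p ((-s) • v)
  simp only [cg_smul] at this
  simpa only [neg_smul, neg_neg] using this

variable {V0 p}

lemma sst_bracket {F G : (Fin d → ℝ) → (Fin d → ℝ)} {F' : (Fin d → ℝ) → (Fin d → ℝ) →L[ℝ] (Fin d → ℝ)}
    (hF : InF V0 p F) (hd : ∀ q, HasFDerivAt F (F' q) q) (hG : ∀ q, G q = F' q (F q))
    (hm : Measurable G) (hper : ∀ q, G (redq q) = G q) :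
    SSt V0 p 0 (shear (fun q => - G q)) := by
  obtain ⟨φ, M, h1, hM, h2, h3⟩ := exists_drift V0 p
  have hs : ∀ n, SSt V0 p (τs n ^ 2) (shear (fun q => (-(τs n)⁻¹) • F q) ∘ φ (τs n ^ 2) ∘
      shear (fun q => ((τs n)⁻¹) • F q)) := fun n => by
    have := (hF.sst (-(τs n)⁻¹)).comp ((h1 (τs n ^ 2) (by positivity)).comp (hF.sst ((τs n)⁻¹)))
    simpa using this
  refine SSt.limit' hs (by simpa using τs_lim.pow 2) (adm_shear hm.neg fun q => by rw [hper])
    (Eventually.of_forall fun x => ?_)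
  set y : ℕ → Phase d := fun n => shear (fun q => ((τs n)⁻¹) • F q) x with hy
  set z : ℕ → Phase d := fun n => φ (τs n ^ 2) (y n) with hz
  have sq : Tendsto (fun n => M * |τs n ^ 2|) atTop (𝓝 0) := by
    have := (tendsto_const_nhds (x := M)).mul (τs_lim.pow 2).abs
    simpa using this
  -- momentum
  have z2 : Tendsto (fun n => (z n).2 - (y n).2) atTop (𝓝 0) :=
    squeeze_zero_norm (fun n => h2 (y n) (τs n ^ 2)) sq
  have z1 : Tendsto (fun n => (τs n)⁻¹ • ((z n).1 - x.1)) atTop (𝓝 (F x.1)) := by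
    have e : Tendsto (fun n => (τs n)⁻¹ • ((z n).1 - x.1 - (τs n ^ 2) • (y n).2)) atTop (𝓝 0) := by
      have l3 : Tendsto (fun n => M * τs n ^ 3) atTop (𝓝 0) := by
        simpa using (tendsto_const_nhds (x := M)).mul (τs_lim.pow 3)
      refine squeeze_zero_norm (fun n => ?_) l3
      have hτ := τs_pos n
      have := h3 (y n) (τs n ^ 2)
      rw [norm_smul, norm_inv, Real.norm_eq_abs, abs_of_pos hτ]
      rw [abs_of_nonneg (by positivity)] at this
      have h5 : (y n).1 = x.1 := rfl
      rw [h5] at this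
      calc (τs n)⁻¹ * _ ≤ (τs n)⁻¹ * (M * (τs n ^ 2) ^ 2) := by gcongr
        _ = _ := by field_simp
    have e2 : Tendsto (fun n => (τs n) • x.2 + F x.1) atTop (𝓝 ((0 : ℝ) • x.2 + F x.1)) :=
      (τs_lim.smul_const _).add_const _
    have e3 := e.add e2
    rw [zero_smul, zero_add, zero_add] at e3
    refine e3.congr fun n => ?_
    have hτ := (τs_pos n).ne'
    have h6 : (y n).2 = x.2 + (τs n)⁻¹ • F x.1 := rfl
    rw [h6, smul_sub, smul_add, smul_add, smul_smul, smul_smul, smul_smul]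
    rw [show (τs n)⁻¹ * τs n ^ 2 = τs n by field_simp,
      show τs n * (τs n)⁻¹ = 1 by field_simp, one_smul]
    abel
  have zq : Tendsto (fun n => (z n).1) atTop (𝓝 x.1) := by
    have := (τs_lim.smul z1).add_const x.1
    rw [zero_smul, zero_add] at this
    refine this.congr fun n => ?_
    rw [smul_smul, mul_inv_cancel₀ (τs_pos n).ne', one_smul]; abel
  have d1 := (hd x.1).hasFDerivWithinAt (s := Set.univ) |>.lim (l := atTop) (c := fun n => (τs n)⁻¹)
    (d := fun n => (z n).1 - x.1) (v := F x.1) (by simpa using zq.sub_const x.1) (by simp) z1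
  have zp : Tendsto (fun n => (z n).2 + (-(τs n)⁻¹) • F (z n).1) atTop (𝓝 (x.2 + - G x.1)) := by
    have := (z2.sub d1).add_const x.2
    rw [zero_sub, ← hG, add_comm] at this
    refine this.congr fun n => ?_
    have h6 : (y n).2 = x.2 + (τs n)⁻¹ • F x.1 := rfl
    simp only [h6, smul_sub, add_sub_cancel, neg_smul]
    abel
  exact zq.prodMk_nhds zp

end TL
end

open MeasureTheory Real
set_option autoImplicit false
set_option linter.all false
set_option linter.unusedSimpArgs false
set_option linter.unusedVariables false

noncomputable section
namespace TL
variable {d : ℕ}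
open Filter Topology

def rv (k : Fin d → ℤ) : Fin d → ℝ := fun i => (k i : ℝ)
def Ef (k : Fin d → ℤ) (γ : ℝ) (q : Fin d → ℝ) : Fin d → ℝ := Real.sin (dz k q + γ) • rv k

lemma measurable_dz (k : Fin d → ℤ) : Measurable (dz k) := (contDiff_dz k).continuous.measurable

lemma measurable_Ef (k : Fin d → ℤ) (γ : ℝ) : Measurable (Ef k γ) := by
  unfold Ef
  exact (Real.measurable_sin.comp ((measurable_dz k).add_const γ)).smul_const _

lemma Ef_per (k : Fin d → ℤ) (γ : ℝ) (q) : Ef k γ (redq q) = Ef k γ q := by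
  refine per_of_add (fun q m => ?_) q
  simp only [Ef]
  rw [dz_add, add_right_comm, Real.sin_add_int_mul_two_pi]

lemma dz_addk (k l : Fin d → ℤ) (q) : dz (k + l) q = dz k q + dz l q := by
  simp only [dz, Pi.add_apply, Int.cast_add, add_mul, Finset.sum_add_distrib]
lemma dz_negk (k : Fin d → ℤ) (q) : dz (-k) q = - dz k q := by
  simp [dz]
lemma dz_subk (k l : Fin d → ℤ) (q) : dz (k - l) q = dz k q - dz l q := by
  rw [sub_eq_add_neg, dz_addk, dz_negk]; ring

variable (V0 : (Fin d → ℝ) → ℝ) [GoodV V0] (p : ENNReal) [GoodP p]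

def KK (k : Fin d → ℤ) : Prop := ∀ γ, InF V0 p (Ef k γ)

lemma KK_kz (j : Fin d) : KK V0 p (kz d j) := by
  intro γ
  refine (inF_cg V0 p (Pi.single j (-Real.cos γ, Real.sin γ))).congr fun q => ?_
  funext i
  simp only [cg, Ef, rv, Pi.smul_apply, smul_eq_mul]
  rw [Finset.sum_eq_single j]
  · simp only [Pi.single_eq_same, Real.sin_add]; ring
  · intro b _ hb
    simp [hb]
  · simp

variable {V0 p}

lemma KK_zero : KK V0 p 0 := fun γ => InF.zero.congr fun q => by
  funext i; simp [Ef, rv]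

lemma KK_neg {k : Fin d → ℤ} (h : KK V0 p k) : KK V0 p (-k) := fun γ =>
  (h (-γ)).congr fun q => by
    funext i
    simp only [Ef, rv, dz_negk, Pi.smul_apply, Pi.neg_apply, smul_eq_mul]
    rw [show dz k q + -γ = -(-dz k q + γ) by ring, Real.sin_neg]
    push_cast; ring

lemma hasFDerivAt_Ef (k : Fin d → ℤ) (γ : ℝ) (q) :
    HasFDerivAt (Ef k γ) ((Real.cos (dz k q + γ) • dzL k).smulRight (rv k)) q := by
  have h1 : HasFDerivAt (fun q => Real.sin (dz k q + γ)) (Real.cos (dz k q + γ) • dzL k) q :=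
    ((hasFDerivAt_dz k q).add_const γ).sin
  exact h1.smul_const (rv k)

lemma Ef_add_pi (k : Fin d → ℤ) (γ : ℝ) (q) : Ef k (γ + π) q = - Ef k γ q := by
  simp only [Ef]
  rw [← add_assoc, Real.sin_add_pi, neg_smul]

lemma Ef_sub_pi (k : Fin d → ℤ) (γ : ℝ) (q) : Ef k (γ - π) q = - Ef k γ q := by
  simp only [Ef]
  rw [← add_sub_assoc, Real.sin_sub_pi, neg_smul]

lemma bracket2 {k l : Fin d → ℤ} (hk : KK V0 p k) (hl : KK V0 p l) (a b α β : ℝ) :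
    SSt V0 p 0 (shear (fun q => -(((a ^ 2 * dz k (rv k) / 4) • Ef (k + k) (α + α) q) +
      ((b ^ 2 * dz l (rv l) / 4) • Ef (l + l) (β + β) q) +
      (a * b * dz k (rv l) / 2) • (Ef (k + l) (α + β) q - Ef (k - l) (α - β) q)))) := by
  have hkl : dz k (rv l) = dz l (rv k) := by
    simp only [dz, rv]; exact Finset.sum_congr rfl fun i _ => mul_comm _ _
  refine sst_bracket (F := fun q => a • Ef k α q + b • Ef l β q)
    (F' := fun q => a • ((Real.cos (dz k q + α) • dzL k).smulRight (rv k)) +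
      b • ((Real.cos (dz l q + β) • dzL l).smulRight (rv l)))
    (((hk α).smul a).add ((hl β).smul b)) (fun q => ?_) (fun q => ?_) ?_ ?_
  · exact ((hasFDerivAt_Ef k α q).const_smul a).add ((hasFDerivAt_Ef l β q).const_smul b)
  · have hv : dzL k (a • Ef k α q + b • Ef l β q) =
        a * (Real.sin (dz k q + α) * dz k (rv k)) + b * (Real.sin (dz l q + β) * dz k (rv l)) := by
      simp [Ef, ← dzL_apply]
    have hw : dzL l (a • Ef k α q + b • Ef l β q) =
        a * (Real.sin (dz k q + α) * dz k (rv l)) + b * (Real.sin (dz l q + β) * dz l (rv l)) := by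
      rw [hkl]
      simp [Ef, ← dzL_apply]
    funext i
    simp only [ContinuousLinearMap.add_apply, ContinuousLinearMap.smul_apply,
      ContinuousLinearMap.smulRight_apply, hv, hw]
    simp only [Pi.add_apply, Pi.smul_apply, smul_eq_mul, Pi.sub_apply, Ef, dz_addk, dz_subk]
    simp only [rv, Pi.add_apply, Pi.sub_apply]
    have e1 : dz k q + dz k q + (α + α) = (dz k q + α) + (dz k q + α) := by ring
    have e2 : dz l q + dz l q + (β + β) = (dz l q + β) + (dz l q + β) := by ring
    have e3 : dz k q + dz l q + (α + β) = (dz k q + α) + (dz l q + β) := by ring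
    have e4 : dz k q - dz l q + (α - β) = (dz k q + α) - (dz l q + β) := by ring
    rw [e1, e2, e3, e4]
    simp only [Real.sin_add (dz k q + α), Real.sin_add (dz l q + β), Real.sin_sub]
    push_cast
    ring
  · have h1 := measurable_Ef (k + k) (α + α)
    have h2 := measurable_Ef (l + l) (β + β)
    have h3 := measurable_Ef (k + l) (α + β)
    have h4 := measurable_Ef (k - l) (α - β)
    fun_prop
  · intro q
    simp only [Ef_per]

lemma dz_self_nonneg (k : Fin d → ℤ) : 0 ≤ dz k (rv k) := by
  simp only [dz, rv]; exact Finset.sum_nonneg fun i _ => mul_self_nonneg _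

lemma dz_self_pos {k : Fin d → ℤ} (hk : k ≠ 0) : 0 < dz k (rv k) := by
  obtain ⟨i, hi⟩ := Function.ne_iff.1 hk
  simp only [dz, rv]
  refine Finset.sum_pos' (fun i _ => mul_self_nonneg _) ⟨i, Finset.mem_univ i, ?_⟩
  have : (k i : ℝ) ≠ 0 := by exact_mod_cast hi
  exact mul_self_pos.2 this

lemma KK_double {k : Fin d → ℤ} (hk : KK V0 p k) : KK V0 p (k + k) := by
  by_cases h0 : k = 0
  · subst h0; simpa using KK_zero
  have hpos := dz_self_pos h0
  intro γ
  -- negative multiples at every phase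
  have neg : ∀ c : ℝ, 0 ≤ c → ∀ γ, SSt V0 p 0 (shear (fun q => -(c • Ef (k + k) γ q))) := by
    intro c hc γ
    have := bracket2 hk hk (Real.sqrt (4 * c / dz k (rv k))) 0 (γ / 2) 0
    rw [Real.sq_sqrt (by positivity)] at this
    have e : 4 * c / dz k (rv k) * dz k (rv k) / 4 = c := by field_simp
    rw [e] at this
    simpa using this
  refine ⟨measurable_Ef _ _, Ef_per _ _, fun s => ?_⟩
  rcases le_total s 0 with hs | hs
  · simpa using neg (-s) (by linarith) γ
  · have := neg s hs (γ + π)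
    simpa [Ef_add_pi] using this

lemma KK_W {k l : Fin d → ℤ} (hk : KK V0 p k) (hl : KK V0 p l) (hkl : dz k (rv l) ≠ 0) (α β : ℝ) :
    InF V0 p (fun q => Ef (k + l) (α + β) q - Ef (k - l) (α - β) q) := by
  refine ⟨(measurable_Ef _ _).sub (measurable_Ef _ _), fun q => by simp only [Ef_per], fun s => ?_⟩
  have h1 := bracket2 hk hl (-(2 * s / dz k (rv l))) 1 α β
  have h2 := (KK_double hk (α + α)).sst ((-(2 * s / dz k (rv l))) ^ 2 * dz k (rv k) / 4)
  have h3 := (KK_double hl (β + β)).sst (1 ^ 2 * dz l (rv l) / 4)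
  have h4 := h1.comp0 (h2.comp0 h3)
  rw [shear_comp, shear_comp] at h4
  convert h4 using 2
  funext q
  have e : -(2 * s / dz k (rv l)) * 1 * dz k (rv l) / 2 = -s := by field_simp
  rw [e, neg_smul]
  abel

lemma KK_addsub {k l : Fin d → ℤ} (hk : KK V0 p k) (hl : KK V0 p l) (hkl : dz k (rv l) ≠ 0) :
    KK V0 p (k + l) ∧ KK V0 p (k - l) := by
  constructor
  · intro γ
    have h1 := (KK_W hk hl hkl γ 0).smul (1 / 2)
    have h2 := (KK_W hk hl hkl (γ + π / 2) (π / 2)).smul (-(1 / 2))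
    refine (h1.add h2).congr fun q => ?_
    rw [show γ + π / 2 + π / 2 = γ + π by ring, show γ + π / 2 - π / 2 = γ by ring, Ef_add_pi,
      add_zero, sub_zero]
    module
  · intro γ
    have h1 := (KK_W hk hl hkl γ 0).smul (-(1 / 2))
    have h2 := (KK_W hk hl hkl (γ + π / 2) (π / 2)).smul (-(1 / 2))
    refine (h1.add h2).congr fun q => ?_
    rw [show γ + π / 2 + π / 2 = γ + π by ring, show γ + π / 2 - π / 2 = γ by ring, Ef_add_pi,
      add_zero, sub_zero]
    module

lemma KK_add {k l : Fin d → ℤ} (hk : KK V0 p k) (hl : KK V0 p l) (hkl : ∑ i, k i * l i ≠ 0) :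
    KK V0 p (k + l) := (KK_addsub hk hl (by
      have : dz k (rv l) = ((∑ i, k i * l i : ℤ) : ℝ) := by simp [dz, rv]
      rw [this]; exact_mod_cast hkl)).1

lemma KK_sub {k l : Fin d → ℤ} (hk : KK V0 p k) (hl : KK V0 p l) (hkl : ∑ i, k i * l i ≠ 0) :
    KK V0 p (k - l) := (KK_addsub hk hl (by
      have : dz k (rv l) = ((∑ i, k i * l i : ℤ) : ℝ) := by simp [dz, rv]
      rw [this]; exact_mod_cast hkl)).2

def sg (j : Fin d) : Fin d → ℤ := Pi.single j 1
def ind (S : Finset (Fin d)) : Fin d → ℤ := fun i => if i ∈ S then 1 else 0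

lemma dot_sg (k : Fin d → ℤ) (j) : ∑ i, k i * sg j i = k j := by
  simp [sg, Pi.single_apply]

lemma KK_erase {S : Finset (Fin d)} {j : Fin d} (hj : j ∈ S) (h : KK V0 p (ind S))
    (h' : KK V0 p (sg j)) : KK V0 p (ind (S.erase j)) := by
  have := KK_sub h h' (by rw [dot_sg]; simp [ind, hj])
  convert this using 1
  funext i
  by_cases hi : i = j
  · subst hi; simp [ind, sg, hj]
  · simp [ind, sg, hi]

lemma KK_sdiff (good : ∀ j : Fin d, Prop) (hg : ∀ j, good j → KK V0 p (sg j))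
    (h : KK V0 p (ind (Finset.univ : Finset (Fin d)))) (T : Finset (Fin d)) (hT : ∀ j ∈ T, good j) :
    KK V0 p (ind (Finset.univ \ T)) := by
  induction T using Finset.induction_on with
  | empty => simpa using h
  | insert a T ha ih =>
    have := KK_erase (S := Finset.univ \ T) (j := a) (by simp [ha])
      (ih fun j hj => hT j (by simp [hj])) (hg a (hT a (by simp)))
    convert this using 2
    ext i; simp

lemma KK_ind (S : Finset (Fin d)) : KK V0 p (ind S) := by
  rcases Nat.eq_zero_or_pos d with hd | hd
  · subst hd
    rw [show ind S = 0 from Subsingleton.elim _ _]; exact KK_zero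
  have hlt : d - 1 < d := by omega
  have h1 : KK V0 p (ind (Finset.univ : Finset (Fin d))) := by
    have := KK_kz V0 p ⟨d - 1, hlt⟩
    convert this using 1
    funext i; simp [ind, kz]
  have h2 : ∀ j : Fin d, (j : ℕ) < d - 1 → KK V0 p (sg j) := fun j hj => by
    have := KK_kz V0 p j
    convert this using 1
    simp [kz, hj, sg]
  have h3 : KK V0 p (sg ⟨d - 1, hlt⟩) := by
    have := KK_sdiff (V0 := V0) (p := p) (fun j => (j : ℕ) < d - 1) h2 h1
      (Finset.univ.erase ⟨d - 1, hlt⟩) (by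
        intro j hj
        have h5 := (Finset.mem_erase.1 hj).1
        have : (j : ℕ) ≠ d - 1 := fun h => h5 (Fin.ext h)
        have := j.2
        show (j : ℕ) < d - 1
        omega)
    convert this using 1
    funext i
    by_cases hi : i = ⟨d - 1, hlt⟩
    · subst hi; simp [ind, sg]
    · simp [ind, sg, hi]
  have h4 : ∀ j : Fin d, KK V0 p (sg j) := fun j => by
    by_cases hj : (j : ℕ) < d - 1
    · exact h2 j hj
    · have : j = ⟨d - 1, hlt⟩ := Fin.ext (by have := j.2; simp; omega)
      rw [this]; exact h3
  have := KK_sdiff (V0 := V0) (p := p) (fun _ => True) (fun j _ => h4 j) h1 (Finset.univ \ S) (by simp)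
  simpa using this

lemma KK_sg (j : Fin d) : KK V0 p (sg j) := by
  have := KK_ind (V0 := V0) (p := p) {j}
  convert this using 1
  funext i
  by_cases hi : i = j
  · subst hi; simp [ind, sg]
  · simp [ind, sg, hi]

lemma KK_add_sg {k : Fin d → ℤ} (hk : KK V0 p k) (j : Fin d) : KK V0 p (k + sg j) := by
  by_cases h0 : k = 0
  · subst h0; simpa using KK_sg j
  by_cases hj : k j = 0
  swap
  · exact KK_add hk (KK_sg j) (by rwa [dot_sg])
  obtain ⟨i, hi⟩ := Function.ne_iff.1 h0
  have hij : i ≠ j := fun h => hi (by rw [h, hj]; rfl)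
  have hpair : KK V0 p (sg i + sg j) := by
    have := KK_ind (V0 := V0) (p := p) {i, j}
    convert this using 1
    funext m
    by_cases h1 : m = i
    · subst h1; simp [ind, sg, hij]
    · by_cases h2 : m = j
      · subst h2; simp [ind, sg, h1]
      · simp [ind, sg, h1, h2]
  have dadd : ∀ a b c : Fin d → ℤ, ∑ m, a m * (b + c) m = ∑ m, a m * b m + ∑ m, a m * c m :=
    fun a b c => by simp [mul_add, Finset.sum_add_distrib]
  by_cases h1 : k i = -1
  · have hm : KK V0 p (sg i + sg j - (sg i + sg i)) :=
      KK_sub hpair (KK_double (KK_sg i)) (by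
        rw [dadd, dot_sg]; simp [sg, hij])
    have e1 : sg i + sg j - (sg i + sg i) = sg j - sg i := by abel
    rw [e1] at hm
    have h2 : KK V0 p (k + (sg j - sg i)) := KK_add hk hm (by
      simp only [Pi.sub_apply, mul_sub, Finset.sum_sub_distrib, dot_sg, hj, h1]; norm_num)
    have h3 := KK_add h2 (KK_sg i) (by
      rw [dot_sg]; simp [sg, hij, h1])
    convert h3 using 1; abel
  · have h2 : KK V0 p (k + (sg i + sg j)) := KK_add hk hpair (by
      rw [dadd, dot_sg, dot_sg, hj, add_zero]; exact hi)
    have h3 := KK_sub h2 (KK_sg i) (by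
      rw [dot_sg]; simp [sg, hij]; omega)
    convert h3 using 1; abel

lemma KK_sub_sg {k : Fin d → ℤ} (hk : KK V0 p k) (j : Fin d) : KK V0 p (k - sg j) := by
  have := KK_neg (KK_add_sg (KK_neg hk) j)
  convert this using 1; abel

lemma KK_all (k : Fin d → ℤ) : KK V0 p k := by
  have h1 : ∀ (m : ℤ) (j : Fin d) (k : Fin d → ℤ), KK V0 p k → KK V0 p (k + m • sg j) := by
    intro m j k hk
    induction m using Int.induction_on with
    | zero => simpa using hk
    | succ n ih => rw [add_smul, one_smul, ← add_assoc]; exact KK_add_sg ih j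
    | pred n ih => rw [sub_smul, one_smul, ← add_sub_assoc]; exact KK_sub_sg ih j
  have h2 : ∀ S : Finset (Fin d), KK V0 p (∑ i ∈ S, k i • sg i) := by
    intro S
    induction S using Finset.induction_on with
    | empty => simpa using KK_zero
    | insert a S ha ih =>
      rw [Finset.sum_insert ha, add_comm]; exact h1 _ _ _ ih
  have := h2 Finset.univ
  convert this using 1
  funext i
  simp [Finset.sum_apply, sg, Pi.single_apply]

end TL
end

open MeasureTheory Real
set_option autoImplicit false
set_option linter.all false
set_option linter.unusedSimpArgs false
set_option linter.unusedVariables false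

noncomputable section
namespace TL
variable {d : ℕ}
open Filter Topology

/-- trigonometric polynomials with their gradients -/
inductive TP : ((Fin d → ℝ) → ℝ) → ((Fin d → ℝ) → (Fin d → ℝ)) → Prop
  | base (k : Fin d → ℤ) (γ c : ℝ) :
      TP (fun q => c * Real.cos (dz k q + γ)) (fun q => (-c) • Ef k γ q)
  | add {f f' g g'} : TP f g → TP f' g' → TP (fun q => f q + f' q) (fun q => g q + g' q)

lemma TP.congr {f f' : (Fin d → ℝ) → ℝ} {g g' : (Fin d → ℝ) → (Fin d → ℝ)} (h : TP f g)
    (h1 : ∀ q, f q = f' q) (h2 : ∀ q, g q = g' q) : TP f' g' := by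
  rwa [show f' = f from (funext h1).symm, show g' = g from (funext h2).symm]

lemma TP.mul_base {f : (Fin d → ℝ) → ℝ} {g : (Fin d → ℝ) → (Fin d → ℝ)} (h : TP f g)
    (k : Fin d → ℤ) (γ c : ℝ) :
    TP (fun q => f q * (c * Real.cos (dz k q + γ)))
      (fun q => f q • ((-c) • Ef k γ q) + (c * Real.cos (dz k q + γ)) • g q) := by
  induction h with
  | base l β b =>
    refine ((TP.base (k + l) (γ + β) (c * b / 2)).add (TP.base (k - l) (γ - β) (c * b / 2))).congr
      (fun q => ?_) (fun q => ?_)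
    · rw [dz_addk, dz_subk, show dz k q + dz l q + (γ + β) = (dz k q + γ) + (dz l q + β) by ring,
        show dz k q - dz l q + (γ - β) = (dz k q + γ) - (dz l q + β) by ring]
      simp only [Real.cos_add (dz k q + γ), Real.cos_sub]
      ring
    · funext i
      simp only [Ef, Pi.add_apply, Pi.smul_apply, smul_eq_mul]
      rw [dz_addk, dz_subk, show dz k q + dz l q + (γ + β) = (dz k q + γ) + (dz l q + β) by ring,
        show dz k q - dz l q + (γ - β) = (dz k q + γ) - (dz l q + β) by ring]
      simp only [Real.sin_add (dz k q + γ), Real.sin_sub, rv, Pi.add_apply, Pi.sub_apply]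
      push_cast
      ring
  | add h1 h2 ih1 ih2 =>
    refine (ih1.add ih2).congr (fun q => ?_) (fun q => ?_)
    · ring
    · module

lemma TP.mul {f f' : (Fin d → ℝ) → ℝ} {g g' : (Fin d → ℝ) → (Fin d → ℝ)} (h : TP f g)
    (h' : TP f' g') : TP (fun q => f q * f' q) (fun q => f q • g' q + f' q • g q) := by
  induction h' with
  | base l β b => exact h.mul_base l β b
  | add h1 h2 ih1 ih2 =>
    refine (ih1.add ih2).congr (fun q => ?_) (fun q => ?_)
    · ring
    · module

lemma TP.one : TP (fun _ : Fin d → ℝ => 1) (fun _ => 0) :=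
  (TP.base 0 0 1).congr (fun q => by simp [dz]) (fun q => by funext i; simp [Ef, rv])

lemma TP.prod {ι : Type*} [DecidableEq ι] (S : Finset ι) {f : ι → (Fin d → ℝ) → ℝ}
    {g : ι → (Fin d → ℝ) → (Fin d → ℝ)} (h : ∀ i, TP (f i) (g i)) :
    TP (fun q => ∏ i ∈ S, f i q) (fun q => ∑ i ∈ S, (∏ j ∈ S.erase i, f j q) • g i q) := by
  induction S using Finset.induction_on with
  | empty => simpa using TP.one
  | insert a S ha ih =>
    refine ((h a).mul ih).congr (fun q => ?_) (fun q => ?_)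
    · rw [Finset.prod_insert ha]
    · rw [Finset.sum_insert ha, Finset.erase_insert ha, add_comm, Finset.smul_sum]
      congr 1
      refine Finset.sum_congr rfl fun i hi => ?_
      have hia : i ≠ a := fun e => ha (e ▸ hi)
      rw [Finset.erase_insert_of_ne hia.symm, Finset.prod_insert (by simp [ha]), smul_smul]

/-- one-dimensional ones with derivative -/
inductive TP1 : (ℝ → ℝ) → (ℝ → ℝ) → Prop
  | base (m : ℤ) (γ c : ℝ) :
      TP1 (fun x => c * Real.cos (m * x + γ)) (fun x => -(c * m * Real.sin (m * x + γ)))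
  | add {f f' g g'} : TP1 f g → TP1 f' g' → TP1 (fun q => f q + f' q) (fun q => g q + g' q)

lemma TP1.congr {f f' g g' : ℝ → ℝ} (h : TP1 f g)
    (h1 : ∀ q, f q = f' q) (h2 : ∀ q, g q = g' q) : TP1 f' g' := by
  rwa [show f' = f from (funext h1).symm, show g' = g from (funext h2).symm]

lemma TP1.const (c : ℝ) : TP1 (fun _ => c) (fun _ => 0) :=
  (TP1.base 0 0 c).congr (by simp) (by simp)

lemma TP1.smul {f g : ℝ → ℝ} (h : TP1 f g) (c : ℝ) : TP1 (fun x => c * f x) (fun x => c * g x) := by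
  induction h with
  | base m γ b => exact (TP1.base m γ (c * b)).congr (fun q => by ring) (fun q => by ring)
  | add h1 h2 ih1 ih2 => exact (ih1.add ih2).congr (fun q => by ring) (fun q => by ring)

lemma TP1.shift {f g : ℝ → ℝ} (h : TP1 f g) (a : ℝ) : TP1 (fun x => f (x - a)) (fun x => g (x - a)) := by
  induction h with
  | base m γ b =>
    refine (TP1.base m (γ - m * a) b).congr (fun q => ?_) (fun q => ?_)
    · rw [show (m : ℝ) * q + (γ - m * a) = m * (q - a) + γ by ring]
    · rw [show (m : ℝ) * q + (γ - m * a) = m * (q - a) + γ by ring]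
  | add h1 h2 ih1 ih2 => exact ih1.add ih2

lemma TP1.sum {ι : Type*} (S : Finset ι) {f g : ι → ℝ → ℝ} (h : ∀ i, TP1 (f i) (g i)) :
    TP1 (fun x => ∑ i ∈ S, f i x) (fun x => ∑ i ∈ S, g i x) := by
  classical
  induction S using Finset.induction_on with
  | empty => simpa using TP1.const 0
  | insert a S ha ih =>
    simp only [Finset.sum_insert ha]
    exact (h a).add ih

lemma TP1.hasDerivAt {f g : ℝ → ℝ} (h : TP1 f g) (x : ℝ) : HasDerivAt f (g x) x := by
  induction h with
  | base m γ c =>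
    have h1 : HasDerivAt (fun x : ℝ => (m : ℝ) * x + γ) (m : ℝ) x := by
      simpa using ((hasDerivAt_id x).const_mul (m : ℝ)).add_const γ
    refine (h1.cos.const_mul c).congr_deriv ?_
    ring
  | add h1 h2 ih1 ih2 => exact ih1.add ih2

lemma TP1.per {f g : ℝ → ℝ} (h : TP1 f g) (x : ℝ) : f (x + 2 * π) = f x ∧ g (x + 2 * π) = g x := by
  induction h with
  | base m γ c =>
    beta_reduce
    rw [show (m : ℝ) * (x + 2 * π) + γ = (m * x + γ) + m * (2 * π) by ring,
      Real.cos_add_int_mul_two_pi, Real.sin_add_int_mul_two_pi]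
    exact ⟨rfl, rfl⟩
  | add h1 h2 ih1 ih2 => exact ⟨by beta_reduce; rw [ih1.1, ih2.1], by beta_reduce; rw [ih1.2, ih2.2]⟩

lemma TP1.toTP {f g : ℝ → ℝ} (h : TP1 f g) (i : Fin d) :
    TP (fun q => f (q i)) (fun q => g (q i) • (Pi.single i (1 : ℝ) : Fin d → ℝ)) := by
  induction h with
  | base m γ c =>
    have e : ∀ q : Fin d → ℝ, dz (m • sg i) q = m * q i := fun q => by
      simp [dz, sg, Pi.single_apply]
    refine (TP.base (m • sg i) γ c).congr (fun q => by rw [e]) (fun q => ?_)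
    funext j
    by_cases hj : j = i
    · subst hj
      simp only [Ef, Pi.smul_apply, e]
      simp only [Pi.smul_apply, rv, smul_eq_mul, sg, Pi.single_eq_same]
      push_cast
      ring
    · simp [Ef, rv, sg, hj]
  | add h1 h2 ih1 ih2 =>
    exact (ih1.add ih2).congr (fun q => rfl) (fun q => by rw [add_smul])

/-! ### Fejer sums -/
def sF (M : ℕ) (x : ℝ) : ℝ :=
  1 / ((M : ℝ) + 1) * ∑ m ∈ Finset.range (M + 1), ∑ j ∈ Finset.range m,
    (-2 / ((j : ℝ) + 1) * Real.cos (((j : ℤ) + 1 : ℤ) * x + -(π / 2)))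
def tF (M : ℕ) (x : ℝ) : ℝ :=
  1 / ((M : ℝ) + 1) * ∑ m ∈ Finset.range (M + 1), ∑ j ∈ Finset.range m,
    (-2 * Real.cos (((j : ℝ) + 1) * x))
def SF (M : ℕ) (x : ℝ) : ℝ :=
  1 / ((M : ℝ) + 1) * ∑ m ∈ Finset.range (M + 1), ∑ j ∈ Finset.range m,
    (2 / ((j : ℝ) + 1) ^ 2 * Real.cos (((j : ℤ) + 1 : ℤ) * x + 0))

lemma tp_sF (M : ℕ) : TP1 (sF M) (tF M) := by
  refine ((TP1.sum (Finset.range (M + 1)) fun m => TP1.sum (Finset.range m) fun (j : ℕ) => TP1.base ((j : ℤ) + 1) (-(π / 2)) (-2 / ((j : ℝ) + 1))).smul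
    (1 / ((M : ℝ) + 1))).congr (fun x => rfl) (fun x => ?_)
  unfold tF
  congr 1
  refine Finset.sum_congr rfl fun m _ => Finset.sum_congr rfl fun j _ => ?_
  rw [← sub_eq_add_neg, Real.sin_sub_pi_div_two]
  push_cast
  field_simp

lemma tp_SF (M : ℕ) : TP1 (SF M) (sF M) := by
  refine ((TP1.sum (Finset.range (M + 1)) fun m => TP1.sum (Finset.range m) fun (j : ℕ) => TP1.base ((j : ℤ) + 1) 0 (2 / ((j : ℝ) + 1) ^ 2)).smul
    (1 / ((M : ℝ) + 1))).congr (fun x => rfl) (fun x => ?_)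
  unfold sF
  congr 1
  refine Finset.sum_congr rfl fun m _ => Finset.sum_congr rfl fun j _ => ?_
  rw [← sub_eq_add_neg, Real.cos_sub_pi_div_two, add_zero]
  push_cast
  field_simp

lemma dirichlet (m : ℕ) (x : ℝ) :
    (1 - ∑ j ∈ Finset.range m, (-2 * Real.cos (((j : ℝ) + 1) * x))) * (1 - Real.cos x)
      = Real.cos (m * x) - Real.cos ((m + 1) * x) := by
  induction m with
  | zero => simp
  | succ m ih =>
    rw [Finset.sum_range_succ, ← sub_sub, sub_mul, ih]
    push_cast
    rw [show ((m : ℝ) + 1 + 1) * x = (m + 1) * x + x by ring,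
      show (m : ℝ) * x = (m + 1) * x - x by ring, Real.cos_add, Real.cos_sub]
    ring

lemma fejer (M : ℕ) (x : ℝ) :
    ((M : ℝ) + 1) * (1 - tF M x) * (1 - Real.cos x) = 1 - Real.cos ((M + 1) * x) := by
  have h : ((M : ℝ) + 1) * (1 - tF M x) =
      ∑ m ∈ Finset.range (M + 1), (1 - ∑ j ∈ Finset.range m, (-2 * Real.cos (((j : ℝ) + 1) * x))) := by
    rw [Finset.sum_sub_distrib, tF]
    have : (M : ℝ) + 1 ≠ 0 := by positivity
    simp only [Finset.sum_const, Finset.card_range, nsmul_eq_mul]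
    push_cast
    rw [mul_sub, ← mul_assoc, mul_one_div_cancel this, one_mul]
  rw [h, Finset.sum_mul]
  simp only [dirichlet]
  have := Finset.sum_range_sub' (fun m : ℕ => Real.cos (m * x)) (M + 1)
  push_cast at this
  rw [this]; simp

lemma tF_bound (M : ℕ) (x : ℝ) (hx : Real.cos x < 1) :
    |tF M x - 1| ≤ 2 / (1 - Real.cos x) * τs M := by
  have h1 := fejer M x
  have h2 : 0 < 1 - Real.cos x := by linarith
  have hM : (0 : ℝ) < M + 1 := by positivity
  have h3 : tF M x - 1 = -(1 - Real.cos ((M + 1) * x)) / ((M + 1) * (1 - Real.cos x)) := by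
    rw [← h1]; field_simp; ring
  rw [h3, abs_div, abs_neg, abs_of_pos (mul_pos hM h2)]
  have h4 : |1 - Real.cos ((M + 1) * x)| ≤ 2 := by
    rw [abs_le]; constructor <;> linarith [Real.cos_le_one ((M + 1) * x), Real.neg_one_le_cos ((M + 1) * x)]
  rw [τs, div_mul_div_comm, mul_one, mul_comm (1 - Real.cos x)]
  gcongr

lemma tF_lim (x : ℝ) (hx : Real.cos x < 1) : Tendsto (fun M => tF M x) atTop (𝓝 1) := by
  have h1 : Tendsto (fun M => tF M x - 1) atTop (𝓝 0) :=
    squeeze_zero_norm (fun M => tF_bound M x hx) (by simpa using τs_lim.const_mul (2 / (1 - Real.cos x)))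
  simpa using h1.add_const 1

lemma cos_lt_one {x : ℝ} (h0 : 0 < x) (h1 : x < 2 * π) : Real.cos x < 1 := by
  refine lt_of_le_of_ne (Real.cos_le_one x) fun h => ?_
  have := (Real.cos_eq_one_iff_of_lt_of_lt (by linarith [Real.pi_pos]) h1).1 h
  linarith

lemma sF_pi (M : ℕ) : sF M π = 0 := by
  unfold sF
  rw [Finset.sum_eq_zero, mul_zero]
  intro m _
  refine Finset.sum_eq_zero fun j _ => ?_
  rw [← sub_eq_add_neg, Real.cos_sub_pi_div_two, Real.sin_int_mul_pi, mul_zero]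

lemma cos_le_between {x y : ℝ} (h0 : 0 < x) (h1 : x < 2 * π) (hy : y ∈ Set.uIcc π x) :
    Real.cos y ≤ Real.cos x := by
  rcases le_total π x with h | h
  · rw [Set.uIcc_of_le h] at hy
    rw [← Real.cos_two_pi_sub y, ← Real.cos_two_pi_sub x]
    exact Real.cos_le_cos_of_nonneg_of_le_pi (by linarith) (by linarith [hy.1]) (by linarith [hy.2])
  · rw [Set.uIcc_of_ge h] at hy
    exact Real.cos_le_cos_of_nonneg_of_le_pi h0.le hy.2 hy.1

lemma sF_lim (x : ℝ) (h0 : 0 < x) (h1 : x < 2 * π) :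
    Tendsto (fun M => sF M x) atTop (𝓝 (x - π)) := by
  have hc := cos_lt_one h0 h1
  have key : ∀ M, ‖sF M x - (x - π)‖ ≤ 2 / (1 - Real.cos x) * τs M * |x - π| := by
    intro M
    have hd : ∀ y ∈ Set.uIcc π x, HasDerivWithinAt (fun y => sF M y - (y - π)) (tF M y - 1) (Set.uIcc π x) y :=
      fun y _ => (((tp_sF M).hasDerivAt y).sub ((hasDerivAt_id y).sub_const π)).hasDerivWithinAt
    have := (convex_uIcc π x).norm_image_sub_le_of_norm_hasDerivWithin_le hd
      (C := 2 / (1 - Real.cos x) * τs M) (fun y hy => by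
        have hy' := cos_le_between h0 h1 hy
        refine (tF_bound M y (by linarith)).trans ?_
        have := (τs_pos M).le
        have : 0 < 1 - Real.cos x := by linarith
        gcongr) Set.left_mem_uIcc Set.right_mem_uIcc
    simpa [sF_pi] using this
  have hl : Tendsto (fun M => 2 / (1 - Real.cos x) * τs M * |x - π|) atTop (𝓝 0) := by
    simpa using (τs_lim.const_mul (2 / (1 - Real.cos x))).mul_const |x - π|
  have := (squeeze_zero_norm key hl).add_const (x - π)
  simpa using this

lemma sF_lim' (x : ℝ) (h0 : x < 0) (h1 : -(2 * π) < x) :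
    Tendsto (fun M => sF M x) atTop (𝓝 (x + π)) := by
  have := sF_lim (x + 2 * π) (by linarith) (by linarith)
  simp only [((tp_sF _).per x).1] at this
  convert this using 2; ring

lemma tF_lim' (x : ℝ) (h0 : x ≠ 0) (h1 : -(2 * π) < x) (h2 : x < 2 * π) :
    Tendsto (fun M => tF M x) atTop (𝓝 1) := by
  rcases lt_or_gt_of_ne h0 with h | h
  · refine tF_lim x ?_
    rw [← Real.cos_neg]; exact cos_lt_one (by linarith) (by linarith)
  · exact tF_lim x (cos_lt_one h h2)

/-- approximate indicator of `(a,b)` -/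
def chF (a b : ℝ) (M : ℕ) (x : ℝ) : ℝ :=
  (b - a) / (2 * π) + (-(1 / (2 * π)) * sF M (x - a) + 1 / (2 * π) * sF M (x - b))
def chD (a b : ℝ) (M : ℕ) (x : ℝ) : ℝ :=
  0 + (-(1 / (2 * π)) * tF M (x - a) + 1 / (2 * π) * tF M (x - b))

lemma tp_chF (a b : ℝ) (M : ℕ) : TP1 (chF a b M) (chD a b M) :=
  (TP1.const _).add ((((tp_sF M).shift a).smul _).add (((tp_sF M).shift b).smul _))

lemma chD_lim {a b x : ℝ} (ha : 0 ≤ a) (hab : a < b) (hb : b ≤ 2 * π) (h0 : 0 < x) (h1 : x < 2 * π)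
    (hxa : x ≠ a) (hxb : x ≠ b) : Tendsto (fun M => chD a b M x) atTop (𝓝 0) := by
  have e1 := tF_lim' (x - a) (sub_ne_zero.2 hxa) (by linarith) (by linarith)
  have e2 := tF_lim' (x - b) (sub_ne_zero.2 hxb) (by linarith) (by linarith)
  have := ((e1.const_mul (-(1 / (2 * π)))).add (e2.const_mul (1 / (2 * π)))).const_add 0
  simpa [chD] using this

lemma chF_lim {a b x : ℝ} (ha : 0 ≤ a) (hab : a < b) (hb : b ≤ 2 * π) (h0 : 0 < x) (h1 : x < 2 * π)
    (hxa : x ≠ a) (hxb : x ≠ b) :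
    Tendsto (fun M => chF a b M x) atTop (𝓝 (if a < x ∧ x < b then 1 else 0)) := by
  have hpi := Real.pi_pos
  have key : ∀ u v : ℝ, Tendsto (fun M => sF M (x - a)) atTop (𝓝 u) →
      Tendsto (fun M => sF M (x - b)) atTop (𝓝 v) →
      Tendsto (fun M => chF a b M x) atTop
        (𝓝 ((b - a) / (2 * π) + (-(1 / (2 * π)) * u + 1 / (2 * π) * v))) := fun u v e1 e2 =>
    ((e1.const_mul (-(1 / (2 * π)))).add (e2.const_mul (1 / (2 * π)))).const_add _
  rcases lt_or_gt_of_ne hxa with h | h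
  · have := key _ _ (sF_lim' (x - a) (by linarith) (by linarith)) (sF_lim' (x - b) (by linarith) (by linarith))
    rw [if_neg (by rintro ⟨h1, _⟩; linarith)]
    convert this using 2; field_simp; ring
  · rcases lt_or_gt_of_ne hxb with h' | h'
    · have := key _ _ (sF_lim (x - a) (by linarith) (by linarith)) (sF_lim' (x - b) (by linarith) (by linarith))
      rw [if_pos ⟨h, h'⟩]
      convert this using 2; field_simp; ring
    · have := key _ _ (sF_lim (x - a) (by linarith) (by linarith)) (sF_lim (x - b) (by linarith) (by linarith))
      rw [if_neg (by rintro ⟨_, h1⟩; linarith)]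
      convert this using 2; field_simp; ring

variable {V0 : (Fin d → ℝ) → ℝ} [GoodV V0] {p : ENNReal} [GoodP p]

lemma TP.inF {f : (Fin d → ℝ) → ℝ} {g : (Fin d → ℝ) → (Fin d → ℝ)} (h : TP f g) : InF V0 p g := by
  induction h with
  | base k γ c => exact (KK_all k γ).smul (-c)
  | add h1 h2 ih1 ih2 => exact ih1.add ih2

/-- periodic saw -/
def saw (q : Fin d → ℝ) : Fin d → ℝ := fun i => redq q i - π

lemma measurable_saw : Measurable (saw : (Fin d → ℝ) → _) :=
  measurable_pi_iff.2 fun i => ((measurable_pi_apply i).comp measurable_redq).sub_const π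

lemma inF_saw : InF V0 p (saw : (Fin d → ℝ) → _) := by
  refine InF.lim (F := fun M q => ∑ i, sF M (q i) • (Pi.single i (1 : ℝ) : Fin d → ℝ))
    (fun M => InF.sum _ fun i _ => ((tp_SF M).toTP i).inF) measurable_saw
    (fun q => by unfold saw; rw [redq_redq]) ?_
  filter_upwards [ae_intQ] with x hx
  refine tendsto_pi_nhds.2 fun i => ?_
  have : saw x.1 i = x.1 i - π := by
    show redq x.1 i - π = _
    rw [redq_of_mem fun i => ⟨(hx i).1.le, (hx i).2⟩]
  rw [this]
  simpa [Finset.sum_apply, Pi.single_apply] using sF_lim (x.1 i) (hx i).1 (hx i).2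

/-- indicator of an open box -/
def Bx (a b : Fin d → ℝ) : Set (Fin d → ℝ) := {q | ∀ i, a i < q i ∧ q i < b i}

lemma measurableSet_Bx (a b : Fin d → ℝ) : MeasurableSet (Bx a b) := by
  have : Bx a b = ⋂ i, ((fun q : Fin d → ℝ => q i) ⁻¹' Set.Ioo (a i) (b i)) := by
    ext; simp [Bx]
  rw [this]
  exact MeasurableSet.iInter fun i => measurable_pi_apply i measurableSet_Ioo

open Classical in
def bF (X : Set (Fin d → ℝ)) (v : Fin d → ℝ) (q : Fin d → ℝ) : Fin d → ℝ := if redq q ∈ X then v else 0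

lemma measurable_bF {X : Set (Fin d → ℝ)} (hX : MeasurableSet X) (v) : Measurable (bF X v) := by
  classical
  unfold bF
  exact Measurable.ite (measurable_redq hX) measurable_const measurable_const

lemma bF_per (X : Set (Fin d → ℝ)) (v q) : bF X v (redq q) = bF X v q := by
  unfold bF
  rw [redq_redq]

lemma inF_box (a b v : Fin d → ℝ) (ha : ∀ i, 0 ≤ a i) (hb : ∀ i, b i ≤ 2 * π) :
    InF V0 p (bF (Bx a b) v) := by
  classical
  by_cases hab : ∀ i, a i < b i
  swap
  · push Not at hab
    obtain ⟨i, hi⟩ := hab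
    refine InF.zero.congr fun q => ?_
    rw [bF, if_neg]
    intro h
    have := h i
    linarith [this.1, this.2]
  have single : ∀ i0, InF V0 p (bF (Bx a b) (Pi.single i0 1)) := by
    intro i0
    have htp := fun M : ℕ => (TP.prod Finset.univ fun j => (tp_chF (a j) (b j) M).toTP j).mul ((tp_sF M).toTP i0)
    refine InF.lim (fun M => (htp M).inF) (measurable_bF (measurableSet_Bx a b) _) (bF_per _ _) ?_
    have hae : ∀ᵐ x ∂(volQ d), ∀ i, x.1 i ≠ a i ∧ x.1 i ≠ b i := by
      refine ae_all_iff.2 fun i => ?_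
      have h1 : ∀ c, ∀ᵐ x ∂(volQ d), x.1 i ≠ c := fun c => by
        have : volQ d {x | x.1 i = c} = 0 :=
          le_antisymm ((volQ_le _).trans (volume_wall i c).le) zero_le
        rw [ae_iff]; simpa using this
      filter_upwards [h1 (a i), h1 (b i)] with x u w using ⟨u, w⟩
    filter_upwards [ae_intQ, hae] with x hx hx2
    have l1 : ∀ S : Finset (Fin d), Tendsto (fun M => ∏ j ∈ S, chF (a j) (b j) M (x.1 j)) atTop
        (𝓝 (∏ j ∈ S, if a j < x.1 j ∧ x.1 j < b j then 1 else 0)) := fun S =>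
      tendsto_finset_prod _ fun j _ => chF_lim (ha j) (hab j) (hb j) (hx j).1 (hx j).2 (hx2 j).1 (hx2 j).2
    have l2 := fun j => chD_lim (ha j) (hab j) (hb j) (hx j).1 (hx j).2 (hx2 j).1 (hx2 j).2
    have l3 := tF_lim (x.1 i0) (cos_lt_one (hx i0).1 (hx i0).2)
    have l4 := sF_lim (x.1 i0) (hx i0).1 (hx i0).2
    have l5 := ((l1 Finset.univ).smul (l3.smul_const (Pi.single i0 (1 : ℝ) : Fin d → ℝ))).add
      (l4.smul (tendsto_finset_sum Finset.univ fun i _ =>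
        (l1 (Finset.univ.erase i)).smul ((l2 i).smul_const (Pi.single i (1 : ℝ) : Fin d → ℝ))))
    convert l5 using 2
    have e : bF (Bx a b) (Pi.single i0 1) x.1 = (∏ j, if a j < x.1 j ∧ x.1 j < b j then (1 : ℝ) else 0) •
        (Pi.single i0 1 : Fin d → ℝ) := by
      rw [bF, redq_of_mem fun i => ⟨(hx i).1.le, (hx i).2⟩]
      by_cases h : x.1 ∈ Bx a b
      · rw [if_pos h, Finset.prod_eq_one, one_smul]
        intro j _
        rw [if_pos (h j)]
      · rw [if_neg h]
        obtain ⟨j, hj⟩ := not_forall.1 h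
        rw [Finset.prod_eq_zero (Finset.mem_univ j) (if_neg hj), zero_smul]
    rw [e]
    simp
  refine (InF.sum Finset.univ fun i _ => (single i).smul (v i)).congr fun q => ?_
  funext j
  simp only [bF]
  split_ifs
  · simp [Finset.sum_apply, Pi.single_apply]
  · simp

end TL
end

open MeasureTheory Real
set_option autoImplicit false
set_option linter.all false
set_option linter.unusedSimpArgs false
set_option linter.unusedVariables false

noncomputable section
namespace TL
variable {d : ℕ}
open Filter Topology

/-! ### Swaps -/
open Classical in
def sd (U : Set (Phase d)) (c w : Phase d) : Phase d :=
  if w ∈ U then c else if w - c ∈ U then -c else 0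

def swp (U : Set (Phase d)) (c z : Phase d) : Phase d := red z + sd U c (red z)

structure Sw (U : Set (Phase d)) (c : Phase d) : Prop where
  meas : MeasurableSet U
  disj : ∀ w ∈ U, w - c ∉ U
  inn : ∀ w ∈ torusBlock d, w ∈ U → w + c ∈ torusBlock d
  inn' : ∀ w ∈ torusBlock d, w - c ∈ U → w - c ∈ torusBlock d
  fr : volume (frontier U) = 0

lemma sd_pos {U : Set (Phase d)} {c w : Phase d} (h : w ∈ U) : sd U c w = c := if_pos h
lemma sd_neg {U : Set (Phase d)} {c w : Phase d} (h : w ∉ U) (h' : w - c ∈ U) : sd U c w = -c := by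
  rw [sd, if_neg h, if_pos h']
lemma sd_zero {U : Set (Phase d)} {c w : Phase d} (h : w ∉ U) (h' : w - c ∉ U) : sd U c w = 0 := by
  rw [sd, if_neg h, if_neg h']

lemma sd_congr {U U' : Set (Phase d)} {c w w' : Phase d} (h : w ∈ U ↔ w' ∈ U')
    (h' : w - c ∈ U ↔ w' - c ∈ U') : sd U c w = sd U' c w' := by
  classical
  unfold sd
  exact if_congr h rfl (if_congr h' rfl rfl)

lemma measurable_sd {U : Set (Phase d)} (hU : MeasurableSet U) (c : Phase d) : Measurable (sd U c) := by
  classical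
  have : sd U c = fun w => if w ∈ U then c else if w - c ∈ U then -c else 0 := by
    funext w; unfold sd; congr
  rw [this]
  exact Measurable.ite hU measurable_const
    (Measurable.ite ((measurable_id.sub_const c) hU) measurable_const measurable_const)

lemma measurable_swp {U : Set (Phase d)} (hU : MeasurableSet U) (c : Phase d) : Measurable (swp U c) :=
  measurable_red.add ((measurable_sd hU c).comp measurable_red)

namespace Sw
variable {U : Set (Phase d)} {c : Phase d}

lemma disj' (h : Sw U c) {w : Phase d} (hw : w ∈ U) : w + c ∉ U := fun h1 =>
  h.disj _ h1 (by rwa [add_sub_cancel_right])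

lemma sd_sd (h : Sw U c) (w : Phase d) : sd U c (w + sd U c w) = - sd U c w := by
  by_cases h1 : w ∈ U
  · rw [sd_pos h1, sd_neg (h.disj' h1) (by rwa [add_sub_cancel_right])]
  · by_cases h2 : w - c ∈ U
    · rw [sd_neg h1 h2, ← sub_eq_add_neg, sd_pos h2, neg_neg]
    · rw [sd_zero h1 h2, add_zero, sd_zero h1 h2, neg_zero]

lemma mem (h : Sw U c) {w : Phase d} (hw : w ∈ torusBlock d) : w + sd U c w ∈ torusBlock d := by
  by_cases h1 : w ∈ U
  · rw [sd_pos h1]; exact h.inn w hw h1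
  · by_cases h2 : w - c ∈ U
    · rw [sd_neg h1 h2, ← sub_eq_add_neg]; exact h.inn' w hw h2
    · rw [sd_zero h1 h2, add_zero]; exact hw

lemma swp_mem (h : Sw U c) (x : Phase d) : swp U c x ∈ torusBlock d := h.mem (red_mem x)

lemma red_swp (h : Sw U c) (x : Phase d) : red (swp U c x) = swp U c x := red_of_mem (h.swp_mem x)

lemma swp_of_mem {w : Phase d} (hw : w ∈ torusBlock d) : swp U c w = w + sd U c w := by
  rw [swp, red_of_mem hw]

lemma vol_pre (h : Sw U c) {A : Set (Phase d)} (hA : MeasurableSet A) :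
    volume (swp U c ⁻¹' A ∩ torusBlock d) = volume (A ∩ torusBlock d) := by
  set Q := torusBlock d
  have hQ : MeasurableSet Q := measurableSet_block
  have hV : MeasurableSet {w : Phase d | w - c ∈ U} := (measurable_id.sub_const c) h.meas
  have hS : MeasurableSet (swp U c ⁻¹' A ∩ Q) := (measurable_swp h.meas c hA).inter hQ
  have dec : ∀ S : Set (Phase d), volume S = volume (S ∩ U) + (volume (S ∩ Uᶜ ∩ {w | w - c ∈ U}) +
      volume ((S ∩ Uᶜ) \ {w | w - c ∈ U})) := fun S => by
    rw [measure_inter_add_diff _ hV, ← Set.diff_eq, measure_inter_add_diff _ h.meas]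
  rw [dec, dec (A ∩ Q)]
  have e1 : volume (swp U c ⁻¹' A ∩ Q ∩ U) = volume (A ∩ Q ∩ Uᶜ ∩ {w | w - c ∈ U}) := by
    rw [← measure_preimage_add_right volume c (A ∩ Q ∩ Uᶜ ∩ {w | w - c ∈ U})]
    congr 1
    ext w
    simp only [Set.mem_inter_iff, Set.mem_preimage, Set.mem_setOf_eq, Set.mem_compl_iff,
      add_sub_cancel_right]
    constructor
    · rintro ⟨⟨h1, h2⟩, h3⟩
      rw [swp_of_mem h2, sd_pos h3] at h1
      exact ⟨⟨⟨h1, h.inn w h2 h3⟩, h.disj' h3⟩, h3⟩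
    · rintro ⟨⟨⟨h1, h2⟩, -⟩, h3⟩
      have h4 : w ∈ Q := by
        have := h.inn' _ h2 (by rwa [add_sub_cancel_right])
        rwa [add_sub_cancel_right] at this
      refine ⟨⟨?_, h4⟩, h3⟩
      rwa [swp_of_mem h4, sd_pos h3]
  have e2 : volume (swp U c ⁻¹' A ∩ Q ∩ Uᶜ ∩ {w | w - c ∈ U}) = volume (A ∩ Q ∩ U) := by
    rw [← measure_preimage_add_right volume c (swp U c ⁻¹' A ∩ Q ∩ Uᶜ ∩ {w | w - c ∈ U})]
    congr 1
    ext w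
    simp only [Set.mem_inter_iff, Set.mem_preimage, Set.mem_setOf_eq, Set.mem_compl_iff,
      add_sub_cancel_right]
    constructor
    · rintro ⟨⟨⟨h1, h2⟩, h5⟩, h3⟩
      have h4 : w ∈ Q := by
        have := h.inn' _ h2 (by rwa [add_sub_cancel_right])
        rwa [add_sub_cancel_right] at this
      rw [swp_of_mem h2, sd_neg h5 (by rwa [add_sub_cancel_right]), add_neg_cancel_right] at h1
      exact ⟨⟨h1, h4⟩, h3⟩
    · rintro ⟨⟨h1, h2⟩, h3⟩
      have h4 := h.inn w h2 h3
      refine ⟨⟨⟨?_, h4⟩, h.disj' h3⟩, h3⟩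
      rwa [swp_of_mem h4, sd_neg (h.disj' h3) (by rwa [add_sub_cancel_right]), add_neg_cancel_right]
  have e3 : (swp U c ⁻¹' A ∩ Q ∩ Uᶜ) \ {w | w - c ∈ U} = (A ∩ Q ∩ Uᶜ) \ {w | w - c ∈ U} := by
    ext w
    simp only [Set.mem_inter_iff, Set.mem_preimage, Set.mem_setOf_eq, Set.mem_compl_iff, Set.mem_diff]
    constructor
    · rintro ⟨⟨⟨h1, h2⟩, h3⟩, h4⟩
      rw [swp_of_mem h2, sd_zero h3 h4, add_zero] at h1
      exact ⟨⟨⟨h1, h2⟩, h3⟩, h4⟩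
    · rintro ⟨⟨⟨h1, h2⟩, h3⟩, h4⟩
      refine ⟨⟨⟨?_, h2⟩, h3⟩, h4⟩
      rwa [swp_of_mem h2, sd_zero h3 h4, add_zero]
  rw [e1, e2, e3, ← add_assoc, ← add_assoc, add_comm (volume (A ∩ Q ∩ U))]

lemma adm (h : Sw U c) : Adm (swp U c) := by
  refine ⟨measurable_swp h.meas c, fun x => by rw [swp, red_red]; rfl, ?_⟩
  have e : (fun x => red (swp U c x)) = swp U c := funext h.red_swp
  rw [e]
  refine ⟨measurable_swp h.meas c, Measure.ext fun A hA => ?_⟩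
  rw [Measure.map_apply (measurable_swp h.meas c) hA, volQ, Measure.restrict_apply hA,
    Measure.restrict_apply (measurable_swp h.meas c hA)]
  exact h.vol_pre hA

lemma ae_int (h : Sw U c) : ∀ᵐ x ∂(volQ d), IntQ x ∧ IntQ (swp U c x) := by
  filter_upwards [h.adm.ae_intQ, TL.ae_intQ] with x h1 h2
  rw [h.red_swp] at h1
  exact ⟨h2, h1⟩

lemma ev_mem {U : Set (Phase d)} {x : Phase d} (h : x ∉ frontier U) : ∀ᶠ w in 𝓝 x, (w ∈ U ↔ x ∈ U) := by
  by_cases hx : x ∈ closure U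
  · have h1 : x ∈ interior U := by
      by_contra h2; exact h ⟨hx, h2⟩
    filter_upwards [mem_interior_iff_mem_nhds.1 h1] with w hw
    exact ⟨fun _ => interior_subset h1, fun _ => hw⟩
  · have : (closure U)ᶜ ∈ 𝓝 x := isClosed_closure.isOpen_compl.mem_nhds hx
    filter_upwards [this] with w hw
    exact ⟨fun h => absurd (subset_closure h) hw, fun h => absurd (subset_closure h) hx⟩

lemma ae_loc (h : Sw U c) : ∀ᵐ x ∂(volQ d), ∀ᶠ w in 𝓝 x, sd U c w = sd U c x := by
  have h1 : ∀ᵐ x ∂(volQ d), x ∉ frontier U := by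
    rw [ae_iff]; simp only [not_not]
    exact le_antisymm ((volQ_le _).trans h.fr.le) zero_le
  have h2 : ∀ᵐ x ∂(volQ d), x - c ∉ frontier U := by
    rw [ae_iff]; simp only [not_not]
    refine le_antisymm ((volQ_le _).trans ?_) zero_le
    have := measure_preimage_add_right volume (-c) (frontier U)
    rw [h.fr] at this
    simp only [← sub_eq_add_neg] at this
    exact this.le
  filter_upwards [h1, h2] with x hx hx'
  have h3 : Tendsto (fun w => w - c) (𝓝 x) (𝓝 (x - c)) := tendsto_id.sub_const c
  filter_upwards [ev_mem hx, h3.eventually (ev_mem hx')] with w hw hw'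
  exact sd_congr hw hw'

end Sw
end TL
end

open MeasureTheory Real
set_option autoImplicit false
set_option linter.all false
set_option linter.unusedSimpArgs false
set_option linter.unusedVariables false

noncomputable section
namespace TL
variable {d : ℕ}
open Filter Topology

lemma isOpen_Bx (a b : Fin d → ℝ) : IsOpen (Bx a b) := by
  have : Bx a b = Set.univ.pi fun i => Set.Ioo (a i) (b i) := by ext; simp [Bx]
  rw [this]; exact isOpen_set_pi Set.finite_univ fun i _ => isOpen_Ioo

lemma convex_Bx (a b : Fin d → ℝ) : Convex ℝ (Bx a b) := by
  have : Bx a b = Set.univ.pi fun i => Set.Ioo (a i) (b i) := by ext; simp [Bx]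
  rw [this]; exact convex_pi fun i _ => convex_Ioo _ _

lemma mem_Bx_sub {a b v q : Fin d → ℝ} : q - v ∈ Bx a b ↔ q ∈ Bx (a + v) (b + v) := by
  simp only [Bx, Set.mem_setOf_eq, Pi.sub_apply, Pi.add_apply]
  refine forall_congr' fun i => ?_
  constructor <;> rintro ⟨h1, h2⟩ <;> constructor <;> linarith

def Uq (X : Set (Fin d → ℝ)) : Set (Phase d) := {x | x.1 ∈ X}
def Up (P : Set (Fin d → ℝ)) : Set (Phase d) := {x | x.2 ∈ P}
def Uqp (X P : Set (Fin d → ℝ)) : Set (Phase d) := {x | x.1 ∈ X ∧ x.2 ∈ P}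

lemma fr_Uq (a b : Fin d → ℝ) : volume (frontier (Uq (Bx a b))) = 0 :=
  Convex.addHaar_frontier _ ((convex_Bx a b).is_linear_preimage (f := Prod.fst) ⟨fun _ _ => rfl, fun _ _ => rfl⟩)
lemma convex_Up (a b : Fin d → ℝ) : Convex ℝ (Up (Bx a b)) :=
  (convex_Bx a b).is_linear_preimage (f := Prod.snd) ⟨fun _ _ => rfl, fun _ _ => rfl⟩
lemma fr_Up (a b : Fin d → ℝ) : volume (frontier (Up (Bx a b))) = 0 :=
  Convex.addHaar_frontier _ (convex_Up a b)
lemma fr_Uqp (a b a' b' : Fin d → ℝ) : volume (frontier (Uqp (Bx a b) (Bx a' b'))) = 0 :=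
  Convex.addHaar_frontier _ (((convex_Bx a b).is_linear_preimage (f := Prod.fst)
    ⟨fun _ _ => rfl, fun _ _ => rfl⟩).inter (convex_Up a' b'))

lemma inQ_add {a b v : Fin d → ℝ} (ha : ∀ i, 0 ≤ a i + v i) (hb : ∀ i, b i + v i ≤ 2 * π)
    {q : Fin d → ℝ} (h : q ∈ Bx a b) (i : Fin d) : 0 ≤ q i + v i ∧ q i + v i < 2 * π := by
  have := h i
  exact ⟨by linarith [ha i], by linarith [hb i]⟩

lemma sw_q {a b v : Fin d → ℝ} (ha : ∀ i, 0 ≤ a i) (hb : ∀ i, b i ≤ 2 * π)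
    (ha' : ∀ i, 0 ≤ a i + v i) (hb' : ∀ i, b i + v i ≤ 2 * π) (hd : ∀ q ∈ Bx a b, q - v ∉ Bx a b) :
    Sw (Uq (Bx a b)) (v, 0) := by
  refine ⟨measurable_fst (measurableSet_Bx a b), fun w hw => hd w.1 hw, fun w hw h i => ?_,
    fun w hw h i => ?_, fr_Uq a b⟩
  · exact inQ_add ha' hb' h i
  · have := h i
    exact ⟨by linarith [ha i, this.1], by linarith [hb i, this.2]⟩

lemma sw_p {a b v : Fin d → ℝ} (hd : ∀ q ∈ Bx a b, q - v ∉ Bx a b) :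
    Sw (Up (Bx a b)) (0, v) := by
  refine ⟨measurable_snd (measurableSet_Bx a b), fun w hw => hd w.2 hw, fun w hw h => ?_,
    fun w hw h => ?_, fr_Up a b⟩
  · intro i; simpa using hw i
  · intro i; simpa using hw i

lemma measurableSet_Uqp (a b a' b' : Fin d → ℝ) : MeasurableSet (Uqp (Bx a b) (Bx a' b')) :=
  (measurable_fst (measurableSet_Bx a b)).inter (measurable_snd (measurableSet_Bx a' b'))

lemma sw_row {a b a' b' v : Fin d → ℝ} (ha : ∀ i, 0 ≤ a i) (hb : ∀ i, b i ≤ 2 * π)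
    (ha' : ∀ i, 0 ≤ a i + v i) (hb' : ∀ i, b i + v i ≤ 2 * π) (hd : ∀ q ∈ Bx a b, q - v ∉ Bx a b) :
    Sw (Uqp (Bx a b) (Bx a' b')) (v, 0) := by
  refine ⟨measurableSet_Uqp a b a' b', fun w hw h => hd w.1 hw.1 h.1, fun w hw h i => ?_,
    fun w hw h i => ?_, fr_Uqp a b a' b'⟩
  · exact inQ_add ha' hb' h.1 i
  · have := h.1 i
    exact ⟨by linarith [ha i, this.1], by linarith [hb i, this.2]⟩

lemma sw_col {a b a' b' v : Fin d → ℝ} (hd : ∀ q ∈ Bx a' b', q - v ∉ Bx a' b') :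
    Sw (Uqp (Bx a b) (Bx a' b')) (0, v) := by
  refine ⟨measurableSet_Uqp a b a' b', fun w hw h => hd w.2 hw.2 h.2, fun w hw h => ?_,
    fun w hw h => ?_, fr_Uqp a b a' b'⟩
  · intro i; simpa using hw i
  · intro i; simpa using hw i

variable {V0 : (Fin d → ℝ) → ℝ} [GoodV V0] {p : ENNReal} [GoodP p]

lemma sst_A {a b v : Fin d → ℝ} (ha : ∀ i, 0 ≤ a i) (hb : ∀ i, b i ≤ 2 * π)
    (ha' : ∀ i, 0 ≤ a i + v i) (hb' : ∀ i, b i + v i ≤ 2 * π) (hd : ∀ q ∈ Bx a b, q - v ∉ Bx a b) :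
    SSt V0 p 0 (swp (Uq (Bx a b)) (v, 0)) := by
  have hS := sw_q ha hb ha' hb' hd
  set U := Uq (Bx a b) with hU
  set F : (Fin d → ℝ) → (Fin d → ℝ) := fun q => (sd U (v, 0) (redq q, 0)).1 with hF
  have hFp : ∀ q p', sd U (v, 0) (redq q, p') = (F q, 0) := by
    intro q p'
    have : sd U (v, 0) (redq q, p') = sd U (v, 0) (redq q, 0) := sd_congr Iff.rfl Iff.rfl
    rw [this]
    refine Prod.ext rfl ?_
    unfold sd
    split_ifs <;> simp
  have hIn : InF V0 p F := by
    refine ((inF_box a b v ha hb).add (inF_box (a + v) (b + v) (-v) ha' hb')).congr fun q => ?_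
    by_cases h1 : redq q ∈ Bx a b
    · have h2 : redq q ∉ Bx (a + v) (b + v) := fun h => hd _ h1 (mem_Bx_sub.2 h)
      have h3 : F q = v := by simp only [hF]; rw [sd_pos (show ((redq q, 0) : Phase d) ∈ U from h1)]
      rw [h3, bF, bF, if_pos h1, if_neg h2, add_zero]
    · by_cases h2 : redq q - v ∈ Bx a b
      · have h3 : F q = -v := by
          simp only [hF]
          rw [sd_neg (show ((redq q, 0) : Phase d) ∉ U from h1) (show ((redq q, 0) : Phase d) - (v, 0) ∈ U from h2)]
          rfl
        rw [h3, bF, bF, if_neg h1, if_pos (mem_Bx_sub.1 h2), zero_add]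
      · have h3 : F q = 0 := by
          simp only [hF]
          rw [sd_zero (show ((redq q, 0) : Phase d) ∉ U from h1) (show ((redq q, 0) : Phase d) - (v, 0) ∉ U from h2)]
          rfl
        rw [h3, bF, bF, if_neg h1, if_neg (fun h => h2 (mem_Bx_sub.2 h)), zero_add]
  obtain ⟨φ, M, h1, hM, h2, h3⟩ := exists_drift V0 p
  have hs : ∀ n, SSt V0 p (τs n) (shear (fun q => ((τs n)⁻¹) • F q) ∘ φ (τs n) ∘
      shear (fun q => ((τs n)⁻¹) • F q)) := fun n => by
    have := (hIn.sst ((τs n)⁻¹)).comp ((h1 (τs n) (τs_pos n).le).comp (hIn.sst ((τs n)⁻¹)))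
    simpa using this
  refine SSt.limit' hs τs_lim hS.adm ?_
  have hl2 : ∀ᵐ x ∂(volQ d), ∀ᶠ w in 𝓝 (swp U (v, 0) x), sd U (v, 0) w = sd U (v, 0) (swp U (v, 0) x) := by
    have := hS.adm.mp.quasiMeasurePreserving.ae hS.ae_loc
    filter_upwards [this] with x hx
    rwa [hS.red_swp] at hx
  filter_upwards [hS.ae_int, hl2] with x hx hx2
  have hxQ := hx.1.mem
  have hredx : redq x.1 = x.1 := redq_of_mem hxQ
  have hsx : sd U (v, 0) x = (F x.1, 0) := by
    rw [← hFp x.1 x.2, hredx]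
  have hΨ : swp U (v, 0) x = (x.1 + F x.1, x.2) := by
    rw [Sw.swp_of_mem hxQ, hsx]; ext <;> simp
  have hsd2 : sd U (v, 0) (swp U (v, 0) x) = (- F x.1, 0) := by
    rw [Sw.swp_of_mem hxQ, hS.sd_sd, hsx]; simp
  rw [hsd2, hΨ] at hx2
  rw [hΨ] at hx ⊢
  set y : ℕ → Phase d := fun n => shear (fun q => ((τs n)⁻¹) • F q) x with hy
  set z : ℕ → Phase d := fun n => φ (τs n) (y n) with hz
  have sq1 : Tendsto (fun n => M * |τs n|) atTop (𝓝 0) := by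
    simpa using (tendsto_const_nhds (x := M)).mul τs_lim.abs
  have sq2 : Tendsto (fun n => M * |τs n| ^ 2) atTop (𝓝 0) := by
    simpa using (tendsto_const_nhds (x := M)).mul (τs_lim.abs.pow 2)
  have z2 : Tendsto (fun n => (z n).2 - (y n).2) atTop (𝓝 0) :=
    squeeze_zero_norm (fun n => h2 (y n) (τs n)) sq1
  have z1 : Tendsto (fun n => (z n).1 - (y n).1 - τs n • (y n).2) atTop (𝓝 0) :=
    squeeze_zero_norm (fun n => h3 (y n) (τs n)) sq2
  have zq : Tendsto (fun n => (z n).1) atTop (𝓝 (x.1 + F x.1)) := by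
    have := (z1.add (τs_lim.smul_const x.2)).add_const (x.1 + F x.1)
    rw [zero_smul, zero_add, zero_add] at this
    refine this.congr fun n => ?_
    have h5 : (y n).1 = x.1 := rfl
    have h6 : (y n).2 = x.2 + (τs n)⁻¹ • F x.1 := rfl
    rw [h5, h6, smul_add, smul_smul, mul_inv_cancel₀ (τs_pos n).ne', one_smul]
    abel
  have hev : ∀ᶠ n in atTop, F (z n).1 = - F x.1 := by
    have t : Tendsto (fun n => ((z n).1, x.2)) atTop (𝓝 (x.1 + F x.1, x.2)) :=
      zq.prodMk_nhds tendsto_const_nhds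
    filter_upwards [t.eventually hx2, t.eventually (isOpen_intQ.mem_nhds hx.2)] with n hn hn2
    have h5 : redq (z n).1 = (z n).1 := redq_of_mem hn2.mem
    rw [← h5, hFp] at hn
    exact congrArg Prod.fst hn
  refine zq.prodMk_nhds ?_
  have := z2.add_const x.2
  rw [zero_add] at this
  refine this.congr' ?_
  filter_upwards [hev] with n hn
  have h6 : (y n).2 = x.2 + (τs n)⁻¹ • F x.1 := rfl
  show _ = (z n).2 + (τs n)⁻¹ • F (z n).1
  rw [hn, h6, smul_neg]
  abel

end TL
end

open MeasureTheory Real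
set_option autoImplicit false
set_option linter.all false
set_option linter.unusedSimpArgs false
set_option linter.unusedVariables false

noncomputable section
namespace TL
variable {d : ℕ}
open Filter Topology

/-! ### Rotation -/
def pv : Fin d → ℝ := fun _ => π
def Jn (t : ℝ) (w : Phase d) : Phase d := (pv + t • w.2, (-t⁻¹) • (w.1 - pv))
def Ji (t : ℝ) (y : Phase d) : Phase d := (pv - t • y.2, t⁻¹ • (y.1 - pv))
def Ln (t : ℝ) (w : Phase d) : Phase d := (t • w.2, (-t⁻¹) • w.1)

lemma Jn_Ji {t : ℝ} (ht : t ≠ 0) (y : Phase d) : Jn t (Ji t y) = y := by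
  ext i
  · simp [Jn, Ji, pv]; field_simp; ring
  · simp [Jn, Ji, pv]; field_simp

lemma Ji_Jn {t : ℝ} (ht : t ≠ 0) (y : Phase d) : Ji t (Jn t y) = y := by
  ext i
  · simp [Jn, Ji, pv]; field_simp; ring
  · simp [Jn, Ji, pv]; field_simp

lemma Jn_add (t : ℝ) (w v : Phase d) : Jn t (w + v) = Jn t w + Ln t v := by
  ext i
  · simp [Jn, Ln]; ring
  · simp [Jn, Ln]; ring

lemma Ji_sub_Ln {t : ℝ} (ht : t ≠ 0) (y v : Phase d) : Ji t (Jn t y - Ln t v) = y - v := by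
  rw [show Jn t y - Ln t v = Jn t (y - v) from ?_, Ji_Jn ht]
  rw [sub_eq_iff_eq_add, ← Jn_add, sub_add_cancel]

lemma Ln_neg (t : ℝ) (v : Phase d) : Ln t (-v) = - Ln t v := by
  ext i <;> simp [Ln]

lemma Ln_zero (t : ℝ) : Ln t (0 : Phase d) = 0 := by
  ext i <;> simp [Ln]

def Nw (w : Phase d) : Phase d := (pv + pv - w.1, - w.2)
lemma Nw_Nw (w : Phase d) : Nw (Nw w) = w := by ext i <;> simp [Nw]
lemma Nw_int {w : Phase d} (h : IntQ w) : IntQ (Nw w) := fun i => by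
  have := h i
  simp only [Nw, Pi.sub_apply, Pi.add_apply, pv]
  constructor <;> linarith

lemma saw_eq {q : Fin d → ℝ} (h : ∀ i, 0 ≤ q i ∧ q i < 2 * π) : saw q = q - pv := by
  funext i
  show redq q i - π = _
  rw [redq_of_mem h]; rfl

lemma isOpen_int1 : IsOpen {q : Fin d → ℝ | ∀ i, 0 < q i ∧ q i < 2 * π} := by
  have : {q : Fin d → ℝ | ∀ i, 0 < q i ∧ q i < 2 * π} = Bx (fun _ => 0) (fun _ => 2 * π) := rfl
  rw [this]; exact isOpen_Bx _ _

lemma ev_saw {q : ℕ → Fin d → ℝ} {q0 : Fin d → ℝ} (h : Tendsto q atTop (𝓝 q0))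
    (h0 : ∀ i, 0 < q0 i ∧ q0 i < 2 * π) : ∀ᶠ n in atTop, saw (q n) = q n - pv := by
  filter_upwards [h.eventually (isOpen_int1.mem_nhds h0)] with n hn
  exact saw_eq fun i => ⟨(hn i).1.le, (hn i).2⟩

lemma pv_int (i : Fin d) : 0 < (pv : Fin d → ℝ) i ∧ (pv : Fin d → ℝ) i < 2 * π := by
  have := Real.pi_pos
  simp only [pv]
  constructor <;> linarith

section
variable (φ : ℝ → Phase d → Phase d)
def Rn (n : ℕ) : Phase d → Phase d :=
  shear (fun q => (-(τs n)⁻¹) • saw q) ∘ φ (τs n) ∘ shear (fun q => (-(τs n)⁻¹) • saw q)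

variable {φ} {M : ℝ}

lemma drift1 (h2 : ∀ x t, ‖(φ t x).2 - x.2‖ ≤ M * |t|) (y : ℕ → Phase d) :
    Tendsto (fun n => (φ (τs n) (y n)).2 - (y n).2) atTop (𝓝 0) :=
  squeeze_zero_norm (fun n => h2 (y n) (τs n)) (by
    simpa using (tendsto_const_nhds (x := M)).mul τs_lim.abs)

lemma drift2 (h3 : ∀ x t, ‖(φ t x).1 - x.1 - t • x.2‖ ≤ M * |t| ^ 2) (y : ℕ → Phase d) :
    Tendsto (fun n => (τs n)⁻¹ • ((φ (τs n) (y n)).1 - (y n).1 - τs n • (y n).2)) atTop (𝓝 0) := by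
  refine squeeze_zero_norm (a := fun n => M * τs n) (fun n => ?_)
    (by simpa using (tendsto_const_nhds (x := M)).mul τs_lim)
  have hτ := τs_pos n
  have := h3 (y n) (τs n)
  rw [norm_smul, norm_inv, Real.norm_eq_abs, abs_of_pos hτ]
  rw [abs_of_pos hτ] at this
  calc (τs n)⁻¹ * _ ≤ (τs n)⁻¹ * (M * (τs n) ^ 2) := by gcongr
    _ = _ := by field_simp

lemma R1 (h2 : ∀ x t, ‖(φ t x).2 - x.2‖ ≤ M * |t|)
    (h3 : ∀ x t, ‖(φ t x).1 - x.1 - t • x.2‖ ≤ M * |t| ^ 2)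
    {z : ℕ → Phase d} {z0 : Phase d} (hz : Tendsto z atTop (𝓝 z0)) (h0 : IntQ z0) :
    Tendsto (fun n => Ji (τs n) (Rn φ n (z n))) atTop (𝓝 z0) := by
  have hz1 : Tendsto (fun n => (z n).1) atTop (𝓝 z0.1) := (continuous_fst.tendsto z0).comp hz
  have hz2 : Tendsto (fun n => (z n).2) atTop (𝓝 z0.2) := (continuous_snd.tendsto z0).comp hz
  set y : ℕ → Phase d := fun n => shear (fun q => (-(τs n)⁻¹) • saw q) (z n) with hy
  set u : ℕ → Phase d := fun n => φ (τs n) (y n) with hu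
  have e1 := drift1 h2 y
  have e2 := drift2 h3 y
  have ev1 := ev_saw hz1 h0
  -- (u - pi)/tau -> p
  have k1 : Tendsto (fun n => (τs n)⁻¹ • ((u n).1 - pv)) atTop (𝓝 z0.2) := by
    have := e2.add hz2
    rw [zero_add] at this
    refine this.congr' ?_
    filter_upwards [ev1] with n hn
    have hτ := (τs_pos n).ne'
    have h6 : (y n).2 = (z n).2 + (-(τs n)⁻¹) • saw (z n).1 := rfl
    have h7 : (y n).1 = (z n).1 := rfl
    show (τs n)⁻¹ • ((u n).1 - (y n).1 - τs n • (y n).2) + (z n).2 = _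
    rw [h6, h7, hn]
    ext i
    simp only [Pi.add_apply, Pi.smul_apply, Pi.sub_apply, smul_eq_mul]
    field_simp
    ring
  have k2 : Tendsto (fun n => (u n).1) atTop (𝓝 pv) := by
    have := (τs_lim.smul k1).add_const pv
    rw [zero_smul, zero_add] at this
    refine this.congr fun n => ?_
    rw [smul_smul, mul_inv_cancel₀ (τs_pos n).ne', one_smul]; abel
  have ev2 := ev_saw k2 pv_int
  refine Tendsto.prodMk_nhds ?_ k1
  have := ((τs_lim.smul (e1.add (hz2.sub k1))).neg).add hz1
  rw [zero_smul, neg_zero, zero_add] at this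
  refine this.congr' ?_
  filter_upwards [ev1, ev2] with n hn hn2
  have hτ := (τs_pos n).ne'
  have h6 : (y n).2 = (z n).2 + (-(τs n)⁻¹) • saw (z n).1 := rfl
  show -(τs n • ((u n).2 - (y n).2 + ((z n).2 - (τs n)⁻¹ • ((u n).1 - pv)))) + (z n).1
    = pv - τs n • ((u n).2 + (-(τs n)⁻¹) • saw (u n).1)
  rw [h6, hn, hn2]
  ext i
  simp only [Pi.add_apply, Pi.smul_apply, Pi.sub_apply, Pi.neg_apply, smul_eq_mul]
  field_simp
  ring

lemma R2 (h2 : ∀ x t, ‖(φ t x).2 - x.2‖ ≤ M * |t|)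
    (h3 : ∀ x t, ‖(φ t x).1 - x.1 - t • x.2‖ ≤ M * |t| ^ 2)
    {w : ℕ → Phase d} {w0 : Phase d} (hw : Tendsto w atTop (𝓝 w0)) (h0 : IntQ w0) :
    Tendsto (fun n => Rn φ n (Jn (τs n) (w n))) atTop (𝓝 (Nw w0)) := by
  have hw1 : Tendsto (fun n => (w n).1) atTop (𝓝 w0.1) := (continuous_fst.tendsto w0).comp hw
  have hw2 : Tendsto (fun n => (w n).2) atTop (𝓝 w0.2) := (continuous_snd.tendsto w0).comp hw
  set y : ℕ → Phase d := fun n => shear (fun q => (-(τs n)⁻¹) • saw q) (Jn (τs n) (w n)) with hy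
  set u : ℕ → Phase d := fun n => φ (τs n) (y n) with hu
  have e1 := drift1 h2 y
  have e2 := drift2 h3 y
  have a1 : Tendsto (fun n => pv + τs n • (w n).2) atTop (𝓝 pv) := by
    have := (τs_lim.smul hw2).const_add pv
    rwa [zero_smul, add_zero] at this
  have ev1 := ev_saw a1 pv_int
  have hy1 : ∀ n, (y n).1 = pv + τs n • (w n).2 := fun n => rfl
  have hy2 : ∀ᶠ n in atTop, (y n).2 = (-(τs n)⁻¹) • ((w n).1 - pv) - (w n).2 := by
    filter_upwards [ev1] with n hn
    have hτ := (τs_pos n).ne'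
    show (-(τs n)⁻¹) • ((w n).1 - pv) + (-(τs n)⁻¹) • saw (pv + τs n • (w n).2) = _
    rw [hn]
    ext i
    simp only [Pi.add_apply, Pi.smul_apply, Pi.sub_apply, smul_eq_mul]
    field_simp
    ring
  have k0 : Tendsto (fun n => (τs n)⁻¹ • ((u n).1 - (pv + pv - (w n).1))) atTop (𝓝 0) := by
    refine e2.congr' ?_
    filter_upwards [hy2] with n hn
    have hτ := (τs_pos n).ne'
    show (τs n)⁻¹ • ((u n).1 - (y n).1 - τs n • (y n).2) = _
    rw [hy1, hn]
    ext i
    simp only [Pi.add_apply, Pi.smul_apply, Pi.sub_apply, smul_eq_mul]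
    field_simp
    ring
  have k2 : Tendsto (fun n => (u n).1) atTop (𝓝 (pv + pv - w0.1)) := by
    have := (τs_lim.smul k0).add (hw1.const_sub (pv + pv))
    rw [zero_smul, zero_add] at this
    refine this.congr fun n => ?_
    rw [smul_smul, mul_inv_cancel₀ (τs_pos n).ne', one_smul]; abel
  have ev2 := ev_saw k2 (Nw_int h0)
  refine Tendsto.prodMk_nhds k2 ?_
  have := (e1.sub k0).sub hw2
  rw [sub_zero, zero_sub] at this
  refine this.congr' ?_
  filter_upwards [hy2, ev2] with n hn hn2
  have hτ := (τs_pos n).ne'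
  show (u n).2 - (y n).2 - _ - _ = (u n).2 + (-(τs n)⁻¹) • saw (u n).1
  rw [hn, hn2]
  ext i
  simp only [Pi.add_apply, Pi.smul_apply, Pi.sub_apply, Pi.neg_apply, smul_eq_mul]
  field_simp
  ring

end

variable {V0 : (Fin d → ℝ) → ℝ} [GoodV V0] {p : ENNReal} [GoodP p]

lemma sst_rot {U : Set (Phase d)} {c : Phase d} (hS : Sw U c)
    (h : ∀ᶠ n in atTop, SSt V0 p 0 (swp (Ji (τs n) ⁻¹' U) (Ln (τs n) c))) : SSt V0 p 0 (swp U c) := by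
  obtain ⟨φ, M, h1, hM, h2, h3⟩ := exists_drift V0 p
  have hR : ∀ n, SSt V0 p (τs n) (Rn φ n) := fun n => by
    have hI : InF V0 p (saw : (Fin d → ℝ) → _) := inF_saw
    have := (hI.sst (-(τs n)⁻¹)).comp ((h1 (τs n) (τs_pos n).le).comp (hI.sst (-(τs n)⁻¹)))
    rw [zero_add, add_zero] at this
    exact this
  refine SSt.limit (t := fun n => τs n + (τs n + (τs n + (0 + τs n))))
    (Ψn := fun n => Rn φ n ∘ Rn φ n ∘ Rn φ n ∘ swp (Ji (τs n) ⁻¹' U) (Ln (τs n) c) ∘ Rn φ n) ?_ ?_ hS.adm ?_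
  · filter_upwards [h] with n hn
    exact (hR n).comp ((hR n).comp ((hR n).comp (hn.comp (hR n))))
  · simpa using τs_lim.add (τs_lim.add (τs_lim.add ((tendsto_const_nhds (x := (0 : ℝ))).add τs_lim)))
  filter_upwards [hS.ae_int, hS.ae_loc] with x hx hloc
  have hΨ := Sw.swp_of_mem (U := U) (c := c) hx.1.mem
  have a1 := R1 h2 h3 (tendsto_const_nhds (x := x)) hx.1
  set w : ℕ → Phase d := fun n => Ji (τs n) (Rn φ n x) with hw
  have a2 : ∀ᶠ n in atTop, swp (Ji (τs n) ⁻¹' U) (Ln (τs n) c) (Rn φ n x) =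
      Jn (τs n) (w n + sd U c x) := by
    have b1 : Tendsto (fun n => pv + τs n • (w n).2) atTop (𝓝 pv) := by
      have := (τs_lim.smul ((continuous_snd.tendsto x).comp a1)).const_add pv
      rwa [zero_smul, add_zero] at this
    filter_upwards [a1.eventually hloc, b1.eventually (isOpen_int1.mem_nhds pv_int)] with n hn hn2
    have hτ := (τs_pos n).ne'
    have e : Rn φ n x = Jn (τs n) (w n) := (Jn_Ji hτ _).symm
    rw [e, Jn_add, Sw.swp_of_mem (show Jn (τs n) (w n) ∈ torusBlock d from
      fun i => ⟨(hn2 i).1.le, (hn2 i).2⟩), ← hn]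
    congr 1
    have m1 : Jn (τs n) (w n) ∈ Ji (τs n) ⁻¹' U ↔ w n ∈ U := by
      rw [Set.mem_preimage, Ji_Jn hτ]
    have m2 : Jn (τs n) (w n) - Ln (τs n) c ∈ Ji (τs n) ⁻¹' U ↔ w n - c ∈ U := by
      rw [Set.mem_preimage, Ji_sub_Ln hτ]
    by_cases q1 : w n ∈ U
    · rw [sd_pos q1, sd_pos (m1.2 q1)]
    · by_cases q2 : w n - c ∈ U
      · rw [sd_neg q1 q2, sd_neg (mt m1.1 q1) (m2.2 q2), Ln_neg]
      · rw [sd_zero q1 q2, sd_zero (mt m1.1 q1) (mt m2.1 q2), Ln_zero]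
  have a3 : Tendsto (fun n => w n + sd U c x) atTop (𝓝 (swp U c x)) := by
    rw [hΨ]; exact a1.add_const _
  have a4 := R2 h2 h3 a3 hx.2
  have a5 := R1 h2 h3 a4 (Nw_int hx.2)
  have a6 := R2 h2 h3 a5 (Nw_int hx.2)
  rw [Nw_Nw] at a6
  refine a6.congr' ?_
  filter_upwards [a2] with n hn
  simp only [Function.comp]
  rw [hn, Jn_Ji (τs_pos n).ne']

end TL
end

open MeasureTheory Real
set_option autoImplicit false
set_option linter.all false
set_option linter.unusedSimpArgs false
set_option linter.unusedVariables false

noncomputable section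
namespace TL
variable {d : ℕ}
open Filter Topology
variable {V0 : (Fin d → ℝ) → ℝ} [GoodV V0] {p : ENNReal} [GoodP p]

lemma ev_bd (u : Fin d → ℝ) : ∀ᶠ n in atTop, ∀ i : Fin d, 0 < (pv + τs n • u : Fin d → ℝ) i ∧
    (pv + τs n • u : Fin d → ℝ) i < 2 * π := by
  have b1 : Tendsto (fun n => pv + τs n • u) atTop (𝓝 pv) := by
    have := (τs_lim.smul_const u).const_add (pv : Fin d → ℝ)
    rwa [zero_smul, add_zero] at this
  exact b1.eventually (isOpen_int1.mem_nhds pv_int)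

lemma mem_scale {t : ℝ} (ht : 0 < t) {a b q : Fin d → ℝ} :
    t⁻¹ • (q - pv) ∈ Bx a b ↔ q ∈ Bx (pv + t • a) (pv + t • b) := by
  simp only [Bx, Set.mem_setOf_eq, Pi.sub_apply, Pi.add_apply, Pi.smul_apply, smul_eq_mul]
  refine forall_congr' fun i => ?_
  rw [lt_inv_mul_iff₀ ht, inv_mul_lt_iff₀ ht, lt_sub_iff_add_lt', sub_lt_iff_lt_add']

lemma mem_scale' {t : ℝ} (ht : 0 < t) {a b q : Fin d → ℝ} :
    pv - t • q ∈ Bx a b ↔ q ∈ Bx (t⁻¹ • (pv - b)) (t⁻¹ • (pv - a)) := by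
  simp only [Bx, Set.mem_setOf_eq, Pi.sub_apply, Pi.smul_apply, smul_eq_mul]
  refine forall_congr' fun i => ?_
  rw [lt_inv_mul_iff₀ ht, inv_mul_lt_iff₀ ht]
  constructor <;> rintro ⟨h1, h2⟩ <;> constructor <;> linarith

lemma disj_scale {t : ℝ} (ht : 0 < t) {a b v : Fin d → ℝ} (hd : ∀ q ∈ Bx a b, q - v ∉ Bx a b) :
    ∀ q ∈ Bx (pv + t • a) (pv + t • b), q - t • v ∉ Bx (pv + t • a) (pv + t • b) := by
  intro q h1 h2
  rw [← mem_scale ht] at h1 h2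
  refine hd _ h1 ?_
  convert h2 using 1
  rw [smul_sub, smul_sub, smul_sub, smul_smul, inv_mul_cancel₀ ht.ne', one_smul]; abel

lemma sst_D {a b v : Fin d → ℝ} (hd : ∀ q ∈ Bx a b, q - v ∉ Bx a b) :
    SSt V0 p 0 (swp (Up (Bx a b)) (0, v)) := by
  refine sst_rot (sw_p hd) ?_
  filter_upwards [ev_bd a, ev_bd b, ev_bd (a + v), ev_bd (b + v)] with n h1 h2 h3 h4
  have hτ := τs_pos n
  have e1 : Ji (τs n) ⁻¹' (Up (Bx a b)) = Uq (Bx (pv + τs n • a) (pv + τs n • b)) := by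
    ext y; exact mem_scale hτ
  have e2 : Ln (τs n) ((0, v) : Phase d) = (τs n • v, 0) := by ext i <;> simp [Ln]
  rw [e1, e2]
  refine sst_A (fun i => (h1 i).1.le) (fun i => (h2 i).2.le) (fun i => ?_) (fun i => ?_) (disj_scale hτ hd)
  · have := (h3 i).1.le
    simp only [Pi.add_apply, Pi.smul_apply, smul_eq_mul] at this ⊢
    linarith
  · have := (h4 i).2.le
    simp only [Pi.add_apply, Pi.smul_apply, smul_eq_mul] at this ⊢
    linarith

lemma sst_col (i0 : Fin d) {a b a' b' v : Fin d → ℝ} (ha : ∀ i, 0 ≤ a i) (hb : ∀ i, b i ≤ 2 * π)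
    (hd : ∀ q ∈ Bx a' b', q - v ∉ Bx a' b') :
    SSt V0 p 0 (swp (Uqp (Bx a b) (Bx a' b')) (0, v)) := by
  set e : Fin d → ℝ := fun _ => 1
  have hI : InF V0 p (bF (Bx a b) e) := inF_box a b e ha hb
  have hD : SSt V0 p 0 (swp (Up (Bx a' b')) (0, v)) := sst_D hd
  have hSD : Sw (Up (Bx a' b')) (0, v) := sw_p hd
  have hS : Sw (Uqp (Bx a b) (Bx a' b')) (0, v) := sw_col hd
  refine SSt.limit' (t := fun _ => 0) (Ψn := fun n : ℕ => shear (fun q => (-(n : ℝ)) • bF (Bx a b) e q) ∘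
    swp (Up (Bx a' b')) (0, v) ∘ shear (fun q => (n : ℝ) • bF (Bx a b) e q) ∘ swp (Up (Bx a' b')) (0, v))
    (fun n => (hI.sst _).comp0 (hD.comp0 ((hI.sst _).comp0 hD))) tendsto_const_nhds hS.adm ?_
  filter_upwards [hS.ae_int] with x hx
  have hxQ := hx.1.mem
  have hredx : redq x.1 = x.1 := redq_of_mem hxQ
  have hD1 : swp (Up (Bx a' b')) (0, v) x = x + sd (Up (Bx a' b')) (0, v) x := Sw.swp_of_mem hxQ
  have hs1 : ∀ w : Phase d, (sd (Up (Bx a' b')) (0, v) w).1 = 0 := fun w => by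
    unfold sd; split_ifs <;> simp
  set y := swp (Up (Bx a' b')) (0, v) x with hy
  have hy1 : y.1 = x.1 := by rw [hD1]; simp [hs1]
  have hyQ : y ∈ torusBlock d := hSD.swp_mem x
  rw [Sw.swp_of_mem hxQ]
  by_cases hX : x.1 ∈ Bx a b
  · have hb1 : bF (Bx a b) e x.1 = e := by rw [bF, hredx, if_pos hX]
    have hfin : x + sd (Uqp (Bx a b) (Bx a' b')) (0, v) x = y := by
      rw [hD1]; congr 1
      refine sd_congr ⟨fun h => h.2, fun h => ⟨hX, h⟩⟩ ⟨fun h => h.2, fun h => ⟨?_, h⟩⟩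
      simpa using hX
    rw [hfin]
    refine tendsto_const_nhds.congr' ?_
    have hbig : ∀ᶠ n : ℕ in atTop, b' i0 + |v i0| ≤ y.2 i0 + n := by
      have : Tendsto (fun n : ℕ => y.2 i0 + (n : ℝ)) atTop atTop :=
        tendsto_atTop_add_const_left _ _ tendsto_natCast_atTop_atTop
      exact this.eventually_ge_atTop _
    filter_upwards [hbig] with n hn
    have s1 : shear (fun q => (n : ℝ) • bF (Bx a b) e q) y = (x.1, y.2 + (n : ℝ) • e) := by
      rw [shear, hy1, hb1]
    have hQ2 : ((x.1, y.2 + (n : ℝ) • e) : Phase d) ∈ torusBlock d := hxQ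
    have s2 : swp (Up (Bx a' b')) (0, v) (x.1, y.2 + (n : ℝ) • e) = (x.1, y.2 + (n : ℝ) • e) := by
      rw [Sw.swp_of_mem hQ2, sd_zero, add_zero]
      · intro h
        have := (h i0).2
        simp only [Pi.add_apply, Pi.smul_apply, smul_eq_mul, e, mul_one] at this
        linarith [abs_nonneg (v i0)]
      · intro h
        have := (h i0).2
        simp only [Prod.snd_sub, Pi.sub_apply, Pi.add_apply, Pi.smul_apply, smul_eq_mul, e, mul_one] at this
        linarith [le_abs_self (v i0)]
    simp only [Function.comp]
    rw [← hy, s1, s2, shear, hb1]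
    refine Prod.ext hy1 ?_
    simp
  · have hb1 : bF (Bx a b) e x.1 = 0 := by rw [bF, hredx, if_neg hX]
    have hfin : sd (Uqp (Bx a b) (Bx a' b')) (0, v) x = 0 := by
      refine sd_zero (fun h => hX h.1) (fun h => hX ?_)
      simpa using h.1
    rw [hfin, add_zero]
    refine tendsto_const_nhds.congr fun n => ?_
    have s1 : ∀ (c : ℝ) (z : Phase d), z.1 = x.1 → shear (fun q => c • bF (Bx a b) e q) z = z := by
      intro c z hz
      rw [shear, hz, hb1]
      refine Prod.ext hz.symm ?_
      simp
    have s2 : swp (Up (Bx a' b')) (0, v) y = x := by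
      rw [Sw.swp_of_mem hyQ, hD1, hSD.sd_sd, add_neg_cancel_right]
    simp only [Function.comp]
    rw [← hy, s1 _ _ hy1, s2, s1 _ _ rfl]

lemma sst_row (i0 : Fin d) {a b a' b' v : Fin d → ℝ} (ha : ∀ i, 0 ≤ a i) (hb : ∀ i, b i ≤ 2 * π)
    (ha' : ∀ i, 0 ≤ a i + v i) (hb' : ∀ i, b i + v i ≤ 2 * π)
    (hd : ∀ q ∈ Bx a b, q - v ∉ Bx a b) :
    SSt V0 p 0 (swp (Uqp (Bx a b) (Bx a' b')) (v, 0)) := by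
  refine sst_rot (sw_row ha hb ha' hb' hd) ?_
  filter_upwards [ev_bd a', ev_bd b'] with n h1 h2
  have hτ := τs_pos n
  have e1 : Ji (τs n) ⁻¹' (Uqp (Bx a b) (Bx a' b')) = Uqp (Bx (pv + τs n • a') (pv + τs n • b'))
      (Bx ((τs n)⁻¹ • (pv - b)) ((τs n)⁻¹ • (pv - a))) := by
    ext y
    exact ⟨fun h => ⟨(mem_scale hτ).1 h.2, (mem_scale' hτ).1 h.1⟩,
      fun h => ⟨(mem_scale' hτ).2 h.2, (mem_scale hτ).2 h.1⟩⟩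
  have e2 : Ln (τs n) ((v, 0) : Phase d) = (0, (-(τs n)⁻¹) • v) := by ext i <;> simp [Ln]
  rw [e1, e2]
  refine sst_col i0 (fun i => (h1 i).1.le) (fun i => (h2 i).2.le) fun q m1 m2 => ?_
  rw [← mem_scale' hτ] at m1 m2
  refine hd _ m1 ?_
  convert m2 using 1
  rw [smul_sub, smul_smul, mul_neg, mul_inv_cancel₀ hτ.ne', neg_one_smul]; abel

end TL
end

open MeasureTheory Real
set_option autoImplicit false
set_option linter.all false
set_option linter.unusedSimpArgs false
set_option linter.unusedVariables false

noncomputable section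
namespace TL
variable {d : ℕ}
open Filter Topology

/-! ### Mesh permutations -/
abbrev Idx (d N L : ℕ) := (Fin d → Fin N) × (Fin d → Fin L)

def cr {N L : ℕ} (h A : ℝ) (i : Idx d N L) : Phase d :=
  (fun k => h * (i.1 k : ℕ), fun k => h * (i.2 k : ℕ) - A)

def hv (h : ℝ) : Fin d → ℝ := fun _ => h

def Cb {N L : ℕ} (h A : ℝ) (i : Idx d N L) : Set (Phase d) :=
  Uqp (Bx (cr h A i).1 ((cr h A i).1 + hv h)) (Bx (cr h A i).2 ((cr h A i).2 + hv h))

variable {N L : ℕ} {h A : ℝ}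

lemma mem_Cb {i : Idx d N L} {z : Phase d} : z ∈ Cb h A i ↔
    (∀ k, h * (i.1 k : ℕ) < z.1 k ∧ z.1 k < h * (i.1 k : ℕ) + h) ∧
    (∀ k, h * (i.2 k : ℕ) - A < z.2 k ∧ z.2 k < h * (i.2 k : ℕ) - A + h) := Iff.rfl

lemma cell_unique (hh : 0 < h) {m n : ℕ} {x : ℝ} (h1 : h * m < x) (h2 : x < h * m + h)
    (h3 : h * n < x) (h4 : x < h * n + h) : m = n := by
  have e1 : h * m < h * (n + 1) := by linarith
  have e2 : h * n < h * (m + 1) := by linarith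
  have e3 := lt_of_mul_lt_mul_left e1 hh.le
  have e4 := lt_of_mul_lt_mul_left e2 hh.le
  have e5 : m < n + 1 := by exact_mod_cast e3
  have e6 : n < m + 1 := by exact_mod_cast e4
  omega

lemma cell_q (hh : 0 < h) {a a' : Fin d → Fin N} {q : Fin d → ℝ}
    (h1 : ∀ k, h * (a k : ℕ) < q k ∧ q k < h * (a k : ℕ) + h)
    (h2 : ∀ k, h * (a' k : ℕ) < q k ∧ q k < h * (a' k : ℕ) + h) : a = a' := by
  funext k
  exact Fin.ext (cell_unique hh (h1 k).1 (h1 k).2 (h2 k).1 (h2 k).2)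

lemma cell_p (hh : 0 < h) {a a' : Fin d → Fin L} {q : Fin d → ℝ}
    (h1 : ∀ k, h * (a k : ℕ) - A < q k ∧ q k < h * (a k : ℕ) - A + h)
    (h2 : ∀ k, h * (a' k : ℕ) - A < q k ∧ q k < h * (a' k : ℕ) - A + h) : a = a' := by
  refine cell_q (q := fun k => q k + A) hh (fun k => ?_) (fun k => ?_)
  · have := h1 k; constructor <;> linarith
  · have := h2 k; constructor <;> linarith

lemma Cb_unique (hh : 0 < h) {i j : Idx d N L} {z : Phase d} (h1 : z ∈ Cb h A i) (h2 : z ∈ Cb h A j) :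
    i = j := Prod.ext (cell_q hh h1.1 h2.1) (cell_p hh h1.2 h2.2)

lemma Cb_shift {i j : Idx d N L} {z : Phase d} (h1 : z ∈ Cb h A i) :
    z + (cr h A j - cr h A i) ∈ Cb h A j := by
  rw [mem_Cb] at h1 ⊢
  refine ⟨fun k => ?_, fun k => ?_⟩
  · have := h1.1 k
    simp only [cr, Prod.fst_add, Prod.fst_sub, Pi.add_apply, Pi.sub_apply]
    constructor <;> linarith
  · have := h1.2 k
    simp only [cr, Prod.snd_add, Prod.snd_sub, Pi.add_apply, Pi.sub_apply]
    constructor <;> linarith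

lemma Cb_shift_iff {i j : Idx d N L} {z : Phase d} :
    z - (cr h A j - cr h A i) ∈ Cb h A i ↔ z ∈ Cb h A j := by
  constructor
  · intro h1
    have := Cb_shift (j := j) h1
    rwa [sub_add_cancel] at this
  · intro h1
    have := Cb_shift (j := i) h1
    convert this using 1
    abel

lemma cr_bd (hh : 0 < h) (hN : h * N = 2 * π) (a : Fin N) : 0 ≤ h * (a : ℕ) ∧ h * (a : ℕ) + h ≤ 2 * π := by
  refine ⟨by positivity, ?_⟩
  rw [← hN]
  have : ((a : ℕ) : ℝ) + 1 ≤ N := by exact_mod_cast a.2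
  nlinarith

lemma Cb_int (hh : 0 < h) (hN : h * N = 2 * π) {i : Idx d N L} {z : Phase d} (hz : z ∈ Cb h A i) : IntQ z := by
  intro k
  have h1 := cr_bd hh hN (i.1 k)
  have h2 := hz.1 k
  have h3 : h * (i.1 k : ℕ) < z.1 k ∧ z.1 k < h * (i.1 k : ℕ) + h := h2
  constructor <;> linarith

def PermOK (V : (Fin d → ℝ) → ℝ) [GoodV V] (p' : ENNReal) [GoodP p'] (h' A' : ℝ) {N' L' : ℕ}
    (σ : Equiv.Perm (Idx d N' L')) : Prop :=
  ∃ Ψ, SSt V p' 0 Ψ ∧ ∀ i, ∀ z ∈ Cb h' A' i, Ψ z = z + (cr h' A' (σ i) - cr h' A' i)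

variable {V0 : (Fin d → ℝ) → ℝ} [GoodV V0] {p : ENNReal} [GoodP p]

lemma PermOK.one : PermOK V0 p h A (1 : Equiv.Perm (Idx d N L)) :=
  ⟨id, SSt.id, fun i z _ => by simp⟩

lemma PermOK.mul {σ σ' : Equiv.Perm (Idx d N L)} (h1 : PermOK V0 p h A σ) (h2 : PermOK V0 p h A σ') :
    PermOK V0 p h A (σ * σ') := by
  obtain ⟨Ψ, a1, a2⟩ := h1
  obtain ⟨Ψ', b1, b2⟩ := h2
  refine ⟨Ψ ∘ Ψ', a1.comp0 b1, fun i z hz => ?_⟩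
  rw [Function.comp, b2 i z hz, a2 (σ' i) _ (Cb_shift hz), Equiv.Perm.mul_apply]
  abel

lemma PermOK.of_swp (hh : 0 < h) (hN : h * N = 2 * π) {i j : Idx d N L} (hij : i ≠ j)
    (hs : SSt V0 p 0 (swp (Cb h A i) (cr h A j - cr h A i))) :
    PermOK V0 p h A (Equiv.swap i j) := by
  refine ⟨_, hs, fun k z hz => ?_⟩
  rw [Sw.swp_of_mem (Cb_int hh hN hz).mem]
  congr 1
  by_cases hki : k = i
  · subst hki
    rw [sd_pos hz, Equiv.swap_apply_left]
  · have n1 : z ∉ Cb h A i := fun h1 => hki (Cb_unique hh hz h1)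
    by_cases hkj : k = j
    · subst hkj
      rw [sd_neg n1 (Cb_shift_iff.2 hz), Equiv.swap_apply_right, neg_sub]
    · rw [sd_zero n1 (fun h1 => hkj (Cb_unique hh hz (Cb_shift_iff.1 h1))),
        Equiv.swap_apply_of_ne_of_ne hki hkj, sub_self]

lemma PermOK.row (hh : 0 < h) (hN : h * N = 2 * π) {a a' : Fin d → Fin N} (c : Fin d → Fin L)
    (haa : a ≠ a') : PermOK V0 p h A (Equiv.swap ((a, c) : Idx d N L) (a', c)) := by
  obtain ⟨i0, -⟩ := Function.ne_iff.1 haa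
  refine PermOK.of_swp hh hN (by simpa using haa) ?_
  have e : cr h A ((a', c) : Idx d N L) - cr h A (a, c) =
      ((cr h A ((a', c) : Idx d N L)).1 - (cr h A ((a, c) : Idx d N L)).1, 0) := by
    ext k <;> simp [cr]
  rw [e]
  refine sst_row i0 (fun k => (cr_bd hh hN (a k)).1) (fun k => (cr_bd hh hN (a k)).2) (fun k => ?_)
    (fun k => ?_) fun q h1 h2 => ?_
  · have := (cr_bd hh hN (a' k)).1
    simp only [cr, Pi.sub_apply]
    linarith
  · have := (cr_bd hh hN (a' k)).2
    simp only [cr, hv, Pi.sub_apply, Pi.add_apply]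
    linarith
  · refine haa (cell_q (q := q) hh h1 fun k => ?_)
    have := h2 k
    simp only [cr, hv, Pi.sub_apply, Pi.add_apply] at this
    constructor <;> linarith

lemma PermOK.col (hh : 0 < h) (hN : h * N = 2 * π) (a : Fin d → Fin N) {c c' : Fin d → Fin L}
    (haa : c ≠ c') : PermOK V0 p h A (Equiv.swap ((a, c) : Idx d N L) (a, c')) := by
  obtain ⟨i0, -⟩ := Function.ne_iff.1 haa
  refine PermOK.of_swp hh hN (by simpa using haa) ?_
  have e : cr h A ((a, c') : Idx d N L) - cr h A (a, c) =
      (0, (cr h A ((a, c') : Idx d N L)).2 - (cr h A ((a, c) : Idx d N L)).2) := by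
    ext k <;> simp [cr]
  rw [e]
  refine sst_col i0 (fun k => (cr_bd hh hN (a k)).1) (fun k => (cr_bd hh hN (a k)).2) fun q h1 h2 => ?_
  refine haa (cell_p (q := q) hh h1 fun k => ?_)
  have := h2 k
  simp only [cr, hv, Pi.sub_apply, Pi.add_apply] at this
  constructor <;> linarith

lemma PermOK.swap (hh : 0 < h) (hN : h * N = 2 * π) (i j : Idx d N L) (hij : i ≠ j) :
    PermOK V0 p h A (Equiv.swap i j) := by
  obtain ⟨a, c⟩ := i
  obtain ⟨a', c'⟩ := j
  by_cases h1 : a = a'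
  · subst h1
    exact PermOK.col hh hN a (fun e => hij (by rw [e]))
  · by_cases h2 : c = c'
    · subst h2
      exact PermOK.row hh hN c h1
    · have e := Equiv.swap_mul_swap_mul_swap (x := ((a, c) : Idx d N L)) (y := (a', c)) (z := (a', c'))
        (by simpa using h1) (by simp [h1])
      rw [Equiv.swap_comm, ← e]
      exact ((PermOK.col hh hN a' h2).mul (PermOK.row hh hN c h1)).mul (PermOK.col hh hN a' h2)

lemma PermOK.all (hh : 0 < h) (hN : h * N = 2 * π) (σ : Equiv.Perm (Idx d N L)) : PermOK V0 p h A σ := by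
  classical
  induction σ using Equiv.Perm.swap_induction_on with
  | one => exact PermOK.one
  | swap_mul f x y hxy ih => exact (PermOK.swap hh hN x y hxy).mul ih

end TL
end

open MeasureTheory Real
set_option autoImplicit false
set_option linter.all false
set_option linter.unusedSimpArgs false
set_option linter.unusedVariables false

noncomputable section
namespace TL
variable {d : ℕ}
open Filter Topology

/-! ### Approximation of sets by mesh cubes -/
def GG {N L : ℕ} (h A : ℝ) (S : Finset (Idx d N L)) : Set (Phase d) := ⋃ i ∈ S, Cb h A i

variable {N L : ℕ} {h A : ℝ}

lemma mem_GG {S : Finset (Idx d N L)} {z : Phase d} : z ∈ GG h A S ↔ ∃ i ∈ S, z ∈ Cb h A i := by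
  simp [GG]

lemma measurableSet_Cb (i : Idx d N L) : MeasurableSet (Cb h A i) :=
  measurableSet_Uqp _ _ _ _

lemma measurableSet_GG (S : Finset (Idx d N L)) : MeasurableSet (GG h A S) :=
  Finset.measurableSet_biUnion _ fun i _ => measurableSet_Cb i

lemma volQ_Cb (hh : 0 < h) (hN : h * N = 2 * π) (i : Idx d N L) : volQ d (Cb h A i) = volume (Cb h A i) := by
  rw [volQ, Measure.restrict_apply (measurableSet_Cb i), Set.inter_eq_left.2]
  exact fun z hz => (Cb_int hh hN hz).mem

lemma volume_Cb_eq (i j : Idx d N L) : volume (Cb h A i) = volume (Cb h A j) := by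
  have e : Cb h A j = (fun z => z + (-(cr h A j - cr h A i))) ⁻¹' Cb h A i := by
    ext z
    rw [Set.mem_preimage, ← sub_eq_add_neg, Cb_shift_iff]
  rw [e, measure_preimage_add_right]

lemma volQ_GG (hh : 0 < h) (hN : h * N = 2 * π) : ∃ v : ENNReal, ∀ S : Finset (Idx d N L),
    volQ d (GG h A S) = S.card * v := by
  classical
  by_cases hne : Nonempty (Idx d N L)
  · obtain ⟨i0⟩ := hne
    refine ⟨volume (Cb h A i0), fun S => ?_⟩
    rw [GG, measure_biUnion_finset]
    · rw [Finset.sum_congr rfl (fun i _ => (volQ_Cb hh hN i).trans (volume_Cb_eq i i0))]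
      simp
    · intro i _ j _ hij
      exact Set.disjoint_left.2 fun z h1 h2 => hij (Cb_unique hh h1 h2)
    · exact fun i _ => measurableSet_Cb i
  · refine ⟨0, fun S => ?_⟩
    have : S = ∅ := by
      ext i; exact (hne ⟨i⟩).elim
    subst this
    simp [GG]

lemma cell_exists (hh : 0 < h) {M : ℕ} {x : ℝ} (h0 : 0 ≤ x) (h1 : x < h * M) (h2 : ∀ n : ℕ, x ≠ h * n) :
    ∃ a : Fin M, h * (a : ℕ) < x ∧ x < h * (a : ℕ) + h := by
  have e0 : 0 ≤ x / h := by positivity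
  have e1 := Nat.floor_le e0
  have e2 := Nat.lt_floor_add_one (x / h)
  rw [le_div_iff₀ hh] at e1
  rw [div_lt_iff₀ hh] at e2
  have e3 : h * (⌊x / h⌋₊ : ℕ) < x := lt_of_le_of_ne (by linarith) (h2 _).symm
  refine ⟨⟨⌊x / h⌋₊, ?_⟩, e3, by push_cast; linarith⟩
  have : h * (⌊x / h⌋₊ : ℕ) < h * M := e3.trans h1
  have := lt_of_mul_lt_mul_left this hh.le
  exact_mod_cast this

def walls (d : ℕ) (h A : ℝ) : Set (Phase d) :=
  (⋃ (k : Fin d) (n : ℕ), {z : Phase d | z.1 k = h * n}) ∪ ⋃ (k : Fin d) (n : ℕ), {z : Phase d | z.2 k = h * n - A}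

lemma volume_walls : volume (walls d h A) = 0 := by
  refine measure_union_null ?_ ?_
  · exact measure_iUnion_null fun k => measure_iUnion_null fun n => volume_wall k _
  · exact measure_iUnion_null fun k => measure_iUnion_null fun n => volume_wall2 k _

lemma Cb_cover (hh : 0 < h) (hN : h * N = 2 * π) (hL : 2 * A ≤ h * L) {z : Phase d} (hz : IntQ z)
    (hA : ∀ k, |z.2 k| < A) (hw : z ∉ walls d h A) : ∃ i : Idx d N L, z ∈ Cb h A i := by
  simp only [walls, Set.mem_union, Set.mem_iUnion, Set.mem_setOf_eq, not_or, not_exists] at hw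
  have h1 : ∀ k, ∃ a : Fin N, h * (a : ℕ) < z.1 k ∧ z.1 k < h * (a : ℕ) + h := fun k =>
    cell_exists hh (hz k).1.le (by rw [hN]; exact (hz k).2) (hw.1 k)
  have h2 : ∀ k, ∃ a : Fin L, h * (a : ℕ) < z.2 k + A ∧ z.2 k + A < h * (a : ℕ) + h := fun k => by
    have := abs_lt.1 (hA k)
    refine cell_exists hh (by linarith) (by linarith) fun n e => hw.2 k n ?_
    linarith
  choose a ha using h1
  choose b hb using h2
  refine ⟨(a, b), mem_Cb.2 ⟨ha, fun k => ?_⟩⟩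
  have := hb k
  constructor <;> simp only <;> linarith

lemma Cb_dist (hh : 0 < h) {i : Idx d N L} {z w : Phase d} (hz : z ∈ Cb h A i) (hw : w ∈ Cb h A i) :
    dist z w ≤ h := by
  rw [mem_Cb] at hz hw
  rw [Prod.dist_eq, max_le_iff, dist_pi_le_iff hh.le, dist_pi_le_iff hh.le]
  refine ⟨fun k => ?_, fun k => ?_⟩
  · have a := hz.1 k; have b := hw.1 k
    rw [Real.dist_eq, abs_le]; constructor <;> linarith
  · have a := hz.2 k; have b := hw.2 k
    rw [Real.dist_eq, abs_le]; constructor <;> linarith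

lemma mesh_approx {J : Type*} [Finite J] (E : J → Set (Phase d)) (hE : ∀ j, MeasurableSet (E j))
    (hd : ∀ i j, i ≠ j → Disjoint (E i) (E j)) (hfin : ∀ j, volQ d (E j) ≠ ⊤) (η : ENNReal) (hη : η ≠ 0) :
    ∃ h0 > (0:ℝ), ∃ A0 : ℝ, ∀ h A : ℝ, 0 < h → h < h0 → A0 ≤ A → ∀ N L : ℕ, h * N = 2 * π → 2 * A ≤ h * L →
      ∃ S : J → Finset (Idx d N L), (∀ i j, i ≠ j → Disjoint (S i) (S j)) ∧
        ∀ j, volQ d (GG h A (S j) \ E j) ≤ η ∧ volQ d (E j) ≤ volQ d (GG h A (S j)) + η := by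
  classical
  have key : ∀ j, ∃ K ⊆ E j ∩ {x | IntQ x}, IsCompact K ∧ volume ((E j ∩ {x | IntQ x}) \ K) < η := by
    intro j
    refine MeasurableSet.exists_isCompact_diff_lt ((hE j).inter isOpen_intQ.measurableSet) ?_ hη
    refine ne_top_of_le_ne_top (hfin j) ?_
    rw [volQ, Measure.restrict_apply (hE j)]
    exact measure_mono fun x hx => ⟨hx.1, hx.2.mem⟩
  choose K hKE hKc hK using key
  have hev1 : ∀ᶠ t in 𝓝[>] (0:ℝ), ∀ i j, i ≠ j → Disjoint (Metric.cthickening t (K i)) (Metric.cthickening t (K j)) := by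
    rw [eventually_all]; intro i
    rw [eventually_all]; intro j
    by_cases hij : i = j
    · exact Eventually.of_forall fun _ h => (h hij).elim
    have hdij : Disjoint (K i) (K j) := (hd i j hij).mono (fun x hx => (hKE i hx).1) (fun x hx => (hKE j hx).1)
    obtain ⟨δ, hδ, hD⟩ := hdij.exists_cthickenings (hKc i) (hKc j).isClosed
    filter_upwards [Ioo_mem_nhdsGT hδ] with t ht _
    exact hD.mono (Metric.cthickening_mono ht.2.le _) (Metric.cthickening_mono ht.2.le _)
  have hev2 : ∀ᶠ t in 𝓝[>] (0:ℝ), ∀ j, volume (Metric.cthickening t (K j)) ≤ volume (K j) + η := by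
    rw [eventually_all]; intro j
    have ht := (tendsto_measure_cthickening_of_isCompact (μ := (volume : Measure (Phase d))) (hKc j)).mono_left
      (nhdsWithin_le_nhds (s := Set.Ioi 0))
    have : volume (K j) < volume (K j) + η := ENNReal.lt_add_right (hKc j).measure_lt_top.ne hη
    filter_upwards [ht.eventually_lt_const this] with t h1 using h1.le
  obtain ⟨h0, hh0, hsub⟩ := mem_nhdsGT_iff_exists_Ioo_subset.1 (hev1.and hev2)
  have hb : ∃ A0 : ℝ, ∀ j, ∀ z ∈ K j, ∀ k, |z.2 k| < A0 := by
    have hc : Bornology.IsBounded (⋃ j, K j) := (isCompact_iUnion hKc).isBounded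
    obtain ⟨R, hR⟩ := hc.exists_norm_le
    refine ⟨R + 1, fun j z hz k => ?_⟩
    have e1 := hR z (Set.mem_iUnion.2 ⟨j, hz⟩)
    have e2 : |z.2 k| ≤ ‖z.2‖ := norm_le_pi_norm z.2 k
    have e3 : ‖z.2‖ ≤ ‖z‖ := norm_snd_le z
    linarith
  obtain ⟨A0, hA0⟩ := hb
  refine ⟨h0, hh0, A0, fun h A hh hlt hA N L hN hL => ?_⟩
  obtain ⟨hD, hV⟩ := hsub ⟨hh, hlt⟩
  let S : J → Finset (Idx d N L) := fun j => Finset.univ.filter fun i => (Cb h A i ∩ K j).Nonempty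
  have hSth : ∀ j, GG h A (S j) ⊆ Metric.cthickening h (K j) := by
    intro j z hz
    obtain ⟨i, hi, hzi⟩ := mem_GG.1 hz
    obtain ⟨w, hw, hwK⟩ := (Finset.mem_filter.1 hi).2
    exact Metric.mem_cthickening_of_dist_le z w h (K j) hwK (Cb_dist hh hzi hw)
  have hKS : ∀ j, K j ⊆ GG h A (S j) ∪ walls d h A := by
    intro j z hz
    by_cases hw : z ∈ walls d h A
    · exact Or.inr hw
    · obtain ⟨i, hi⟩ := Cb_cover (N := N) (L := L) hh hN hL (hKE j hz).2 (fun k => (hA0 j z hz k).trans_le hA) hw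
      exact Or.inl (mem_GG.2 ⟨i, Finset.mem_filter.2 ⟨Finset.mem_univ _, z, hi, hz⟩, hi⟩)
  refine ⟨S, fun i j hij => ?_, fun j => ⟨?_, ?_⟩⟩
  · refine Finset.disjoint_left.2 fun a h1 h2 => ?_
    obtain ⟨w, hw, hwK⟩ := (Finset.mem_filter.1 h1).2
    have w1 : w ∈ GG h A (S j) := mem_GG.2 ⟨a, h2, hw⟩
    exact Set.disjoint_left.1 (hD i j hij) (Metric.self_subset_cthickening _ hwK) (hSth j w1)
  · calc volQ d (GG h A (S j) \ E j) ≤ volume (GG h A (S j) \ E j) := volQ_le _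
      _ ≤ volume (Metric.cthickening h (K j) \ K j) :=
          measure_mono fun z hz => ⟨hSth j hz.1, fun hk => hz.2 (hKE j hk).1⟩
      _ = volume (Metric.cthickening h (K j)) - volume (K j) :=
          measure_diff (Metric.self_subset_cthickening _) (hKc j).measurableSet.nullMeasurableSet (hKc j).measure_lt_top.ne
      _ ≤ η := by rw [tsub_le_iff_left]; exact hV j
  · have e1 : volQ d (E j) ≤ volume (E j ∩ {x | IntQ x}) := by
      have : volQ d (E j) = volQ d (E j ∩ {x | IntQ x}) := by
        refine measure_congr ?_
        filter_upwards [ae_intQ (d := d)] with x hx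
        exact propext ⟨fun h => ⟨h, hx⟩, fun h => h.1⟩
      rw [this]; exact volQ_le _
    have e2 : volume (K j) ≤ volQ d (GG h A (S j)) := by
      have e3 : volQ d (GG h A (S j)) = volume (GG h A (S j)) := by
        rw [volQ, Measure.restrict_apply (measurableSet_GG _), Set.inter_eq_left.2]
        intro z hz
        obtain ⟨i, hi, hzi⟩ := mem_GG.1 hz
        exact (Cb_int hh hN hzi).mem
      rw [e3]
      calc volume (K j) ≤ volume (GG h A (S j) ∪ walls d h A) := measure_mono (hKS j)
        _ ≤ volume (GG h A (S j)) + volume (walls d h A) := measure_union_le _ _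
        _ = _ := by rw [volume_walls, add_zero]
    calc volQ d (E j) ≤ volume (E j ∩ {x | IntQ x}) := e1
      _ ≤ volume (K j ∪ ((E j ∩ {x | IntQ x}) \ K j)) := measure_mono (by rw [Set.union_diff_self]; exact Set.subset_union_right)
      _ ≤ volume (K j) + volume ((E j ∩ {x | IntQ x}) \ K j) := measure_union_le _ _
      _ ≤ _ := add_le_add e2 (hK j).le

lemma exists_perm {I J : Type*} [Fintype I] [DecidableEq I] (T T' : J → Finset I)
    (hT : ∀ i j, i ≠ j → Disjoint (T i) (T j)) (hT' : ∀ i j, i ≠ j → Disjoint (T' i) (T' j))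
    (hc : ∀ j, (T' j).card = (T j).card) : ∃ σ : Equiv.Perm I, ∀ j, ∀ i ∈ T' j, σ i ∈ T j := by
  classical
  have e : ∀ j, (T' j) ≃ (T j) := fun j => Finset.equivOfCardEq (hc j)
  have uT : ∀ {i j a}, a ∈ T i → a ∈ T j → i = j := fun {i j a} h1 h2 => by
    by_contra hne; exact Finset.disjoint_left.1 (hT i j hne) h1 h2
  have uT' : ∀ {i j a}, a ∈ T' i → a ∈ T' j → i = j := fun {i j a} h1 h2 => by
    by_contra hne; exact Finset.disjoint_left.1 (hT' i j hne) h1 h2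
  let g : J → I → I := fun j i => if hi : i ∈ T' j then (e j ⟨i, hi⟩ : I) else i
  let f : I → I := fun i => if hi : ∃ j, i ∈ T' j then g hi.choose i else i
  have hf : ∀ j i, i ∈ T' j → f i = g j i := by
    intro j i hi
    have hex : ∃ j, i ∈ T' j := ⟨j, hi⟩
    have : hex.choose = j := uT' hex.choose_spec hi
    simp only [f]
    rw [dif_pos hex, this]
  have hg : ∀ j i (hi : i ∈ T' j), g j i = (e j ⟨i, hi⟩ : I) := fun j i hi => dif_pos hi
  let s : Finset I := Finset.univ.filter fun i => ∃ j, i ∈ T' j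
  have hinj : Set.InjOn f s := by
    intro a ha b hb hab
    obtain ⟨j, hj⟩ := (Finset.mem_filter.1 ha).2
    obtain ⟨k, hk⟩ := (Finset.mem_filter.1 hb).2
    rw [hf j a hj, hf k b hk, hg j a hj, hg k b hk] at hab
    have hjk : j = k := uT (e j ⟨a, hj⟩).2 (hab ▸ (e k ⟨b, hk⟩).2)
    subst hjk
    have := (e j).injective (Subtype.ext hab)
    exact congrArg Subtype.val this
  obtain ⟨G, hG⟩ := Finset.exists_equiv_extend_of_card_eq (t := (Finset.univ : Finset I)) (by simp)
    (Finset.subset_univ _) hinj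
  refine ⟨G.trans (Equiv.subtypeUnivEquiv (fun x => Finset.mem_univ x)), fun j i hi => ?_⟩
  have h1 := hG i (Finset.mem_filter.2 ⟨Finset.mem_univ _, j, hi⟩)
  show (G i : I) ∈ T j
  rw [h1, hf j i hi, hg j i hi]
  exact (e j ⟨i, hi⟩).2
end TL
end

open MeasureTheory Real
set_option autoImplicit false
set_option linter.all false
set_option linter.unusedSimpArgs false
set_option linter.unusedVariables false

noncomputable section
namespace TL
variable {d : ℕ}
open Filter Topology

lemma cube_perm (V0 : (Fin d → ℝ) → ℝ) [GoodV V0] (p : ENNReal) [GoodP p]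
    {J : Type*} [Finite J] (E F : J → Set (Phase d)) (hE : ∀ j, MeasurableSet (E j))
    (hF : ∀ j, MeasurableSet (F j)) (hEp : ∀ j x, red x ∈ E j ↔ x ∈ E j)
    (hdE : ∀ i j, i ≠ j → Disjoint (E i) (E j)) (hdF : ∀ i j, i ≠ j → Disjoint (F i) (F j))
    (hfin : ∀ j, volQ d (E j) ≠ ⊤) (heq : ∀ j, volQ d (F j) = volQ d (E j)) (η : ENNReal) (hη : η ≠ 0) :
    ∃ Ψ : Phase d → Phase d, SSt V0 p 0 Ψ ∧ ∀ j, volQ d (F j \ Ψ ⁻¹' E j) ≤ 3 * η ∧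
      volQ d (Ψ ⁻¹' E j \ F j) ≤ 3 * η := by
  classical
  obtain ⟨h0, hh0, A0, H0⟩ := mesh_approx E hE hdE hfin η hη
  obtain ⟨h1, hh1, A1, H1⟩ := mesh_approx F hF hdF (fun j => (heq j).symm ▸ hfin j) η hη
  obtain ⟨N, hN1, hN2⟩ : ∃ N : ℕ, 0 < N ∧ 2 * π / N < min h0 h1 := by
    have hm : 0 < min h0 h1 := lt_min hh0 hh1
    obtain ⟨N, hN⟩ := exists_nat_gt (2 * π / min h0 h1)
    have hNp : (0:ℝ) < N := lt_of_le_of_lt (by positivity) hN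
    refine ⟨N, by exact_mod_cast hNp, ?_⟩
    rw [div_lt_iff₀ hm] at hN
    rw [div_lt_iff₀ hNp]; linarith
  have hNp : (0:ℝ) < N := by exact_mod_cast hN1
  obtain ⟨h, hhd⟩ : ∃ h : ℝ, h = 2 * π / N := ⟨_, rfl⟩
  obtain ⟨A, hAd⟩ : ∃ A : ℝ, A = max A0 A1 := ⟨_, rfl⟩
  rw [← hhd] at hN2
  have hh : 0 < h := by rw [hhd]; positivity
  have hN : h * N = 2 * π := by rw [hhd]; field_simp
  obtain ⟨L, hL⟩ : ∃ L : ℕ, 2 * A ≤ h * L := by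
    obtain ⟨L, hL⟩ := exists_nat_ge (2 * A / h)
    refine ⟨L, ?_⟩
    rw [div_le_iff₀ hh] at hL; linarith
  obtain ⟨S, hSd, hS⟩ := H0 h A hh (hN2.trans_le (min_le_left _ _)) (hAd ▸ le_max_left _ _) N L hN hL
  obtain ⟨S', hSd', hS'⟩ := H1 h A hh (hN2.trans_le (min_le_right _ _)) (hAd ▸ le_max_right _ _) N L hN hL
  obtain ⟨v, hv⟩ := volQ_GG (d := d) (N := N) (L := L) (h := h) (A := A) hh hN
  have hT : ∀ j, ∃ T ⊆ S j, T.card = min (S j).card (S' j).card := fun j =>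
    Finset.exists_subset_card_eq (min_le_left _ _)
  have hT' : ∀ j, ∃ T ⊆ S' j, T.card = min (S j).card (S' j).card := fun j =>
    Finset.exists_subset_card_eq (min_le_right _ _)
  choose T hTs hTc using hT
  choose T' hTs' hTc' using hT'
  obtain ⟨σ, hσ⟩ := exists_perm T T' (fun i j hij => (hSd i j hij).mono (hTs i) (hTs j))
    (fun i j hij => (hSd' i j hij).mono (hTs' i) (hTs' j)) (fun j => (hTc' j).trans (hTc j).symm)
  obtain ⟨Ψ, hΨ, hΨσ⟩ := PermOK.all (V0 := V0) (p := p) (A := A) hh hN σ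
  have hadm : Adm Ψ := hΨ.1
  have GGmono : ∀ {S T : Finset (Idx d N L)}, T ⊆ S → GG h A T ⊆ GG h A S := fun hs z hz => by
    obtain ⟨i, hi, hzi⟩ := mem_GG.1 hz
    exact mem_GG.2 ⟨i, hs hi, hzi⟩
  have hmE : ∀ j, MeasurableSet (Ψ ⁻¹' E j) := fun j => hadm.meas (hE j)
  have hpre : ∀ j, volQ d (Ψ ⁻¹' E j) = volQ d (E j) := by
    intro j
    rw [← hadm.mp.measure_preimage (hE j).nullMeasurableSet]
    congr 1
    ext x
    exact (hEp j (Ψ x)).symm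
  have hA : ∀ j, volQ d (F j \ Ψ ⁻¹' E j) ≤ 3 * η := by
    intro j
    have s1 : F j \ Ψ ⁻¹' E j ⊆ (F j \ GG h A (T' j)) ∪ (fun x => red (Ψ x)) ⁻¹' (GG h A (T j) \ E j) := by
      intro x hx
      by_cases hG : x ∈ GG h A (T' j)
      · right
        obtain ⟨i, hi, hxi⟩ := mem_GG.1 hG
        have e1 := hΨσ i x hxi
        have e2 : Ψ x ∈ Cb h A (σ i) := by rw [e1]; exact Cb_shift hxi
        have e3 : red (Ψ x) = Ψ x := red_of_mem (Cb_int hh hN e2).mem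
        show red (Ψ x) ∈ GG h A (T j) \ E j
        rw [e3]
        exact ⟨mem_GG.2 ⟨_, hσ j i hi, e2⟩, hx.2⟩
      · exact Or.inl ⟨hx.1, hG⟩
    have s2 : volQ d ((fun x => red (Ψ x)) ⁻¹' (GG h A (T j) \ E j)) ≤ η := by
      rw [hadm.mp.measure_preimage ((measurableSet_GG _).diff (hE j)).nullMeasurableSet]
      exact (measure_mono (Set.diff_subset_diff_left (GGmono (hTs j)))).trans (hS j).1
    have s3 : volQ d (E j) ≤ volQ d (GG h A (T' j)) + η := by
      rw [hv, hTc']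
      have a1 := (hS j).2
      have a2 := (hS' j).2
      rw [hv] at a1 a2
      rcases min_choice (S j).card (S' j).card with e | e
      · rw [e]; exact a1
      · rw [e, ← heq]; exact a2
    have s4 : volQ d (GG h A (T' j)) ≤ volQ d (F j ∩ GG h A (T' j)) + η := by
      rw [← measure_inter_add_diff (GG h A (T' j)) (hF j), Set.inter_comm]
      refine add_le_add_right ?_ _
      exact (measure_mono (Set.diff_subset_diff_left (GGmono (hTs' j)))).trans (hS' j).1
    have s5 : volQ d (F j \ GG h A (T' j)) ≤ η + η := by
      have e := measure_inter_add_diff (μ := volQ d) (F j) (measurableSet_GG (h := h) (A := A) (T' j))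
      have hf : volQ d (F j ∩ GG h A (T' j)) ≠ ⊤ :=
        ne_top_of_le_ne_top (heq j ▸ hfin j) (measure_mono Set.inter_subset_left)
      rw [← ENNReal.add_le_add_iff_left hf, e, heq, ← add_assoc]
      exact s3.trans (add_le_add_left s4 _)
    calc volQ d (F j \ Ψ ⁻¹' E j) ≤ _ := measure_mono s1
      _ ≤ _ := measure_union_le _ _
      _ ≤ (η + η) + η := add_le_add s5 s2
      _ = 3 * η := by ring
  refine ⟨Ψ, hΨ, fun j => ⟨hA j, ?_⟩⟩
  refine le_of_eq_of_le ?_ (hA j)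
  have e1 := measure_inter_add_diff (μ := volQ d) (F j) (hmE j)
  have e2 := measure_inter_add_diff (μ := volQ d) (Ψ ⁻¹' E j) (hF j)
  have hf : volQ d (F j ∩ Ψ ⁻¹' E j) ≠ ⊤ :=
    ne_top_of_le_ne_top (heq j ▸ hfin j) (measure_mono Set.inter_subset_left)
  rw [Set.inter_comm, hpre, ← heq, ← e1] at e2
  exact (ENNReal.add_right_inj hf).1 e2

end TL
end

open MeasureTheory Real
set_option autoImplicit false
set_option linter.all false
set_option linter.unusedSimpArgs false
set_option linter.unusedVariables false

noncomputable section
namespace TL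
variable {d : ℕ}
open Filter Topology

/-! ### Sufficiency -/
lemma small_bad (p : ENNReal) [GoodP p] (C : ℝ) (hC : 0 ≤ C) (e : ℝ) (he : 0 < e) :
    ∃ θ > (0:ℝ), ∀ (f : Phase d → ℝ) (B : Set (Phase d)), MeasurableSet B → volQ d B ≤ ENNReal.ofReal θ →
      (∀ x, x ∉ B → f x = 0) → (∀ x, |f x| ≤ C) → eLpNorm f p (volQ d) ≤ ENNReal.ofReal e := by
  have hp : 0 < p.toReal := ENNReal.toReal_pos (zero_lt_one.trans_le GoodP.one_le).ne' GoodP.ne_top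
  refine ⟨(e / (C + 1)) ^ p.toReal, by positivity, fun f B hB hv h0 hb => ?_⟩
  have e1 : f = B.indicator f := by
    funext x
    by_cases hx : x ∈ B
    · rw [Set.indicator_of_mem hx]
    · rw [Set.indicator_of_notMem hx, h0 x hx]
  rw [e1, eLpNorm_indicator_eq_eLpNorm_restrict hB]
  refine (eLpNorm_le_of_ae_bound (C := C) (Eventually.of_forall hb)).trans ?_
  rw [Measure.restrict_apply_univ]
  calc volQ d B ^ p.toReal⁻¹ * ENNReal.ofReal C
      ≤ (ENNReal.ofReal ((e / (C + 1)) ^ p.toReal)) ^ p.toReal⁻¹ * ENNReal.ofReal C := by gcongr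
    _ = ENNReal.ofReal (e / (C + 1) * C) := by
        rw [← ENNReal.ofReal_rpow_of_nonneg (by positivity) hp.le, ← ENNReal.rpow_mul,
          mul_inv_cancel₀ hp.ne', ENNReal.rpow_one, ← ENNReal.ofReal_mul (by positivity)]
    _ ≤ ENNReal.ofReal e := by
        refine ENNReal.ofReal_le_ofReal ?_
        rw [div_mul_eq_mul_div, div_le_iff₀ (by positivity)]
        nlinarith

lemma map_restrict_eq {p : ENNReal} [GoodP p] {ρ0 ρ1 : Phase d → ℝ} (h0 : Tor p ρ0) (h1 : Tor p ρ1)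
    (H : ∀ μ ν : ℝ, μ < ν → volQ d {x | μ < ρ0 x ∧ ρ0 x < ν} = volQ d {x | μ < ρ1 x ∧ ρ1 x < ν}) :
    ((volQ d).map ρ0).restrict {0}ᶜ = ((volQ d).map ρ1).restrict {0}ᶜ := by
  have hU : ({0}ᶜ : Set ℝ) = ⋃ ab : {ab : ℚ × ℚ // 0 < ab.1 ∨ ab.2 < 0}, Set.Ioo (ab.1.1 : ℝ) (ab.1.2 : ℝ) := by
    ext x
    simp only [Set.mem_compl_iff, Set.mem_singleton_iff, Set.mem_iUnion]
    constructor
    · intro hx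
      rcases lt_or_gt_of_ne hx with h | h
      · obtain ⟨b, hb1, hb2⟩ := exists_rat_btwn h
        obtain ⟨a, ha⟩ := exists_rat_lt x
        exact ⟨⟨(a, b), Or.inr (by exact_mod_cast hb2)⟩, ha, hb1⟩
      · obtain ⟨a, ha1, ha2⟩ := exists_rat_btwn h
        obtain ⟨b, hb⟩ := exists_rat_gt x
        exact ⟨⟨(a, b), Or.inl (by exact_mod_cast ha1)⟩, ha2, hb⟩
    · rintro ⟨⟨⟨a, b⟩, hab⟩, hx1, hx2⟩ rfl
      simp only at hx1 hx2 hab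
      rcases hab with h | h
      · have : (0:ℝ) < a := by exact_mod_cast h
        linarith
      · have : (b:ℝ) < 0 := by exact_mod_cast h
        linarith
  have hIoo : ∀ a b : ℝ, (volQ d).map ρ0 (Set.Ioo a b) = (volQ d).map ρ1 (Set.Ioo a b) := by
    intro a b
    by_cases hab : a < b
    · rw [Measure.map_apply h0.meas measurableSet_Ioo, Measure.map_apply h1.meas measurableSet_Ioo]
      exact H a b hab
    · rw [Set.Ioo_eq_empty hab]; simp
  rw [hU, Measure.restrict_iUnion_congr]
  rintro ⟨⟨a, b⟩, hab⟩
  have hfin : (volQ d).map ρ0 (Set.Ioo (a:ℝ) b) < ⊤ := by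
    rw [Measure.map_apply h0.meas measurableSet_Ioo]
    obtain ⟨δ, hδ0, hδ⟩ : ∃ δ : NNReal, δ ≠ 0 ∧ ∀ y ∈ Set.Ioo (a:ℝ) b, (δ:ℝ) ≤ |y| := by
      rcases hab with h | h
      · have h' : (0:ℝ) < a := by exact_mod_cast h
        refine ⟨Real.toNNReal a, by simpa using h', fun y hy => ?_⟩
        rw [Real.coe_toNNReal _ h'.le]
        exact hy.1.le.trans (le_abs_self y)
      · have h' : (b:ℝ) < 0 := by exact_mod_cast h
        refine ⟨Real.toNNReal (-b), by simpa using h', fun y hy => ?_⟩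
        rw [Real.coe_toNNReal _ (by linarith)]
        have := neg_le_abs y
        have := hy.2
        linarith
    refine lt_of_le_of_lt (measure_mono ?_) (h0.memLp.meas_ge_lt_top
      (zero_lt_one.trans_le (GoodP.one_le (p := p))).ne' GoodP.ne_top hδ0)
    intro x hx
    have := hδ _ hx
    show δ ≤ ‖ρ0 x‖₊
    rw [← NNReal.coe_le_coe]
    exact this
  haveI : IsFiniteMeasure (((volQ d).map ρ0).restrict (Set.Ioo (a:ℝ) b)) :=
    ⟨by rw [Measure.restrict_apply_univ]; exact hfin⟩
  refine Real.measure_ext_Ioo_rat fun x y => ?_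
  rw [Measure.restrict_apply measurableSet_Ioo, Measure.restrict_apply measurableSet_Ioo, Set.Ioo_inter_Ioo]
  exact hIoo _ _

lemma suff (V0 : (Fin d → ℝ) → ℝ) [GoodV V0] (p : ENNReal) [GoodP p] {ρ0 ρ1 : Phase d → ℝ}
    (h0 : Tor p ρ0) (h1 : Tor p ρ1)
    (H : ∀ μ ν : ℝ, μ < ν → volQ d {x | μ < ρ0 x ∧ ρ0 x < ν} = volQ d {x | μ < ρ1 x ∧ ρ1 x < ν})
    (ε : ℝ) (hε : 0 < ε) : ∃ τ ∈ Set.Icc (0:ℝ) ε, ∃ Φ : Phase d → Phase d, Reachable (torusHam V0) τ Φ ∧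
        eLpNorm (fun x => ρ0 (Φ x) - ρ1 x) p (volQ d) < ENNReal.ofReal ε := by
  classical
  have hR := map_restrict_eq h0 h1 H
  have hp0 : p ≠ 0 := (zero_lt_one.trans_le (GoodP.one_le (p := p))).ne'
  have hpt : p ≠ ⊤ := GoodP.ne_top
  obtain ⟨e, hed⟩ : ∃ e, e = ε / 4 := ⟨_, rfl⟩
  have he : 0 < e := by rw [hed]; positivity
  have hid : MemLp (id : ℝ → ℝ) p ((volQ d).map ρ0) :=
    (memLp_map_measure_iff aestronglyMeasurable_id h0.meas.aemeasurable).2 h0.memLp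
  obtain ⟨s0, hs0, hs0m⟩ := hid.exists_simpleFunc_eLpNorm_sub_lt hpt (ε := ENNReal.ofReal e) (by simpa using he)
  obtain ⟨s, hsz, hsnz⟩ : ∃ s : SimpleFunc ℝ ℝ, s 0 = 0 ∧ ∀ x, x ≠ 0 → s x = s0 x := by
    refine ⟨SimpleFunc.piecewise {0} (measurableSet_singleton 0) (SimpleFunc.const ℝ 0) s0, ?_, fun x hx => ?_⟩
    · simp
    · simp [hx]
  have hsm : MemLp s p ((volQ d).map ρ0) := by
    refine hs0m.mono s.aestronglyMeasurable (Eventually.of_forall fun x => ?_)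
    by_cases hx : x = 0
    · subst hx; rw [hsz]; simp
    · rw [hsnz x hx]
  have hsd : eLpNorm (fun x => x - s x) p ((volQ d).map ρ0) < ENNReal.ofReal e := by
    refine lt_of_le_of_lt (eLpNorm_mono fun x => ?_) hs0
    by_cases hx : x = 0
    · subst hx; simp [hsz]
    · simp [hsnz x hx]
  have hsmeas : Measurable s := s.measurable
  have hgm : Measurable (fun x => x - s x) := measurable_id.sub hsmeas
  have hsd1 : eLpNorm (fun x => x - s x) p ((volQ d).map ρ1) < ENNReal.ofReal e := by
    have ei : (fun x => x - s x) = ({0}ᶜ : Set ℝ).indicator (fun x => x - s x) := by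
      funext x
      by_cases hx : x = 0
      · subst hx; simp [hsz]
      · rw [Set.indicator_of_mem (by simpa using hx)]
    rw [ei, eLpNorm_indicator_eq_eLpNorm_restrict (measurableSet_singleton 0).compl] at hsd ⊢
    rw [← hR]; exact hsd
  rw [eLpNorm_map_measure hgm.aestronglyMeasurable h0.meas.aemeasurable] at hsd
  rw [eLpNorm_map_measure hgm.aestronglyMeasurable h1.meas.aemeasurable] at hsd1
  let J := {c : ℝ // c ∈ s.range ∧ c ≠ 0}
  haveI : Finite J := (s.range.finite_toSet.subset (fun c (hc : c ∈ s.range ∧ c ≠ 0) => hc.1)).to_subtype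
  haveI : Fintype J := Fintype.ofFinite J
  let E : J → Set (Phase d) := fun c => ρ0 ⁻¹' (s ⁻¹' {c.1})
  let F : J → Set (Phase d) := fun c => ρ1 ⁻¹' (s ⁻¹' {c.1})
  have hlev : ∀ c : ℝ, MeasurableSet (s ⁻¹' {c}) := fun c => s.measurableSet_fiber c
  have hEm : ∀ j, MeasurableSet (E j) := fun j => h0.meas (hlev _)
  have hFm : ∀ j, MeasurableSet (F j) := fun j => h1.meas (hlev _)
  obtain ⟨M, hM⟩ := s.exists_forall_norm_le
  have hM0 : 0 ≤ M := (norm_nonneg _).trans (hM 0)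
  obtain ⟨θ, hθ, Hθ⟩ := small_bad (d := d) p (2 * M) (by positivity) e he
  have hηp : 0 < θ / (6 * (Fintype.card J + 1)) := by positivity
  obtain ⟨Ψ, hΨ, hΨb⟩ := cube_perm V0 p E F hEm hFm
    (fun j x => by show s (ρ0 (red x)) = _ ↔ s (ρ0 x) = _; rw [h0.per])
    (fun i j hij => Set.disjoint_left.2 fun x hx hy => hij (Subtype.ext (Eq.trans (Eq.symm hx) hy)))
    (fun i j hij => Set.disjoint_left.2 fun x hx hy => hij (Subtype.ext (Eq.trans (Eq.symm hx) hy)))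
    (fun j => by
      have := SimpleFunc.measure_preimage_lt_top_of_memLp hp0 hpt s hsm j.1 j.2.2
      rw [Measure.map_apply h0.meas (hlev _)] at this
      exact this.ne)
    (fun j => by
      have hs : s ⁻¹' {j.1} ⊆ ({0}ᶜ : Set ℝ) := by
        rintro x hx rfl
        exact j.2.2 (Eq.trans (Eq.symm hx) hsz)
      have := congrArg (fun m : Measure ℝ => m (s ⁻¹' {j.1})) hR
      simp only [Measure.restrict_apply (hlev _), Set.inter_eq_left.2 hs,
        Measure.map_apply h0.meas (hlev _), Measure.map_apply h1.meas (hlev _)] at this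
      exact this.symm)
    (ENNReal.ofReal (θ / (6 * (Fintype.card J + 1)))) (by simpa using hηp)
  have hadm : Adm Ψ := hΨ.1
  have hmΨ : Measurable (fun x => ρ0 (Ψ x)) := h0.meas.comp hadm.meas
  let B : Set (Phase d) := ⋃ j, ((F j \ Ψ ⁻¹' E j) ∪ (Ψ ⁻¹' E j \ F j))
  have hBm : MeasurableSet B := MeasurableSet.iUnion fun j =>
    ((hFm j).diff (hadm.meas (hEm j))).union ((hadm.meas (hEm j)).diff (hFm j))
  have hBv : volQ d B ≤ ENNReal.ofReal θ := by
    calc volQ d B ≤ ∑ j, volQ d ((F j \ Ψ ⁻¹' E j) ∪ (Ψ ⁻¹' E j \ F j)) := measure_iUnion_fintype_le _ _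
      _ ≤ ∑ j : J, ENNReal.ofReal (6 * (θ / (6 * (Fintype.card J + 1)))) := by
          refine Finset.sum_le_sum fun j _ => (measure_union_le _ _).trans ?_
          refine (add_le_add (hΨb j).1 (hΨb j).2).trans (le_of_eq ?_)
          rw [ENNReal.ofReal_mul (by norm_num), ← add_mul]
          congr 1
          norm_num
      _ = ENNReal.ofReal (Fintype.card J * (6 * (θ / (6 * (Fintype.card J + 1))))) := by
          rw [Finset.sum_const, nsmul_eq_mul, ENNReal.ofReal_mul (by positivity)]
          simp
      _ ≤ ENNReal.ofReal θ := by
          refine ENNReal.ofReal_le_ofReal ?_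
          rw [show (Fintype.card J : ℝ) * (6 * (θ / (6 * (Fintype.card J + 1)))) =
            Fintype.card J * θ / (Fintype.card J + 1) by field_simp, div_le_iff₀ (by positivity)]
          nlinarith
  have hmid : eLpNorm (fun x => s (ρ0 (Ψ x)) - s (ρ1 x)) p (volQ d) ≤ ENNReal.ofReal e := by
    refine Hθ _ B hBm hBv (fun x hx => ?_) fun x => ?_
    · have hx' : ∀ j, (Ψ x ∈ E j ↔ x ∈ F j) := by
        intro j
        simp only [B, Set.mem_iUnion, not_exists, Set.mem_union, Set.mem_diff, Set.mem_preimage] at hx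
        have := hx j
        tauto
      rw [sub_eq_zero]
      by_cases hc : s (ρ1 x) = 0
      · by_contra hne
        rw [hc] at hne
        have hc0 : s (ρ0 (Ψ x)) ≠ 0 := hne
        let j : J := ⟨s (ρ0 (Ψ x)), s.mem_range_self _, hc0⟩
        have : x ∈ F j := (hx' j).1 rfl
        exact hc0 (Eq.trans (Eq.symm this) hc)
      · let j : J := ⟨s (ρ1 x), s.mem_range_self _, hc⟩
        exact (hx' j).2 rfl
    · have a1 := hM (ρ0 (Ψ x))
      have a2 := hM (ρ1 x)
      rw [Real.norm_eq_abs] at a1 a2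
      exact (abs_sub _ _).trans (by linarith)
  obtain ⟨τ, hτ, Φ, hΦ, hΦe⟩ := hΨ.2 ρ0 h0 e he
  refine ⟨τ, ⟨hτ.1, hτ.2.trans (by rw [hed]; linarith)⟩, Φ, hΦ, ?_⟩
  have hmΦ : Measurable (fun x => ρ0 (Φ x)) := h0.meas.comp (reachable_admInv V0 hΦ).1.meas
  have b1 := sub_norm_le (p := p) hmΦ hmΨ h1.meas
  have b2 := sub_norm_le (p := p) hmΨ (hsmeas.comp hmΨ) h1.meas
  have b3 := sub_norm_le (p := p) (hsmeas.comp hmΨ) (hsmeas.comp h1.meas) h1.meas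
  have b4 : eLpNorm (fun x => ρ0 (Ψ x) - (s ∘ fun x => ρ0 (Ψ x)) x) p (volQ d) < ENNReal.ofReal e := by
    have := eLpNorm_comp_adm (p := p) (f := fun x => ρ0 x - s (ρ0 x)) (h0.meas.sub (hsmeas.comp h0.meas))
      (fun x => by rw [h0.per]) hadm
    exact lt_of_eq_of_lt this hsd
  have b5 : eLpNorm (fun x => (s ∘ ρ1) x - ρ1 x) p (volQ d) < ENNReal.ofReal e := by
    refine lt_of_eq_of_lt ?_ hsd1
    exact eLpNorm_sub_comm (s ∘ ρ1) ρ1 p (volQ d)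
  have b6 : eLpNorm (fun x => (s ∘ fun x => ρ0 (Ψ x)) x - (s ∘ ρ1) x) p (volQ d) ≤ ENNReal.ofReal e := hmid
  calc _ ≤ _ := b1
    _ < ENNReal.ofReal e + (ENNReal.ofReal e + (ENNReal.ofReal e + ENNReal.ofReal e)) := by
        refine ENNReal.add_lt_add hΦe (b2.trans_lt (ENNReal.add_lt_add b4 (b3.trans_lt ?_)))
        exact ENNReal.add_lt_add_of_le_of_lt (ne_top_of_le_ne_top ENNReal.ofReal_ne_top b6) b6 b5
    _ = ENNReal.ofReal ε := by
        rw [← ENNReal.ofReal_add he.le he.le, ← ENNReal.ofReal_add he.le (by positivity),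
          ← ENNReal.ofReal_add he.le (by positivity)]
        congr 1
        rw [hed]; ring

/-! ### Necessity -/
lemma nec_le {p : ENNReal} [GoodP p] {f : ℕ → Phase d → ℝ} {g : Phase d → ℝ} (hf : ∀ n, Measurable (f n))
    (hg : Measurable g) (hfg : Tendsto (fun n => eLpNorm (fun x => f n x - g x) p (volQ d)) atTop (𝓝 0))
    {μ ν : ℝ} {C : ENNReal} (hC : ∀ n, volQ d {x | μ < f n x ∧ f n x < ν} ≤ C) :
    volQ d {x | μ < g x ∧ g x < ν} ≤ C := by
  have hp0 : p ≠ 0 := (zero_lt_one.trans_le (GoodP.one_le (p := p))).ne'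
  have hm := tendstoInMeasure_of_tendsto_eLpNorm (μ := volQ d) (l := atTop) hp0 (fun n => (hf n).aestronglyMeasurable)
    hg.aestronglyMeasurable hfg
  obtain ⟨ns, hns, hae⟩ := hm.exists_seq_tendsto_ae
  let D : ℕ → Set (Phase d) := fun k => {x | ∀ m, k ≤ m → μ < f (ns m) x ∧ f (ns m) x < ν}
  have hD : Monotone D := fun a b hab x hx m hm => hx m (hab.trans hm)
  have h1 : volQ d {x | μ < g x ∧ g x < ν} ≤ volQ d (⋃ k, D k) := by
    refine measure_mono_ae ?_
    filter_upwards [hae] with x hx hgx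
    obtain ⟨k, hk⟩ := eventually_atTop.1 (hx.eventually (Ioo_mem_nhds hgx.1 hgx.2))
    exact Set.mem_iUnion.2 ⟨k, hk⟩
  rw [hD.measure_iUnion] at h1
  refine h1.trans (iSup_le fun k => (measure_mono fun x hx => ?_).trans (hC (ns k)))
  exact hx k le_rfl

lemma adm_level {f : Phase d → ℝ} (hf : Measurable f) (hper : ∀ x, f (red x) = f x)
    {Ψ : Phase d → Phase d} (hΨ : Adm Ψ) (μ ν : ℝ) :
    volQ d {x | μ < f (Ψ x) ∧ f (Ψ x) < ν} = volQ d {x | μ < f x ∧ f x < ν} := by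
  rw [← hΨ.mp.measure_preimage (s := {x | μ < f x ∧ f x < ν}) (hf measurableSet_Ioo).nullMeasurableSet]
  congr 1
  ext x
  show _ ↔ μ < f (red (Ψ x)) ∧ f (red (Ψ x)) < ν
  rw [hper]
  rfl

lemma nec (V0 : (Fin d → ℝ) → ℝ) [GoodV V0] (p : ENNReal) [GoodP p] {ρ0 ρ1 : Phase d → ℝ}
    (h0 : Tor p ρ0) (h1 : Tor p ρ1)
    (H : ∀ ε > (0:ℝ), ∃ τ ∈ Set.Icc (0:ℝ) ε, ∃ Φ : Phase d → Phase d, Reachable (torusHam V0) τ Φ ∧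
        eLpNorm (fun x => ρ0 (Φ x) - ρ1 x) p (volQ d) < ENNReal.ofReal ε) (μ ν : ℝ) :
    volQ d {x | μ < ρ0 x ∧ ρ0 x < ν} = volQ d {x | μ < ρ1 x ∧ ρ1 x < ν} := by
  have H' : ∀ n : ℕ, ∃ Φ : Phase d → Phase d, AdmInv Φ ∧
        eLpNorm (fun x => ρ0 (Φ x) - ρ1 x) p (volQ d) < ENNReal.ofReal (1 / ((n:ℝ) + 1)) := fun n => by
    obtain ⟨τ, _, Φ, hΦ, h⟩ := H (1 / ((n:ℝ) + 1)) (by positivity)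
    exact ⟨Φ, reachable_admInv V0 hΦ, h⟩
  choose Φ hΦ hn using H'
  have hlim : Tendsto (fun n : ℕ => ENNReal.ofReal (1 / ((n:ℝ) + 1))) atTop (𝓝 0) := by
    have := ENNReal.tendsto_ofReal (tendsto_one_div_add_atTop_nhds_zero_nat (𝕜 := ℝ))
    rwa [ENNReal.ofReal_zero] at this
  have hA : Tendsto (fun n => eLpNorm (fun x => ρ0 (Φ n x) - ρ1 x) p (volQ d)) atTop (𝓝 0) :=
    tendsto_of_tendsto_of_tendsto_of_le_of_le tendsto_const_nhds hlim (fun _ => zero_le) (fun n => (hn n).le)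
  have hadm : ∀ n, Adm (Φ n) := fun n => (hΦ n).1
  choose Φ' hadm' hl hr using fun n => (hΦ n).2
  apply le_antisymm
  · refine nec_le (p := p) (f := fun n x => ρ1 (Φ' n x)) (fun n => h1.meas.comp (hadm' n).meas) h0.meas ?_
      (fun n => (adm_level h1.meas h1.per (hadm' n) μ ν).le)
    refine hA.congr fun n => ?_
    have := eLpNorm_comp_adm (p := p) (f := fun x => ρ0 (Φ n x) - ρ1 x) ((h0.meas.comp (hadm n).meas).sub h1.meas)
      (fun x => by rw [h1.per, per_comp h0.per (hadm n)]) (hadm' n)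
    rw [← this]
    simp only [hr]
    exact eLpNorm_sub_comm ρ0 (fun x => ρ1 (Φ' n x)) p (volQ d)
  · exact nec_le (p := p) (f := fun n x => ρ0 (Φ n x)) (fun n => h0.meas.comp (hadm n).meas) h1.meas hA
      (fun n => (adm_level h0.meas h0.per (hadm n) μ ν).le)

lemma volQ_level {f : Phase d → ℝ} (hf : Measurable f) (μ ν : ℝ) :
    volQ d {x | μ < f x ∧ f x < ν} = volume ({x | μ < f x ∧ f x < ν} ∩ torusBlock d) := by
  have hm : MeasurableSet {x | μ < f x ∧ f x < ν} := hf measurableSet_Ioo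
  rw [volQ, Measure.restrict_apply hm]

end TL
end

/-- **Theorem (small-time approximate controllability of the Liouville equation on `T*𝕋^d`).**
For the torus control system (lifted to `ℝ^d × ℝ^d`)
`H_u(q,p) = |p|²/2 + V_0(q) + Σ_{j=1}^d (u_{2j−1} cos(k_j·q) + u_{2j} sin(k_j·q))` with
`V_0` smooth and `2π`-periodic, and torus densities `ρ0, ρ1` of class `L^r`: `ρ1` is
small-time approximately reachable from `ρ0` for the Liouville equation if and only if for
all `μ < ν` the Lebesgue measures of `{μ < ρ0 < ν} ∩ Q` and `{μ < ρ1 < ν} ∩ Q` coincide,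
where `Q = [0,2π)^d × ℝ^d`. -/
theorem torus_liouville_controllability
    (d : ℕ) (V0 : (Fin d → ℝ) → ℝ) (hV0 : ContDiff ℝ (⊤ : ℕ∞) V0)
    (hper : ∀ (q : Fin d → ℝ) (k : Fin d → ℤ),
      V0 (fun i => q i + 2 * Real.pi * (k i)) = V0 q)
    (r : ℝ) (hr : 1 ≤ r) (ρ0 ρ1 : Phase d → ℝ)
    (hρ0 : IsTorusDensity (ENNReal.ofReal r) ρ0)
    (hρ1 : IsTorusDensity (ENNReal.ofReal r) ρ1) :
    (∀ ε > (0:ℝ), ∃ τ ∈ Set.Icc (0:ℝ) ε, ∃ Φ : Phase d → Phase d,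
        Reachable (torusHam V0) τ Φ ∧
        eLpNorm (fun x => ρ0 (Φ x) - ρ1 x) (ENNReal.ofReal r)
            (volume.restrict (torusBlock d))
          < ENNReal.ofReal ε)
      ↔
    (∀ μ ν : ℝ, μ < ν →
        volume ({x : Phase d | μ < ρ0 x ∧ ρ0 x < ν} ∩ torusBlock d)
          = volume ({x : Phase d | μ < ρ1 x ∧ ρ1 x < ν} ∩ torusBlock d)) := by
  haveI : TL.GoodV V0 := ⟨hV0, hper⟩
  haveI : TL.GoodP (ENNReal.ofReal r) :=
    ⟨by rw [← ENNReal.ofReal_one]; exact ENNReal.ofReal_le_ofReal hr, ENNReal.ofReal_ne_top⟩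
  have t0 := TL.Tor.of hρ0
  have t1 := TL.Tor.of hρ1
  constructor
  · intro H μ ν _
    have := TL.nec V0 (ENNReal.ofReal r) t0 t1 H μ ν
    rwa [TL.volQ_level t0.meas, TL.volQ_level t1.meas] at this
  · intro H ε hε
    refine TL.suff V0 (ENNReal.ofReal r) t0 t1 (fun μ ν h => ?_) ε hε
    rw [TL.volQ_level t0.meas, TL.volQ_level t1.meas]
    exact H μ ν h
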